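/- Let d ∈ ℕ, α ∈ (0, min(2,d)) and δ ∈ (0, (d-α)/2]. For every T > 0 there exists a constant c > 0 such that for all t ∈ (0,T] and x, y ∈ ℝ^d \ {0}, p̃(t,x,y) ≥ c p(t,x,y) H(t,x) H(t,y), where H(t,x) = 1 + h_δ(x)/h_δ(t^{1/α}) and h_δ(t^{1/α}) denotes the value of the radial profile of h_δ at t^{1/α}. -/

import Mathlib

open MeasureTheory Real Set Filter RealInnerProductSpace

noncomputable section

/-- Euclidean space `ℝ^d`. -/
abbrev Ed (d : ℕ) := EuclideanSpace ℝ (Fin d)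

/-- Modified Bessel function of the second kind `K_ν(r)`. -/
def besselK (ν r : ℝ) : ℝ :=
  (1 / 2) * (r / 2) ^ ν * ∫ u in Ioi (0 : ℝ), u ^ (-ν - 1) * Real.exp (-u - r ^ 2 / (4 * u))

/-- Relativistic `α`-stable heat kernel with mass parameter `m`:
`p^m(t,x,y) = (2π)^{-d} ∫ exp(-i⟨y-x,z⟩) exp(-t(|z|²+m^{2/α})^{α/2}) dz`
(the integral is real, and equals the cosine integral below). -/
def relKernel (d : ℕ) (α m t : ℝ) (x y : Ed d) : ℝ :=
  (2 * π) ^ (-(d : ℝ)) *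
    ∫ z : Ed d, Real.cos ⟪y - x, z⟫ * Real.exp (-t * (‖z‖ ^ 2 + m ^ (2 / α)) ^ (α / 2))

/-- Fractional (`α`-stable) heat kernel `p⁰(t,x,y)`. -/
def fracKernel (d : ℕ) (α t : ℝ) (x y : Ed d) : ℝ :=
  (2 * π) ^ (-(d : ℝ)) * ∫ z : Ed d, Real.cos ⟪y - x, z⟫ * Real.exp (-t * ‖z‖ ^ α)

/-- The summands of the perturbation series. -/
def pertN (d : ℕ) (k : ℝ → Ed d → Ed d → ℝ) (q : Ed d → ℝ) : ℕ → ℝ → Ed d → Ed d → ℝ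
  | 0 => k
  | n + 1 => fun t x y =>
      ∫ s in Ioo (0 : ℝ) t, ∫ z : Ed d, pertN d k q n s x z * q z * k (t - s) z y

/-- Schrödinger perturbation of a transition density `k` by a potential `q`. -/
def pert (d : ℕ) (k : ℝ → Ed d → Ed d → ℝ) (q : Ed d → ℝ) (t : ℝ) (x y : Ed d) : ℝ :=
  ∑' n : ℕ, pertN d k q n t x y

/-- Radial profile of the potential `V_β`. -/
def VProf (d : ℕ) (α β r : ℝ) : ℝ :=
  2 ^ (α / 2) * Real.Gamma (((d : ℝ) - β) / 2) / Real.Gamma (((d : ℝ) - β - α) / 2) *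
    (besselK ((β + α) / 2) r / besselK (β / 2) r) * r ^ (-(α / 2))

/-- The potential `V_β(x)`. -/
def Vbeta (d : ℕ) (α β : ℝ) (x : Ed d) : ℝ := VProf d α β ‖x‖

/-- The Hardy constant `κ_β` for the fractional Laplacian. -/
def kappa (d : ℕ) (α β : ℝ) : ℝ :=
  2 ^ α * Real.Gamma ((β + α) / 2) * Real.Gamma (((d : ℝ) - β) / 2) /
    (Real.Gamma (β / 2) * Real.Gamma (((d : ℝ) - β - α) / 2))

/-- `h^m_β(x) = ∫_0^∞ t^{(d-α-β)/α} p^m(t,x,0) dt`. -/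
def hBetaM (d : ℕ) (α m β : ℝ) (x : Ed d) : ℝ :=
  ∫ t in Ioi (0 : ℝ), t ^ (((d : ℝ) - α - β) / α) * relKernel d α m t x 0

/-- `h_β = h^1_β`. -/
def hBeta (d : ℕ) (α β : ℝ) (x : Ed d) : ℝ := hBetaM d α 1 β x

/-- `V^m_β(x) = ((d-α-β)/α) h^m_{β+α}(x)/h^m_β(x)`. -/
def VbetaM (d : ℕ) (α m β : ℝ) (x : Ed d) : ℝ :=
  (((d : ℝ) - α - β) / α) * hBetaM d α m (β + α) x / hBetaM d α m β x

/-- The function `H⁰(t,x)`. -/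
def Hzero (d : ℕ) (α δ t : ℝ) (x : Ed d) : ℝ :=
  if δ ≤ ((d : ℝ) - α) / 2 then 1 + t ^ (δ / α) * ‖x‖ ^ (-δ)
  else 1 + t ^ (((d : ℝ) - α - δ) / α) * ‖x‖ ^ (-((d : ℝ) - α - δ))

/-- Density of the Lévy measure of the relativistic `α`-stable operator (mass 1). -/
def levyNu (d : ℕ) (α : ℝ) (x : Ed d) : ℝ :=
  2 ^ ((α - (d : ℝ)) / 2 + 1) * π ^ (-(d : ℝ) / 2) * |Real.Gamma (-α / 2)|⁻¹ *
    besselK (((d : ℝ) + α) / 2) ‖x‖ / ‖x‖ ^ (((d : ℝ) + α) / 2)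

/-! ## Laplace transforms and the stable subordinator -/

open ProbabilityTheory in
lemma laplace_ext_aux (m : Measure ℝ)
    (hf : ∀ l : ℝ, 0 < l → ∫⁻ s, ENNReal.ofReal (exp (-l * s)) ∂m ≠ ⊤) (t : ℝ) (ht : t < 1) :
    Integrable (fun s => exp (t * s)) (m.withDensity fun s => ENNReal.ofReal (exp (-s))) ∧
    mgf id (m.withDensity fun s => ENNReal.ofReal (exp (-s))) t =
      (∫⁻ s, ENNReal.ofReal (exp (-(1 - t) * s)) ∂m).toReal := by
  have hm : Measurable fun s : ℝ => ENNReal.ofReal (exp (-s)) := by fun_prop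
  have key : ∫⁻ s, ENNReal.ofReal (exp (t * s)) ∂(m.withDensity fun s => ENNReal.ofReal (exp (-s)))
      = ∫⁻ s, ENNReal.ofReal (exp (-(1 - t) * s)) ∂m := by
    rw [lintegral_withDensity_eq_lintegral_mul _ hm (by fun_prop)]
    refine lintegral_congr fun s => ?_
    simp only [Pi.mul_apply]
    rw [← ENNReal.ofReal_mul (exp_nonneg _), ← exp_add]
    congr 2; ring
  have hmeas : AEStronglyMeasurable (fun s : ℝ => exp (t * s))
    (m.withDensity fun s => ENNReal.ofReal (exp (-s))) := by fun_prop
  refine ⟨⟨hmeas, ?_⟩, ?_⟩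
  · rw [hasFiniteIntegral_iff_ofReal (ae_of_all _ fun s => exp_nonneg _), key]
    exact (hf _ (by linarith)).lt_top
  · rw [mgf]
    simp only [id]
    rw [integral_eq_lintegral_of_nonneg_ae (ae_of_all _ fun s => exp_nonneg _) hmeas, key]

open ProbabilityTheory in
/-- Uniqueness for Laplace transforms. -/
lemma laplace_ext (m n : Measure ℝ)
    (hf : ∀ l : ℝ, 0 < l → ∫⁻ s, ENNReal.ofReal (exp (-l * s)) ∂m ≠ ⊤)
    (he : ∀ l : ℝ, 0 < l → ∫⁻ s, ENNReal.ofReal (exp (-l * s)) ∂m =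
      ∫⁻ s, ENNReal.ofReal (exp (-l * s)) ∂n) : m = n := by
  have hm : Measurable fun s : ℝ => ENNReal.ofReal (exp (-s)) := by fun_prop
  have hfn : ∀ l : ℝ, 0 < l → ∫⁻ s, ENNReal.ofReal (exp (-l * s)) ∂n ≠ ⊤ :=
    fun l hl => he l hl ▸ hf l hl
  suffices h : (m.withDensity fun s => ENNReal.ofReal (exp (-s))) =
      (n.withDensity fun s => ENNReal.ofReal (exp (-s))) by
    have hz : ∀ (s : ℝ), ENNReal.ofReal (exp (-s)) ≠ 0 := fun s => by simp [exp_pos]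
    rw [← withDensity_inv_same (μ := m) hm (ae_of_all _ hz) (ae_of_all _ fun _ => ENNReal.ofReal_ne_top),
      ← withDensity_inv_same (μ := n) hm (ae_of_all _ hz) (ae_of_all _ fun _ => ENNReal.ofReal_ne_top), h]
  have fin : ∀ k : Measure ℝ, (∀ l : ℝ, 0 < l → ∫⁻ s, ENNReal.ofReal (exp (-l * s)) ∂k ≠ ⊤) →
      IsFiniteMeasure (k.withDensity fun s => ENNReal.ofReal (exp (-s))) := fun k hk => by
    refine isFiniteMeasure_withDensity ?_
    simpa using hk 1 one_pos
  set M := m.withDensity fun s => ENNReal.ofReal (exp (-s)) with hM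
  set N := n.withDensity fun s => ENNReal.ofReal (exp (-s)) with hN
  have := fin m hf
  have := fin n hfn
  have sub : ∀ k : Measure ℝ, (∀ l : ℝ, 0 < l → ∫⁻ s, ENNReal.ofReal (exp (-l * s)) ∂k ≠ ⊤) →
      {z : ℂ | z.re < 1} ⊆ {z | z.re ∈ interior (integrableExpSet id
        (k.withDensity fun s => ENNReal.ofReal (exp (-s))))} := fun k hk z hz => by
    have h1 : Iio (1 : ℝ) ⊆ integrableExpSet id (k.withDensity fun s => ENNReal.ofReal (exp (-s))) :=
      fun t ht => (laplace_ext_aux k hk t ht).1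
    exact interior_maximal h1 isOpen_Iio hz
  have hconv : Convex ℝ {z : ℂ | z.re < 1} := convex_halfSpace_re_lt 1
  have E : EqOn (complexMGF id M) (complexMGF id N) {z : ℂ | z.re < 1} := by
    refine AnalyticOnNhd.eqOn_of_preconnected_of_frequently_eq
      ((analyticOnNhd_complexMGF).mono (sub m hf)) ((analyticOnNhd_complexMGF).mono (sub n hfn))
      hconv.isPreconnected (z₀ := ((0 : ℝ) : ℂ)) (by simp) ?_
    have h_real : ∃ᶠ (x : ℝ) in nhdsWithin 0 {0}ᶜ, complexMGF id M x = complexMGF id N x := by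
      refine Eventually.frequently ?_
      have : ∀ᶠ x : ℝ in nhdsWithin 0 {0}ᶜ, x < 1 :=
        nhdsWithin_le_nhds (eventually_lt_nhds (by norm_num))
      filter_upwards [this] with x hx
      rw [complexMGF_ofReal, complexMGF_ofReal, (laplace_ext_aux m hf x hx).2,
        (laplace_ext_aux n hfn x hx).2, he _ (by linarith)]
    rw [frequently_iff_seq_forall] at h_real ⊢
    obtain ⟨xs, hx_tendsto, hx_eq⟩ := h_real
    refine ⟨fun n ↦ xs n, ?_, fun n ↦ ?_⟩
    · rw [tendsto_nhdsWithin_iff] at hx_tendsto ⊢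
      constructor
      · have := hx_tendsto.1
        exact (Complex.continuous_ofReal.tendsto 0).comp this
      · simpa using hx_tendsto.2
    · simp [hx_eq]
  refine Measure.ext_of_charFun (funext fun t => ?_)
  rw [← complexMGF_id_mul_I, ← complexMGF_id_mul_I]
  exact E (by simp)

/-- Convolution powers of a measure on the half line. -/
def convPow (ν : Measure NNReal) : ℕ → Measure NNReal
  | 0 => Measure.dirac 0
  | n + 1 => ν.conv (convPow ν n)

instance convPow_sfinite (ν : Measure NNReal) [IsFiniteMeasure ν] (n : ℕ) :
    IsFiniteMeasure (convPow ν n) := by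
  induction n with
  | zero => unfold convPow; infer_instance
  | succ n ih => unfold convPow; infer_instance

lemma laplace_convPow (ν : Measure NNReal) [IsFiniteMeasure ν] (l : ℝ) (n : ℕ) :
    ∫⁻ s, ENNReal.ofReal (exp (-l * s)) ∂(convPow ν n) =
      (∫⁻ s, ENNReal.ofReal (exp (-l * s)) ∂ν) ^ n := by
  have hm : Measurable fun s : NNReal => ENNReal.ofReal (exp (-l * s)) := by fun_prop
  induction n with
  | zero => simp [convPow]
  | succ n ih =>
    rw [convPow, Measure.lintegral_conv hm, pow_succ', ← ih]
    rw [← lintegral_mul_const _ hm]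
    refine lintegral_congr fun x => ?_
    rw [← lintegral_const_mul _ hm]
    refine lintegral_congr fun y => ?_
    rw [← ENNReal.ofReal_mul (exp_nonneg _), ← exp_add]
    congr 2; push_cast; ring

lemma compound_poisson (ν : Measure NNReal) [IsFiniteMeasure ν] :
    ∃ m : Measure NNReal, IsProbabilityMeasure m ∧ ∀ l : ℝ, 0 ≤ l →
      ∫⁻ s, ENNReal.ofReal (exp (-l * s)) ∂m =
        ENNReal.ofReal (exp (-(∫⁻ s, ENNReal.ofReal (1 - exp (-l * s)) ∂ν).toReal)) := by
  set c : ℝ := (ν univ).toReal with hc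
  set m : Measure NNReal := ENNReal.ofReal (exp (-c)) •
    Measure.sum (fun k => (ENNReal.ofReal ((Nat.factorial k : ℝ)⁻¹)) • convPow ν k) with hmdef
  have key : ∀ l : ℝ, 0 ≤ l →
      ∫⁻ s, ENNReal.ofReal (exp (-l * s)) ∂m =
        ENNReal.ofReal (exp (-(∫⁻ s, ENNReal.ofReal (1 - exp (-l * s)) ∂ν).toReal)) := by
    intro l hl
    have hle : ∀ s : NNReal, exp (-l * s) ≤ 1 := fun s => by
      rw [exp_le_one_iff]; nlinarith [s.2, mul_nonneg hl s.2, (show (s:ℝ) = s.1 from rfl)]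
    have hsum : (∫⁻ s, ENNReal.ofReal (exp (-l * s)) ∂ν) +
        (∫⁻ s, ENNReal.ofReal (1 - exp (-l * s)) ∂ν) = ν univ := by
      rw [← lintegral_add_left (by fun_prop), ← lintegral_one]
      refine lintegral_congr fun s => ?_
      rw [← ENNReal.ofReal_add (exp_nonneg _) (by linarith [hle s])]
      simp
    have hfin : ν univ ≠ ⊤ := measure_ne_top _ _
    set A := ∫⁻ s, ENNReal.ofReal (exp (-l * s)) ∂ν with hA
    set B := ∫⁻ s, ENNReal.ofReal (1 - exp (-l * s)) ∂ν with hB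
    have hAf : A ≠ ⊤ := fun h => hfin (by rw [← hsum, h, top_add])
    have hBf : B ≠ ⊤ := fun h => hfin (by rw [← hsum, h, add_top])
    have hcAB : c = A.toReal + B.toReal := by rw [hc, ← hsum, ENNReal.toReal_add hAf hBf]
    rw [hmdef, lintegral_smul_measure, lintegral_sum_measure]
    simp_rw [lintegral_smul_measure, laplace_convPow, ← hA, smul_eq_mul]
    have h1 : ∀ k : ℕ, ENNReal.ofReal ((Nat.factorial k : ℝ)⁻¹) * A ^ k =
        ENNReal.ofReal (A.toReal ^ k / (Nat.factorial k : ℝ)) := fun k => by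
      rw [div_eq_inv_mul, ENNReal.ofReal_mul (by positivity), ENNReal.ofReal_pow (by positivity),
        ENNReal.ofReal_toReal hAf]
    simp_rw [h1]
    rw [← ENNReal.ofReal_tsum_of_nonneg (fun k => by positivity)
      (Real.summable_pow_div_factorial _)]
    have h2 : ∑' k : ℕ, A.toReal ^ k / (Nat.factorial k : ℝ) = exp A.toReal := by
      rw [Real.exp_eq_exp_ℝ, NormedSpace.exp_eq_tsum_div]
    rw [h2, ← ENNReal.ofReal_mul (exp_nonneg _), ← exp_add, hcAB]
    congr 2; ring
  refine ⟨m, ⟨?_⟩, key⟩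
  have := key 0 le_rfl
  simpa using this

/-- Gamma integral in extended form. -/
lemma lint_gamma (p l : ℝ) (hp : 0 < p) (hl : 0 < l) :
    ∫⁻ v in Ioi (0:ℝ), ENNReal.ofReal (v ^ (p - 1) * exp (-l * v)) =
      ENNReal.ofReal (Real.Gamma p * l ^ (-p)) := by
  have h := Real.integral_rpow_mul_exp_neg_mul_Ioi hp hl
  have hi : Integrable (fun v : ℝ => v ^ (p - 1) * exp (-l * v)) (volume.restrict (Ioi 0)) := by
    refine Integrable.of_integral_ne_zero ?_
    simp only [neg_mul, h]
    have := Real.Gamma_pos_of_pos hp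
    positivity
  rw [← ofReal_integral_eq_lintegral_ofReal hi]
  · simp only [neg_mul, h]
    rw [mul_comm, one_div, inv_rpow hl.le, rpow_neg hl.le]
  · refine (ae_restrict_iff' measurableSet_Ioi).2 (ae_of_all _ fun v hv => ?_)
    have : (0:ℝ) < v := hv
    simp only [Pi.zero_apply]; positivity

lemma lint_rpow_Ioo (p l : ℝ) (hp : 0 < p) (hl : 0 < l) :
    ∫⁻ v in Ioo (0:ℝ) l, ENNReal.ofReal (v ^ (p - 1)) = ENNReal.ofReal (l ^ p / p) := by
  have h := integral_rpow (a := 0) (b := l) (r := p - 1) (Or.inl (by linarith))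
  have hi := (intervalIntegral.intervalIntegrable_rpow' (a := 0) (b := l) (r := p - 1) (by linarith))
  rw [intervalIntegral.integral_of_le hl.le] at h
  rw [intervalIntegrable_iff_integrableOn_Ioc_of_le hl.le] at hi
  rw [setLIntegral_congr Ioo_ae_eq_Ioc, ← ofReal_integral_eq_lintegral_ofReal hi, h]
  · congr 1
    rw [sub_add_cancel, zero_rpow hp.ne', sub_zero]
  · refine (ae_restrict_iff' measurableSet_Ioc).2 (ae_of_all _ fun v hv => ?_)
    have : (0:ℝ) < v := hv.1
    simp only [Pi.zero_apply]; positivity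

/-- The Levy-Khintchine formula for the power function. -/
lemma lint_levy (a l : ℝ) (ha : 0 < a) (ha1 : a < 1) (hl : 0 < l) :
    ∫⁻ v in Ioi (0:ℝ), ENNReal.ofReal (1 - exp (-l * v)) *
      ENNReal.ofReal (a / Real.Gamma (1 - a) * v ^ (-1 - a)) = ENNReal.ofReal (l ^ a) := by
  have hG := Real.Gamma_pos_of_pos (show 0 < 1 - a by linarith)
  have h1 : ∀ v ∈ Ioi (0:ℝ), ENNReal.ofReal (1 - exp (-l * v)) *
      ENNReal.ofReal (a / Real.Gamma (1 - a) * v ^ (-1 - a)) =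
      ∫⁻ u in Ioo (0:ℝ) l, ENNReal.ofReal (a / Real.Gamma (1 - a)) *
        ENNReal.ofReal (v ^ ((1 - a) - 1) * exp (-u * v)) := by
    intro v hv
    have hv : (0:ℝ) < v := hv
    rw [lintegral_const_mul _ (by fun_prop)]
    have h2 : ∀ u, ENNReal.ofReal (v ^ ((1 - a) - 1) * exp (-u * v)) =
        ENNReal.ofReal (v ^ (-1 - a)) * ENNReal.ofReal (v * exp (-u * v)) := fun u => by
      rw [← ENNReal.ofReal_mul (by positivity), ← mul_assoc, ← rpow_add_one hv.ne']
      congr 3; ring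
    simp_rw [h2]
    rw [lintegral_const_mul _ (by fun_prop)]
    have h3 : ∫⁻ u in Ioo (0:ℝ) l, ENNReal.ofReal (v * exp (-u * v)) =
        ENNReal.ofReal (1 - exp (-l * v)) := by
      have hd : ∀ u ∈ uIcc (0:ℝ) l, HasDerivAt (fun u => - exp (-u * v)) (v * exp (-u * v)) u := by
        intro u _
        have := (((hasDerivAt_neg' u).mul_const v).exp).neg
        convert! this using 1
        ring
      have hIntg := intervalIntegral.integral_eq_sub_of_hasDerivAt hd
        (Continuous.intervalIntegrable (by fun_prop) _ _)
      rw [intervalIntegral.integral_of_le hl.le] at hIntg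
      rw [setLIntegral_congr Ioo_ae_eq_Ioc, ← ofReal_integral_eq_lintegral_ofReal _ _, hIntg]
      · congr 1; simp; ring
      · exact ((by fun_prop : Continuous fun u : ℝ => v * exp (-u * v)).integrableOn_Icc).mono_set
          Ioc_subset_Icc_self
      · exact ae_of_all _ fun u => by positivity
    rw [h3, ENNReal.ofReal_mul (by positivity)]
    ring
  rw [setLIntegral_congr_fun measurableSet_Ioi h1, lintegral_lintegral_swap]
  · have h4 : ∀ u ∈ Ioo (0:ℝ) l, ∫⁻ v in Ioi (0:ℝ), ENNReal.ofReal (a / Real.Gamma (1 - a)) *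
        ENNReal.ofReal (v ^ ((1 - a) - 1) * exp (-u * v)) =
        ENNReal.ofReal a * ENNReal.ofReal (u ^ (a - 1)) := by
      intro u hu
      rw [lintegral_const_mul _ (by fun_prop), lint_gamma _ _ (by linarith) hu.1,
        ← ENNReal.ofReal_mul (by positivity), ← ENNReal.ofReal_mul ha.le]
      congr 1
      field_simp
      congr 1; ring
    rw [setLIntegral_congr_fun measurableSet_Ioo h4, lintegral_const_mul _ (by fun_prop),
      lint_rpow_Ioo _ _ ha hl, ← ENNReal.ofReal_mul ha.le]
    congr 1; field_simp
  · fun_prop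

lemma exists_compound_seq (a : ℝ) (ha : 0 < a) (ha1 : a < 1) :
    ∃ m : ℕ → Measure NNReal, (∀ n, IsProbabilityMeasure (m n)) ∧ ∀ l : ℝ, 0 < l →
      Tendsto (fun n => ∫ s, exp (-l * s) ∂(m n)) atTop (nhds (exp (-l ^ a))) := by
  have hG := Real.Gamma_pos_of_pos (show 0 < 1 - a by linarith)
  set F : ℝ → ENNReal := fun v => ENNReal.ofReal (a / Real.Gamma (1 - a) * v ^ (-1 - a)) with hF
  have hFm : Measurable F := by rw [hF]; fun_prop
  set ν : ℕ → Measure NNReal := fun n =>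
    ((volume.restrict (Ioi ((1:ℝ) / (n + 1)))).withDensity F).map Real.toNNReal with hν
  have hfin : ∀ n, IsFiniteMeasure (ν n) := fun n => by
    have : IsFiniteMeasure ((volume.restrict (Ioi ((1:ℝ) / (n + 1)))).withDensity F) := by
      refine isFiniteMeasure_withDensity ?_
      have h := integrableOn_Ioi_rpow_of_lt (a := -1 - a) (by linarith)
        (show (0:ℝ) < 1 / (n + 1) by positivity)
      exact ((h.const_mul (a / Real.Gamma (1 - a))).lintegral_lt_top).ne
    exact Measure.isFiniteMeasure_map _ _
  choose m hm1 hm2 using fun n => compound_poisson (ν n)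
  refine ⟨m, hm1, fun l hl => ?_⟩
  have hB : ∀ n, ∫⁻ s, ENNReal.ofReal (1 - exp (-l * s)) ∂(ν n) =
      ∫⁻ v in Ioi ((1:ℝ) / (n + 1)), ENNReal.ofReal (1 - exp (-l * v)) * F v := fun n => by
    rw [hν]
    simp only
    rw [lintegral_map (by fun_prop) (by fun_prop),
      lintegral_withDensity_eq_lintegral_mul _ hFm (by fun_prop)]
    refine setLIntegral_congr_fun measurableSet_Ioi fun v hv => ?_
    have : (0:ℝ) < v := lt_trans (by positivity) (show (1:ℝ) / (n + 1) < v from hv)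
    simp only [Pi.mul_apply]
    rw [Real.coe_toNNReal _ this.le, mul_comm]
  have hlim : Tendsto (fun n => ∫⁻ s, ENNReal.ofReal (1 - exp (-l * s)) ∂(ν n)) atTop
      (nhds (ENNReal.ofReal (l ^ a))) := by
    simp_rw [hB, ← lint_levy a l ha ha1 hl]
    have hU : (⋃ n : ℕ, Ioi ((1:ℝ) / (n + 1))) = Ioi 0 := by
      ext v
      simp only [mem_iUnion, mem_Ioi]
      constructor
      · rintro ⟨n, hn⟩
        exact lt_trans (by positivity) hn
      · intro hv
        exact exists_nat_one_div_lt hv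
    have hmono : Monotone fun n : ℕ => Ioi ((1:ℝ) / (n + 1)) := by
      intro i j hij
      refine Ioi_subset_Ioi (one_div_le_one_div_of_le (by positivity) ?_)
      gcongr
    have := tendsto_measure_iUnion_atTop
      (μ := volume.withDensity fun v => ENNReal.ofReal (1 - exp (-l * v)) * F v) hmono
    rw [hU] at this
    simpa only [withDensity_apply _ measurableSet_Ioi, Function.comp_def] using this
  have h1 : ∀ n, ∫ s, exp (-l * s) ∂(m n) =
      exp (-(∫⁻ s, ENNReal.ofReal (1 - exp (-l * s)) ∂(ν n)).toReal) := fun n => by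
    rw [integral_eq_lintegral_of_nonneg_ae (ae_of_all _ fun s => exp_nonneg _)
      (by fun_prop), hm2 n l hl.le, ENNReal.toReal_ofReal (exp_nonneg _)]
  simp_rw [h1]
  have h2 := (ENNReal.tendsto_toReal ENNReal.ofReal_ne_top).comp hlim
  rw [ENNReal.toReal_ofReal (by positivity)] at h2
  exact (continuous_exp.tendsto _).comp h2.neg

lemma exists_subordinator_unit (a : ℝ) (ha : 0 < a) (ha1 : a < 1) :
    ∃ P : ProbabilityMeasure unitInterval, ∀ l : ℝ, 0 < l →
      ∫ x, (x : ℝ) ^ l ∂(P : Measure unitInterval) = exp (-l ^ a) := by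
  obtain ⟨m, hm, hlim⟩ := exists_compound_seq a ha ha1
  have hι : Continuous fun s : NNReal => (⟨exp (-s), (exp_nonneg _),
      by rw [exp_le_one_iff]; simp⟩ : unitInterval) := by
    fun_prop
  set ι := fun s : NNReal => (⟨exp (-s), (exp_nonneg _),
      by rw [exp_le_one_iff]; simp⟩ : unitInterval) with hιdef
  set Pn : ℕ → ProbabilityMeasure unitInterval := fun n =>
    ⟨(m n).map ι, Measure.isProbabilityMeasure_map hι.measurable.aemeasurable⟩ with hPn
  set U : Ultrafilter (ProbabilityMeasure unitInterval) := (hyperfilter ℕ).map Pn with hU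
  have hconv : Tendsto Pn (hyperfilter ℕ : Filter ℕ) (nhds U.lim) := by
    have := U.le_nhds_lim
    rwa [hU, Ultrafilter.coe_map] at this
  refine ⟨U.lim, fun l hl => ?_⟩
  have hc : Continuous fun x : unitInterval => (x : ℝ) ^ l :=
    (Real.continuous_rpow_const hl.le).comp continuous_subtype_val
  have h1 := ProbabilityMeasure.tendsto_iff_forall_integral_tendsto.1 hconv
    (BoundedContinuousFunction.mkOfCompact ⟨_, hc⟩)
  simp only [BoundedContinuousFunction.mkOfCompact_apply, ContinuousMap.coe_mk] at h1
  refine tendsto_nhds_unique h1 ?_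
  have h2 : ∀ n, ∫ x, (x : ℝ) ^ l ∂(Pn n : Measure unitInterval) = ∫ s, exp (-l * s) ∂(m n) := by
    intro n
    rw [hPn]
    simp only [ProbabilityMeasure.coe_mk]
    rw [integral_map hι.measurable.aemeasurable hc.aestronglyMeasurable]
    refine integral_congr_ae (ae_of_all _ fun s => ?_)
    simp only [hιdef]
    rw [← exp_mul]; congr 1; ring
  simp_rw [h2]
  exact (hlim l hl).mono_left Nat.hyperfilter_le_atTop

/-- Existence of the stable subordinator law at time one. -/
lemma exists_subordinator (a : ℝ) (ha : 0 < a) (ha1 : a < 1) :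
    ∃ η : Measure ℝ, IsProbabilityMeasure η ∧ η (Iic 0) = 0 ∧ ∀ l : ℝ, 0 < l →
      ∫⁻ s, ENNReal.ofReal (exp (-l * s)) ∂η = ENNReal.ofReal (exp (-l ^ a)) := by
  obtain ⟨P, hP⟩ := exists_subordinator_unit a ha ha1
  have hlint : ∀ l : ℝ, 0 < l → ∫⁻ x, ENNReal.ofReal ((x : ℝ) ^ l) ∂(P : Measure unitInterval) =
      ENNReal.ofReal (exp (-l ^ a)) := fun l hl => by
    have hc : Continuous fun x : unitInterval => (x : ℝ) ^ l :=
      (Real.continuous_rpow_const hl.le).comp continuous_subtype_val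
    rw [← hP l hl, ofReal_integral_eq_lintegral_ofReal
      (hc.integrable_of_hasCompactSupport (HasCompactSupport.of_compactSpace _))]
    exact ae_of_all _ fun x => rpow_nonneg x.2.1 _
  set Q := (P : Measure unitInterval) with hQ
  have h0 : Q {0} = 0 := by
    have h1 : ∀ l : ℝ, 0 < l → ENNReal.ofReal (exp (-l ^ a)) + Q {0} ≤ 1 := fun l hl => by
      rw [← hlint l hl, ← lintegral_indicator_one (measurableSet_singleton 0),
        ← lintegral_add_right _ (measurable_one.indicator (measurableSet_singleton 0))]
      calc _ ≤ ∫⁻ _, 1 ∂Q := by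
            refine lintegral_mono fun x => ?_
            by_cases hx : x = 0
            · simp [hx, zero_rpow hl.ne']
            · simp only [mem_singleton_iff, hx, not_false_iff, indicator_of_notMem, add_zero]
              simpa using rpow_le_one x.2.1 x.2.2 hl.le
        _ = 1 := by simp
    have h2 : Tendsto (fun l : ℝ => ENNReal.ofReal (exp (-l ^ a)) + Q {0}) (nhdsWithin 0 (Ioi 0))
        (nhds (ENNReal.ofReal (exp (-0 ^ a)) + Q {0})) := by
      refine Tendsto.add_const _ (ENNReal.tendsto_ofReal ?_)
      refine (continuous_exp.tendsto _).comp (Tendsto.neg ?_)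
      exact ((Real.continuous_rpow_const ha.le).tendsto 0).mono_left nhdsWithin_le_nhds
    have h3 := le_of_tendsto h2 (eventually_nhdsWithin_of_forall fun l hl => h1 l hl)
    rw [zero_rpow ha.ne'] at h3
    simp only [neg_zero, exp_zero, ENNReal.ofReal_one] at h3
    by_contra hne
    exact absurd h3 (not_le.2 (ENNReal.lt_add_right ENNReal.one_ne_top hne))
  have h1 : Q {1} = 0 := by
    have h1 : ∀ l : ℝ, 0 < l → Q {1} ≤ ENNReal.ofReal (exp (-l ^ a)) := fun l hl => by
      rw [← hlint l hl, ← lintegral_indicator_one (measurableSet_singleton 1)]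
      refine lintegral_mono fun x => ?_
      by_cases hx : x = 1
      · simp [hx]
      · simp [hx]
    have h2 : Tendsto (fun l : ℝ => ENNReal.ofReal (exp (-l ^ a))) atTop (nhds 0) := by
      rw [← ENNReal.ofReal_zero]
      refine ENNReal.tendsto_ofReal ?_
      exact tendsto_exp_atBot.comp (tendsto_neg_atTop_atBot.comp (tendsto_rpow_atTop ha))
    have h3 := ge_of_tendsto h2 ((eventually_gt_atTop 0).mono fun l hl => h1 l hl)
    simpa using h3
  have hmlog : Measurable fun x : unitInterval => -Real.log x := by fun_prop
  refine ⟨Q.map fun x : unitInterval => -Real.log x, Measure.isProbabilityMeasure_map hmlog.aemeasurable, ?_, ?_⟩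
  · rw [Measure.map_apply hmlog measurableSet_Iic]
    refine measure_mono_null (t := {0} ∪ {1}) ?_ (measure_union_null h0 h1)
    intro x hx
    simp only [mem_preimage, mem_Iic, Left.neg_nonpos_iff] at hx
    by_contra hne
    simp only [mem_union, mem_singleton_iff, not_or] at hne
    have hx0 : (0:ℝ) < x := lt_of_le_of_ne x.2.1 fun h => hne.1 (Subtype.ext h.symm)
    have hx1 : (x:ℝ) < 1 := lt_of_le_of_ne x.2.2 fun h => hne.2 (Subtype.ext h)
    exact absurd hx (not_le.2 (Real.log_neg hx0 hx1))
  · intro l hl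
    rw [lintegral_map (by fun_prop) hmlog, ← hlint l hl]
    refine lintegral_congr_ae ?_
    have : ∀ᵐ x ∂Q, x ≠ 0 := by
      rw [ae_iff]; simpa using h0
    filter_upwards [this] with x hx
    have hx0 : (0:ℝ) < x := lt_of_le_of_ne x.2.1 fun h => hx (Subtype.ext h.symm)
    rw [rpow_def_of_pos hx0]
    congr 2; ring

/-- `η` is the law of the `a`-stable subordinator at time one. -/
structure IsSub (a : ℝ) (η : Measure ℝ) : Prop where
  prob : IsProbabilityMeasure η
  null : η (Iic 0) = 0
  lap : ∀ l : ℝ, 0 < l →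
      ∫⁻ s, ENNReal.ofReal (exp (-l * s)) ∂η = ENNReal.ofReal (exp (-l ^ a))

lemma IsSub.ae_pos {a : ℝ} {η : Measure ℝ} (h : IsSub a η) : ∀ᵐ s ∂η, 0 < s := by
  rw [ae_iff]
  simp only [not_lt]; exact h.null

lemma IsSub.sum_law {a : ℝ} {η : Measure ℝ} (h : IsSub a η) (ha : 0 < a) {t s : ℝ} (ht : 0 < t)
    (hs : 0 < s) {F : ℝ → ENNReal} (hF : Measurable F) :
    ∫⁻ u, ∫⁻ v, F (t ^ (1 / a) * u + s ^ (1 / a) * v) ∂η ∂η =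
      ∫⁻ w, F ((t + s) ^ (1 / a) * w) ∂η := by
  have := h.prob
  have hmt : Measurable fun u : ℝ => t ^ (1 / a) * u := by fun_prop
  have hms : Measurable fun u : ℝ => s ^ (1 / a) * u := by fun_prop
  have hmts : Measurable fun u : ℝ => (t + s) ^ (1 / a) * u := by fun_prop
  have L : ∀ r : ℝ, 0 < r → ∀ l : ℝ, 0 < l →
      ∫⁻ u, ENNReal.ofReal (exp (-l * u)) ∂(η.map fun u : ℝ => r ^ (1 / a) * u) =
      ENNReal.ofReal (exp (-(r * l ^ a))) := fun r hr l hl => by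
    rw [lintegral_map (by fun_prop) (by fun_prop)]
    have h1 := h.lap (l * r ^ (1 / a)) (by positivity)
    rw [mul_rpow hl.le (by positivity), ← rpow_mul hr.le, one_div_mul_cancel ha.ne', rpow_one] at h1
    rw [mul_comm r, ← h1]
    refine lintegral_congr fun u => ?_
    congr 2; ring
  have key : (η.map fun u : ℝ => t ^ (1 / a) * u).conv (η.map fun u : ℝ => s ^ (1 / a) * u) =
      η.map fun u : ℝ => (t + s) ^ (1 / a) * u := by
    have I := fun l hl => L (t + s) (by linarith) l hl
    symm
    refine laplace_ext _ _ (fun l hl => by rw [I l hl]; exact ENNReal.ofReal_ne_top) fun l hl => ?_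
    have hm : Measurable fun u : ℝ => ENNReal.ofReal (exp (-l * u)) := by fun_prop
    rw [I l hl, Measure.lintegral_conv hm]
    have : ∀ x y : ℝ, ENNReal.ofReal (exp (-l * (x + y))) =
        ENNReal.ofReal (exp (-l * x)) * ENNReal.ofReal (exp (-l * y)) := fun x y => by
      rw [← ENNReal.ofReal_mul (exp_nonneg _), ← exp_add]; congr 2; ring
    simp_rw [this]
    have h3 : ∀ x, ∫⁻ y, ENNReal.ofReal (exp (-l * x)) * ENNReal.ofReal (exp (-l * y))
        ∂(η.map fun u : ℝ => s ^ (1 / a) * u) =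
        ENNReal.ofReal (exp (-l * x)) * ENNReal.ofReal (exp (-(s * l ^ a))) := fun x => by
      rw [lintegral_const_mul _ hm, L s hs l hl]
    simp_rw [h3]
    rw [lintegral_mul_const _ hm, L t ht l hl, ← ENNReal.ofReal_mul (exp_nonneg _), ← exp_add]
    congr 2; ring
  have h4 := congrArg (fun m : Measure ℝ => ∫⁻ w, F w ∂m) key
  rw [lintegral_map hF hmts, Measure.lintegral_conv hF, lintegral_map _ hmt] at h4
  · rw [← h4]
    refine lintegral_congr fun u => ?_
    rw [lintegral_map (by fun_prop) hms]
  · exact Measurable.lintegral_prod_right' (f := fun p : ℝ × ℝ => F (p.1 + p.2))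
      (hF.comp measurable_add)

lemma IsSub.neg_moment {a : ℝ} {η : Measure ℝ} (h : IsSub a η) (ha : 0 < a) {b : ℝ} (hb : 0 < b) :
    ∫⁻ s, ENNReal.ofReal (s ^ (-b)) ∂η = ENNReal.ofReal (Real.Gamma (b / a) / (a * Real.Gamma b)) := by
  have := h.prob
  have hG := Real.Gamma_pos_of_pos hb
  have hGa := Real.Gamma_pos_of_pos (div_pos hb ha)
  have h1 : ∀ᵐ s ∂η, ENNReal.ofReal (s ^ (-b)) = ENNReal.ofReal (1 / Real.Gamma b) *
      ∫⁻ l in Ioi (0:ℝ), ENNReal.ofReal (l ^ (b - 1) * exp (-l * s)) := by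
    filter_upwards [h.ae_pos] with s hs
    have : ∀ l : ℝ, -l * s = -s * l := fun l => by ring
    simp_rw [this]
    rw [lint_gamma b s hb hs, ← ENNReal.ofReal_mul (by positivity)]
    congr 1; field_simp
  rw [lintegral_congr_ae h1, lintegral_const_mul _ (by fun_prop), lintegral_lintegral_swap]
  · have h2 : ∀ l ∈ Ioi (0:ℝ), ∫⁻ s, ENNReal.ofReal (l ^ (b - 1) * exp (-l * s)) ∂η =
        ENNReal.ofReal (l ^ (b - 1) * exp (-l ^ a)) := fun l hl => by
      have hl : (0:ℝ) < l := hl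
      simp_rw [ENNReal.ofReal_mul (show 0 ≤ l ^ (b - 1) by positivity)]
      rw [lintegral_const_mul _ (by fun_prop), h.lap l hl]
    rw [setLIntegral_congr_fun measurableSet_Ioi h2]
    have h3 := integral_rpow_mul_exp_neg_rpow ha (show -1 < b - 1 by linarith)
    rw [sub_add_cancel] at h3
    have hi : Integrable (fun l : ℝ => l ^ (b - 1) * exp (-l ^ a)) (volume.restrict (Ioi 0)) := by
      refine Integrable.of_integral_ne_zero ?_
      rw [h3]; positivity
    rw [← ofReal_integral_eq_lintegral_ofReal hi, h3, ← ENNReal.ofReal_mul (by positivity)]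
    · congr 1; field_simp
    · refine (ae_restrict_iff' measurableSet_Ioi).2 (ae_of_all _ fun v hv => ?_)
      have : (0:ℝ) < v := hv
      simp only [Pi.zero_apply]; positivity
  · fun_prop

open ProbabilityTheory in
lemma IsSub.lap_deriv {a : ℝ} {η : Measure ℝ} (h : IsSub a η) (ha : 0 < a) {l : ℝ} (hl : 0 < l) :
    ∫⁻ s, ENNReal.ofReal (exp (-l * s)) * ENNReal.ofReal s ∂η =
      ENNReal.ofReal (a * l ^ (a - 1) * exp (-l ^ a)) := by
  have := h.prob
  have hIntg : ∀ t : ℝ, t < 0 → Integrable (fun s => exp (t * s)) η := fun t ht => by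
    refine ⟨by fun_prop, ?_⟩
    rw [hasFiniteIntegral_iff_ofReal (ae_of_all _ fun s => exp_nonneg _)]
    have := h.lap (-t) (by linarith)
    rw [neg_neg] at this
    rw [this]; exact ENNReal.ofReal_lt_top
  have hmgf : ∀ t : ℝ, t < 0 → mgf id η t = exp (-(-t) ^ a) := fun t ht => by
    have h2 := h.lap (-t) (by linarith)
    rw [neg_neg] at h2
    rw [mgf]
    simp only [id]
    rw [integral_eq_lintegral_of_nonneg_ae (ae_of_all _ fun s => exp_nonneg _) (by fun_prop), h2,
      ENNReal.toReal_ofReal (exp_nonneg _)]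
  have hmem : -l ∈ interior (integrableExpSet id η) := by
    have h1 : Iio (0:ℝ) ⊆ integrableExpSet id η := fun t ht => hIntg t ht
    exact interior_maximal h1 isOpen_Iio (by simpa using hl)
  have hd := hasDerivAt_mgf hmem
  have hd2 : HasDerivAt (fun t : ℝ => exp (-(-t) ^ a)) (a * l ^ (a - 1) * exp (-l ^ a)) (-l) := by
    have h1 : HasDerivAt (fun t : ℝ => (-t) ^ a) (-1 * a * (- -l) ^ (a - 1)) (-l) :=
      (hasDerivAt_neg' (-l)).rpow_const (Or.inl (by rw [neg_neg]; exact hl.ne'))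
    convert! h1.neg.exp using 1
    simp only [Pi.neg_apply, neg_neg]; ring
  have hd3 : HasDerivAt (mgf id η) (a * l ^ (a - 1) * exp (-l ^ a)) (-l) := by
    refine hd2.congr_of_eventuallyEq ?_
    filter_upwards [Iio_mem_nhds (show -l < 0 by linarith)] with t ht using hmgf t ht
  have heq := hd.unique hd3
  simp only [id] at heq
  have hpos : 0 < a * l ^ (a - 1) * exp (-l ^ a) := by positivity
  have hi : Integrable (fun s => s * exp (-l * s)) η := by
    refine Integrable.of_integral_ne_zero ?_
    rw [heq]; exact hpos.ne'
  rw [← heq, ofReal_integral_eq_lintegral_ofReal hi]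
  · refine lintegral_congr fun s => ?_
    rw [mul_comm, ENNReal.ofReal_mul' (exp_nonneg _)]
  · filter_upwards [h.ae_pos] with s hs
    simp only [Pi.zero_apply]; positivity

/-- Steutel's identity. -/
lemma IsSub.steutel {a : ℝ} {η : Measure ℝ} (h : IsSub a η) (ha : 0 < a) (ha1 : a < 1)
    {F : ℝ → ENNReal} (hF : Measurable F) :
    ∫⁻ s, F s * ENNReal.ofReal s ∂η = ENNReal.ofReal (a / Real.Gamma (1 - a)) *
      ∫⁻ r, (∫⁻ v in Ioi (0:ℝ), F (r + v) * ENNReal.ofReal (v ^ (-a))) ∂η := by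
  have := h.prob
  have hG := Real.Gamma_pos_of_pos (show 0 < 1 - a by linarith)
  set D : ℝ → ENNReal := fun v => ENNReal.ofReal (v ^ (-a)) with hD
  have hDm : Measurable D := by rw [hD]; fun_prop
  set κ : Measure ℝ := (volume.restrict (Ioi 0)).withDensity D with hκ
  have hsf : SFinite κ := by rw [hκ]; infer_instance
  have hR : ∀ {F : ℝ → ENNReal}, Measurable F →
      ∫⁻ s, F s ∂(ENNReal.ofReal (a / Real.Gamma (1 - a)) • η.conv κ) =
      ENNReal.ofReal (a / Real.Gamma (1 - a)) *
      ∫⁻ r, (∫⁻ v in Ioi (0:ℝ), F (r + v) * ENNReal.ofReal (v ^ (-a))) ∂η := fun {F} hF => by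
    rw [lintegral_smul_measure, Measure.lintegral_conv hF, smul_eq_mul]
    congr 1
    refine lintegral_congr fun r => ?_
    rw [hκ, lintegral_withDensity_eq_lintegral_mul _ hDm (by fun_prop)]
    refine lintegral_congr fun v => ?_
    simp only [Pi.mul_apply, hD]; rw [mul_comm]
  have hLm : ∀ {F : ℝ → ENNReal}, Measurable F →
      ∫⁻ s, F s ∂(η.withDensity fun s => ENNReal.ofReal s) =
      ∫⁻ s, F s * ENNReal.ofReal s ∂η := fun {F} hF => by
    rw [lintegral_withDensity_eq_lintegral_mul _ (by fun_prop) hF]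
    refine lintegral_congr fun v => ?_
    simp only [Pi.mul_apply]; rw [mul_comm]
  rw [← hR hF, ← hLm hF]
  congr 1
  have I : ∀ l : ℝ, 0 < l → ∫⁻ s, ENNReal.ofReal (exp (-l * s))
      ∂(η.withDensity fun s => ENNReal.ofReal s) =
      ENNReal.ofReal (a * l ^ (a - 1) * exp (-l ^ a)) := fun l hl => by
    rw [hLm (by fun_prop), h.lap_deriv ha hl]
  refine laplace_ext _ _ (fun l hl => by rw [I l hl]; exact ENNReal.ofReal_ne_top) fun l hl => ?_
  rw [I l hl, hR (by fun_prop)]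
  have h1 : ∀ r v : ℝ, v ∈ Ioi (0:ℝ) → ENNReal.ofReal (exp (-l * (r + v))) * ENNReal.ofReal (v ^ (-a)) =
      ENNReal.ofReal (exp (-l * r)) * ENNReal.ofReal (v ^ ((1 - a) - 1) * exp (-l * v)) :=
    fun r v hv => by
    have hv : (0:ℝ) < v := hv
    rw [← ENNReal.ofReal_mul (by positivity), ← ENNReal.ofReal_mul (by positivity)]
    congr 1
    rw [show -l * (r + v) = -l * r + -l * v by ring, exp_add, show (1 - a) - 1 = -a by ring]
    ring
  have h2 : ∀ r, ∫⁻ v in Ioi (0:ℝ), ENNReal.ofReal (exp (-l * (r + v))) * ENNReal.ofReal (v ^ (-a)) =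
      ENNReal.ofReal (exp (-l * r)) * ENNReal.ofReal (Real.Gamma (1 - a) * l ^ (-(1 - a))) := fun r => by
    rw [setLIntegral_congr_fun measurableSet_Ioi (h1 r), lintegral_const_mul _ (by fun_prop),
      lint_gamma _ _ (by linarith) hl]
  simp_rw [h2]
  rw [lintegral_mul_const _ (by fun_prop), h.lap l hl, ← ENNReal.ofReal_mul (by positivity),
    ← ENNReal.ofReal_mul (by positivity)]
  congr 1
  field_simp
  rw [show a - 1 = -(1 - a) by ring]

lemma lint_scale {c : ℝ} (hc : 0 < c) (b : ℝ) {F : ℝ → ENNReal} (hF : Measurable F) :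
    ∫⁻ s in Ioi b, F (c * s) = ENNReal.ofReal c⁻¹ * ∫⁻ s in Ioi (c * b), F s := by
  rw [← lintegral_indicator measurableSet_Ioi, ← lintegral_indicator measurableSet_Ioi]
  have h := Real.map_volume_mul_left hc.ne'
  rw [abs_of_pos (inv_pos.2 hc)] at h
  rw [← smul_eq_mul, ← lintegral_smul_measure, ← h,
    lintegral_map (hF.indicator measurableSet_Ioi) (by fun_prop)]
  refine lintegral_congr fun s => ?_
  simp only [indicator, mem_Ioi, mul_lt_mul_iff_right₀ hc]

lemma lint_shift (r : ℝ) (G : ℝ → ENNReal) :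
    ∫⁻ v in Ioi (0:ℝ), G (r + v) = ∫⁻ u in Ioi r, G u := by
  rw [← lintegral_indicator measurableSet_Ioi, ← lintegral_indicator measurableSet_Ioi]
  rw [← lintegral_add_left_eq_self ((Ioi r).indicator G) r]
  refine lintegral_congr fun s => ?_
  simp only [indicator, mem_Ioi, lt_add_iff_pos_right]

lemma lint_reflect (u : ℝ) (G : ℝ → ENNReal) :
    ∫⁻ w in Ioo (0:ℝ) u, G (u - w) = ∫⁻ w in Ioo (0:ℝ) u, G w := by
  rw [← lintegral_indicator measurableSet_Ioo, ← lintegral_indicator measurableSet_Ioo]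
  rw [← lintegral_sub_left_eq_self ((Ioo 0 u).indicator G) u]
  refine lintegral_congr fun s => ?_
  simp only [indicator, mem_Ioo]
  congr 1
  simp only [eq_iff_iff]; constructor <;> rintro ⟨h1, h2⟩ <;> constructor <;> linarith

lemma beta_bound (a p u : ℝ) (ha1 : a < 1) (hp : -1 < p) (hu : 0 < u) :
    ∫⁻ w in Ioo (0:ℝ) u, ENNReal.ofReal ((u - w) ^ p) * ENNReal.ofReal (w ^ (-a)) ≤
      ENNReal.ofReal (1 / (p + 1) + 1 / (1 - a)) * ENNReal.ofReal (u ^ (p + 1 - a)) := by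
  have h1 : ∀ w ∈ Ioo (0:ℝ) u, ENNReal.ofReal ((u - w) ^ p) * ENNReal.ofReal (w ^ (-a)) ≤
      ENNReal.ofReal (u ^ (-a)) * ENNReal.ofReal ((u - w) ^ ((p + 1) - 1)) +
      ENNReal.ofReal (u ^ p) * ENNReal.ofReal (w ^ ((1 - a) - 1)) := by
    intro w hw
    have hw0 := hw.1
    have huw : 0 < u - w := by linarith [hw.2]
    rw [← ENNReal.ofReal_mul (by positivity), ← ENNReal.ofReal_mul (by positivity),
      ← ENNReal.ofReal_mul (by positivity), ← ENNReal.ofReal_add (by positivity) (by positivity)]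
    refine ENNReal.ofReal_le_ofReal ?_
    rw [add_sub_cancel_right, show (1 - a) - 1 = -a by ring]
    have e1 : w ^ (-a) * w ≤ u ^ (-a) * u := by
      rw [← rpow_add_one hw0.ne', ← rpow_add_one hu.ne']
      exact rpow_le_rpow hw0.le hw.2.le (by linarith)
    have e2 : (u - w) ^ p * (u - w) ≤ u ^ p * u := by
      rw [← rpow_add_one huw.ne', ← rpow_add_one hu.ne']
      exact rpow_le_rpow huw.le (by linarith) (by linarith)
    have e3 : 0 < (u - w) ^ p := by positivity
    have e4 : 0 < w ^ (-a) := by positivity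
    refine le_of_mul_le_mul_right ?_ hu
    calc (u - w) ^ p * w ^ (-a) * u = (u - w) ^ p * (w ^ (-a) * w)
          + ((u - w) ^ p * (u - w)) * w ^ (-a) := by ring
      _ ≤ (u - w) ^ p * (u ^ (-a) * u) + (u ^ p * u) * w ^ (-a) := by gcongr
      _ = _ := by ring
  refine (setLIntegral_mono (by fun_prop) h1).trans ?_
  rw [lintegral_add_left (by fun_prop), lintegral_const_mul _ (by fun_prop),
    lintegral_const_mul _ (by fun_prop),
    lint_reflect u (fun w => ENNReal.ofReal (w ^ ((p + 1) - 1))),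
    lint_rpow_Ioo _ _ (by linarith) hu, lint_rpow_Ioo _ _ (by linarith) hu,
    ← ENNReal.ofReal_mul (by positivity), ← ENNReal.ofReal_mul (by positivity)]
  have hp1 : 0 < p + 1 := by linarith
  have ha2 : 0 < 1 - a := by linarith
  rw [← ENNReal.ofReal_add (by positivity) (by positivity), ← ENNReal.ofReal_mul (by positivity)]
  refine ENNReal.ofReal_le_ofReal (le_of_eq ?_)
  have e1 : u ^ (p + 1 - a) = u ^ (-a) * u ^ (p + 1) := by rw [← rpow_add hu]; congr 1; ring
  have e2 : u ^ (p + 1 - a) = u ^ p * u ^ (1 - a) := by rw [← rpow_add hu]; congr 1; ring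
  rw [add_mul, mul_div_assoc', mul_div_assoc', ← e1, ← e2]; ring

lemma conv_bound (a p : ℝ) (ha1 : a < 1) (hp : -1 < p) {G : ℝ → ENNReal} (hG : Measurable G) :
    ∫⁻ w in Ioi (0:ℝ), (∫⁻ v in Ioi (0:ℝ), G (w + v) * ENNReal.ofReal (v ^ p)) *
        ENNReal.ofReal (w ^ (-a)) ≤
      ENNReal.ofReal (1 / (p + 1) + 1 / (1 - a)) *
        ∫⁻ u in Ioi (0:ℝ), G u * ENNReal.ofReal (u ^ (p + 1 - a)) := by
  have h1 : ∀ w, (∫⁻ v in Ioi (0:ℝ), G (w + v) * ENNReal.ofReal (v ^ p)) * ENNReal.ofReal (w ^ (-a)) =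
      ∫⁻ u in Ioi w, G u * (ENNReal.ofReal ((u - w) ^ p) * ENNReal.ofReal (w ^ (-a))) := fun w => by
    rw [← lint_shift w, ← lintegral_mul_const _ (by fun_prop)]
    refine lintegral_congr fun v => ?_
    rw [add_sub_cancel_left, mul_assoc]
  simp_rw [h1]
  have h2 : ∀ w ∈ Ioi (0:ℝ),
      ∫⁻ u in Ioi w, G u * (ENNReal.ofReal ((u - w) ^ p) * ENNReal.ofReal (w ^ (-a))) =
      ∫⁻ u in Ioi (0:ℝ), (Iio u).indicator (fun w =>
        G u * (ENNReal.ofReal ((u - w) ^ p) * ENNReal.ofReal (w ^ (-a)))) w := fun w hw => by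
    rw [← lintegral_indicator measurableSet_Ioi, ← lintegral_indicator measurableSet_Ioi]
    refine lintegral_congr fun u => ?_
    simp only [indicator, mem_Ioi, mem_Iio]
    have hw : (0:ℝ) < w := hw
    by_cases hu : w < u
    · simp [hu, hw.trans hu]
    · simp [hu]
  rw [setLIntegral_congr_fun measurableSet_Ioi h2, lintegral_lintegral_swap]
  · rw [← lintegral_const_mul _ (by fun_prop)]
    refine setLIntegral_mono (by fun_prop) fun u hu => ?_
    rw [lintegral_indicator measurableSet_Iio, Measure.restrict_restrict measurableSet_Iio,
      inter_comm, Ioi_inter_Iio, lintegral_const_mul _ (by fun_prop), mul_left_comm]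
    gcongr
    exact beta_bound a p u ha1 hp hu
  · have : Function.uncurry (fun (w u : ℝ) => (Iio u).indicator (fun w =>
        G u * (ENNReal.ofReal ((u - w) ^ p) * ENNReal.ofReal (w ^ (-a)))) w) =
        {q : ℝ × ℝ | q.1 < q.2}.indicator (fun q => G q.2 * (ENNReal.ofReal ((q.2 - q.1) ^ p) *
          ENNReal.ofReal (q.1 ^ (-a)))) := by
      ext ⟨w, u⟩; simp [Function.uncurry, indicator]
    rw [this]
    exact ((by fun_prop : Measurable fun q : ℝ × ℝ => G q.2 * (ENNReal.ofReal ((q.2 - q.1) ^ p) *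
          ENNReal.ofReal (q.1 ^ (-a)))).indicator
      (measurableSet_lt measurable_fst measurable_snd)).aemeasurable

lemma meas_shift_int {F : ℝ → ENNReal} (hF : Measurable F) (p : ℝ) :
    Measurable fun r : ℝ => ∫⁻ v in Ioi (0:ℝ), F (r + v) * ENNReal.ofReal (v ^ p) :=
  Measurable.lintegral_prod_right' (f := fun q : ℝ × ℝ => F (q.1 + q.2) * ENNReal.ofReal (q.2 ^ p))
    (by fun_prop)

lemma IsSub.steutel_iter {a : ℝ} {η : Measure ℝ} (h : IsSub a η) (ha : 0 < a) (ha1 : a < 1) (k : ℕ) :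
    ∃ C : ENNReal, C ≠ ⊤ ∧ ∀ F : ℝ → ENNReal, Measurable F →
      ∫⁻ s, F s * ENNReal.ofReal s ^ (k + 1) ∂η ≤ C * ∑ j ∈ Finset.range (k + 1),
        ∫⁻ r, (∫⁻ v in Ioi (0:ℝ), F (r + v) * ENNReal.ofReal (v ^ (k - (j + 1) * a))) ∂η := by
  have := h.prob
  induction k with
  | zero =>
    refine ⟨ENNReal.ofReal (a / Real.Gamma (1 - a)), ENNReal.ofReal_ne_top, fun F hF => ?_⟩
    simp only [zero_add, pow_one, Finset.range_one, Finset.sum_singleton, Nat.cast_zero, one_mul,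
      zero_sub]
    rw [h.steutel ha ha1 hF]
  | succ k ih =>
    obtain ⟨C, hC, hk⟩ := ih
    set c := ENNReal.ofReal (a / Real.Gamma (1 - a)) with hc
    have hp : ∀ j ∈ Finset.range (k + 1), -1 < (k:ℝ) - (j + 1) * a := fun j hj => by
      have h1 : (j:ℝ) + 1 ≤ k + 1 := by exact_mod_cast Finset.mem_range.1 hj
      nlinarith
    set B : ℕ → ENNReal := fun j => ENNReal.ofReal (1 / ((k - (j + 1) * a) + 1) + 1 / (1 - a)) with hB
    set I : (ℝ → ENNReal) → ℕ → ENNReal := fun F j =>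
      ∫⁻ r, (∫⁻ v in Ioi (0:ℝ), F (r + v) * ENNReal.ofReal (v ^ ((k + 1 : ℕ) - (j + 1) * a))) ∂η with hI
    refine ⟨C * ∑ j ∈ Finset.range (k + 1), (1 + c * B j), ?_, fun F hF => ?_⟩
    · refine ENNReal.mul_ne_top hC ?_
      refine ENNReal.sum_ne_top.2 fun j _ => ?_
      exact ENNReal.add_ne_top.2 ⟨ENNReal.one_ne_top, ENNReal.mul_ne_top ENNReal.ofReal_ne_top
        ENNReal.ofReal_ne_top⟩
    have h1 := hk (fun s => F s * ENNReal.ofReal s) (by fun_prop)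
    have h2 : ∫⁻ s, F s * ENNReal.ofReal s ^ (k + 1 + 1) ∂η =
      ∫⁻ s, F s * ENNReal.ofReal s * ENNReal.ofReal s ^ (k + 1) ∂η :=
      lintegral_congr fun s => by ring
    rw [h2]
    refine h1.trans ?_
    rw [mul_assoc C]
    gcongr
    rw [Finset.sum_mul]
    refine Finset.sum_le_sum fun j hj => ?_
    have hj2 : I F j + c * B j * I F (j + 1) ≤ (1 + c * B j) *
        ∑ i ∈ Finset.range (k + 1 + 1), I F i := by
      rw [add_mul, one_mul]
      have hjr := Finset.mem_range.1 hj
      gcongr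
      · exact Finset.single_le_sum (f := I F) (fun i _ => zero_le) (Finset.mem_range.2 (by omega))
      · exact Finset.single_le_sum (f := I F) (fun i _ => zero_le) (Finset.mem_range.2 (by omega))
    refine le_trans ?_ hj2
    set p : ℝ := (k:ℝ) - (j + 1) * a with hpdef
    have e1 : ∀ᵐ r ∂η, (∫⁻ v in Ioi (0:ℝ), F (r + v) * ENNReal.ofReal (r + v) * ENNReal.ofReal (v ^ p)) =
        (∫⁻ v in Ioi (0:ℝ), F (r + v) * ENNReal.ofReal (v ^ ((k + 1 : ℕ) - (j + 1) * a))) +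
        (∫⁻ v in Ioi (0:ℝ), F (r + v) * ENNReal.ofReal (v ^ p)) * ENNReal.ofReal r := by
      filter_upwards [h.ae_pos] with r hr
      rw [← lintegral_mul_const _ (by fun_prop), ← lintegral_add_left (by fun_prop)]
      refine setLIntegral_congr_fun measurableSet_Ioi fun v hv => ?_
      have hv : (0:ℝ) < v := hv
      rw [ENNReal.ofReal_add hr.le hv.le, show (((k + 1 : ℕ) : ℝ) - (j + 1) * a) = p + 1 by
        rw [hpdef]; push_cast; ring, rpow_add_one hv.ne', ENNReal.ofReal_mul (by positivity)]
      ring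
    rw [lintegral_congr_ae e1, lintegral_add_left (meas_shift_int hF _)]
    gcongr
    rw [h.steutel ha ha1 (meas_shift_int hF p), mul_assoc]
    gcongr
    rw [hI]
    simp only
    rw [← lintegral_const_mul _ (meas_shift_int hF _)]
    refine lintegral_mono fun r => ?_
    have := conv_bound a p ha1 (hp j hj) (G := fun u => F (r + u)) (by fun_prop)
    simp only [← add_assoc] at this
    refine this.trans (le_of_eq ?_)
    rw [hB]
    simp only
    congr 1
    refine lintegral_congr fun u => ?_
    rw [show p + 1 - a = ((k + 1 : ℕ) : ℝ) - (((j + 1 : ℕ) : ℝ) + 1) * a by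
      rw [hpdef]; push_cast; ring]

/-- Upper bound for the law of the subordinator. -/
lemma IsSub.upper {a : ℝ} {η : Measure ℝ} (h : IsSub a η) (ha : 0 < a) (ha1 : a < 1) :
    ∃ (k : ℕ) (C : ENNReal), C ≠ ⊤ ∧ ∀ F : ℝ → ENNReal, Measurable F → ∀ t : ℝ, 0 < t →
      ∫⁻ s, F (t ^ (1 / a) * s) ∂η ≤ C * ∑ j ∈ Finset.range (k + 1),
        ENNReal.ofReal (t ^ (j + 1)) * ∫⁻ s in Ioi (0:ℝ), F s * ENNReal.ofReal (s ^ (-1 - (j + 1) * a)) := by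
  have := h.prob
  obtain ⟨k, hk⟩ := exists_nat_ge (1 / (1 - a))
  rw [div_le_iff₀ (by linarith)] at hk
  obtain ⟨C, hC, hI⟩ := h.steutel_iter ha ha1 k
  have key : ∀ F : ℝ → ENNReal, Measurable F → ∫⁻ s, F s ∂η ≤ C * ∑ j ∈ Finset.range (k + 1),
        ∫⁻ s in Ioi (0:ℝ), F s * ENNReal.ofReal (s ^ (-1 - (j + 1) * a)) := by
    intro F hF
    have h1 := hI (fun s => F s * ENNReal.ofReal (s ^ (-(k:ℝ) - 1))) (by fun_prop)
    have h2 : ∫⁻ s, F s * ENNReal.ofReal (s ^ (-(k:ℝ) - 1)) * ENNReal.ofReal s ^ (k + 1) ∂η =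
        ∫⁻ s, F s ∂η := by
      refine lintegral_congr_ae ?_
      filter_upwards [h.ae_pos] with s hs
      rw [mul_assoc, ← ENNReal.ofReal_pow hs.le, ← ENNReal.ofReal_mul (by positivity),
        ← rpow_natCast, ← rpow_add hs]
      simp
    rw [h2] at h1
    refine h1.trans ?_
    refine mul_le_mul_right (Finset.sum_le_sum fun j hj => ?_) C
    have hj1 : (j:ℝ) + 1 ≤ k + 1 := by exact_mod_cast Finset.mem_range.1 hj
    have hp : 0 ≤ (k:ℝ) - (j + 1) * a := by nlinarith
    have h3 : ∀ᵐ r ∂η, (∫⁻ v in Ioi (0:ℝ), F (r + v) * ENNReal.ofReal ((r + v) ^ (-(k:ℝ) - 1)) *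
        ENNReal.ofReal (v ^ ((k:ℝ) - (j + 1) * a))) ≤
        ∫⁻ s in Ioi (0:ℝ), F s * ENNReal.ofReal (s ^ (-1 - (j + 1) * a)) := by
      filter_upwards [h.ae_pos] with r hr
      calc _ ≤ ∫⁻ v in Ioi (0:ℝ), F (r + v) * ENNReal.ofReal ((r + v) ^ (-1 - (j + 1) * a)) := by
            refine setLIntegral_mono (by fun_prop) fun v hv => ?_
            have hv : (0:ℝ) < v := hv
            rw [mul_assoc, ← ENNReal.ofReal_mul (by positivity)]
            gcongr
            calc (r + v) ^ (-(k:ℝ) - 1) * v ^ ((k:ℝ) - (j + 1) * a) ≤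
                (r + v) ^ (-(k:ℝ) - 1) * (r + v) ^ ((k:ℝ) - (j + 1) * a) := by
                  gcongr; linarith
              _ = _ := by rw [← rpow_add (by positivity)]; congr 1; ring
        _ = ∫⁻ s in Ioi r, F s * ENNReal.ofReal (s ^ (-1 - (j + 1) * a)) :=
            lint_shift r fun s => F s * ENNReal.ofReal (s ^ (-1 - (j + 1) * a))
        _ ≤ _ := lintegral_mono_set (Ioi_subset_Ioi hr.le)
    calc _ ≤ ∫⁻ _, (∫⁻ s in Ioi (0:ℝ), F s * ENNReal.ofReal (s ^ (-1 - (j + 1) * a))) ∂η :=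
          lintegral_mono_ae h3
      _ = _ := by simp
  refine ⟨k, C, hC, fun F hF t ht => ?_⟩
  refine (key (fun s => F (t ^ (1 / a) * s)) (by fun_prop)).trans ?_
  gcongr with j hj
  set S := t ^ (1 / a) with hS
  have hSp : 0 < S := by positivity
  have h4 := lint_scale hSp 0 (F := fun s => F s * ENNReal.ofReal ((S⁻¹ * s) ^ (-1 - (j + 1) * a)))
    (by fun_prop)
  simp only [inv_mul_cancel_left₀ hSp.ne'] at h4
  rw [h4, mul_zero, ← lintegral_const_mul _ (by fun_prop), ← lintegral_const_mul _ (by fun_prop)]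
  refine setLIntegral_mono (by fun_prop) fun s hs => le_of_eq ?_
  have hs : (0:ℝ) < s := hs
  rw [mul_left_comm, mul_left_comm (ENNReal.ofReal (t ^ (j + 1)))]
  congr 1
  rw [← ENNReal.ofReal_mul (by positivity), ← ENNReal.ofReal_mul (by positivity)]
  congr 1
  rw [mul_rpow (by positivity) hs.le, ← mul_assoc]
  congr 1
  rw [inv_rpow hSp.le, ← rpow_neg hSp.le, ← rpow_neg_one, ← rpow_add hSp, hS, ← rpow_mul ht.le,
    ← rpow_natCast]
  congr 1
  push_cast; field_simp; ring

/-- Lower bound for the law of the subordinator. -/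
lemma IsSub.lower {a : ℝ} {η : Measure ℝ} (h : IsSub a η) (ha : 0 < a) (ha1 : a < 1) {M : ℝ} (hM : 0 < M) :
    ∀ F : ℝ → ENNReal, Measurable F → ∀ t : ℝ, 0 < t →
      ENNReal.ofReal (a / Real.Gamma (1 - a)) * η (Iic M) * ENNReal.ofReal t *
        ∫⁻ s in Ioi (M * t ^ (1 / a)), F s * ENNReal.ofReal (s ^ (-1 - a)) ≤
      ∫⁻ s, F (t ^ (1 / a) * s) ∂η := by
  have := h.prob
  have key : ∀ F : ℝ → ENNReal, Measurable F →
      ENNReal.ofReal (a / Real.Gamma (1 - a)) * η (Iic M) *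
        ∫⁻ s in Ioi M, F s * ENNReal.ofReal (s ^ (-1 - a)) ≤ ∫⁻ s, F s ∂η := by
    intro F hF
    have h1 := h.steutel ha ha1 (F := fun s => F s * ENNReal.ofReal (s ^ (-1:ℝ))) (by fun_prop)
    have h2 : ∫⁻ s, F s * ENNReal.ofReal (s ^ (-1:ℝ)) * ENNReal.ofReal s ∂η = ∫⁻ s, F s ∂η := by
      refine lintegral_congr_ae ?_
      filter_upwards [h.ae_pos] with s hs
      rw [mul_assoc, ← ENNReal.ofReal_mul (by positivity), ← rpow_add_one hs.ne']
      simp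
    rw [h2] at h1
    rw [h1, mul_assoc]
    gcongr
    calc η (Iic M) * ∫⁻ s in Ioi M, F s * ENNReal.ofReal (s ^ (-1 - a)) =
        ∫⁻ r in Iic M, (∫⁻ s in Ioi M, F s * ENNReal.ofReal (s ^ (-1 - a))) ∂η := by
          rw [setLIntegral_const, mul_comm]
      _ ≤ ∫⁻ r in Iic M, (∫⁻ v in Ioi (0:ℝ), F (r + v) * ENNReal.ofReal ((r + v) ^ (-1:ℝ)) *
            ENNReal.ofReal (v ^ (-a))) ∂η := by
          refine lintegral_mono_ae ?_
          filter_upwards [ae_restrict_of_ae h.ae_pos, ae_restrict_mem measurableSet_Iic] with r hr hrM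
          calc _ ≤ ∫⁻ s in Ioi r, F s * ENNReal.ofReal (s ^ (-1 - a)) :=
                lintegral_mono_set (Ioi_subset_Ioi hrM)
            _ = ∫⁻ v in Ioi (0:ℝ), F (r + v) * ENNReal.ofReal ((r + v) ^ (-1 - a)) :=
                (lint_shift r fun s => F s * ENNReal.ofReal (s ^ (-1 - a))).symm
            _ ≤ _ := by
              refine setLIntegral_mono (by fun_prop) fun v hv => ?_
              have hv : (0:ℝ) < v := hv
              rw [mul_assoc, ← ENNReal.ofReal_mul (by positivity)]
              gcongr
              rw [show -1 - a = -1 + -a by ring, rpow_add (by positivity)]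
              exact mul_le_mul_of_nonneg_left
                (rpow_le_rpow_of_nonpos hv (by linarith) (by linarith)) (by positivity)
      _ ≤ _ := setLIntegral_le_lintegral _ _
  intro F hF t ht
  refine le_trans (le_of_eq ?_) (key (fun s => F (t ^ (1 / a) * s)) (by fun_prop))
  set S := t ^ (1 / a) with hS
  have hSp : 0 < S := by positivity
  have h4 := lint_scale hSp M (F := fun s => F s * ENNReal.ofReal ((S⁻¹ * s) ^ (-1 - a)))
    (by fun_prop)
  simp only [inv_mul_cancel_left₀ hSp.ne'] at h4
  have hSM : S * M = M * S := mul_comm _ _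
  have hs0 : ∀ s : ℝ, 0 < s → ENNReal.ofReal t * ENNReal.ofReal (s ^ (-1 - a)) =
      ENNReal.ofReal S⁻¹ * ENNReal.ofReal ((S⁻¹ * s) ^ (-1 - a)) := fun s hs => by
    rw [← ENNReal.ofReal_mul (by positivity), ← ENNReal.ofReal_mul (by positivity)]
    congr 1
    rw [mul_rpow (by positivity) hs.le, ← mul_assoc]
    congr 1
    rw [inv_rpow hSp.le, ← rpow_neg hSp.le, ← rpow_neg_one, ← rpow_add hSp, hS, ← rpow_mul ht.le]
    conv_lhs => rw [← rpow_one t]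
    congr 1
    field_simp; ring
  rw [h4, hSM, mul_assoc]
  congr 1
  rw [← lintegral_const_mul _ (by fun_prop), ← lintegral_const_mul _ (by fun_prop)]
  refine setLIntegral_congr_fun measurableSet_Ioi fun s hs => ?_
  have hs : (0:ℝ) < s := lt_trans (by positivity) (show M * S < s from hs)
  rw [mul_left_comm, hs0 s hs, mul_left_comm]

/-- Gaussian kernel with killing. -/
def Gk (d : ℕ) (s r : ℝ) : ℝ := (4 * π * s) ^ (-(d : ℝ) / 2) * exp (-s - r ^ 2 / (4 * s))

lemma Gk_nonneg (d : ℕ) {s : ℝ} (hs : 0 ≤ s) (r : ℝ) : 0 ≤ Gk d s r := by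
  unfold Gk; positivity

lemma Gk_pos (d : ℕ) {s : ℝ} (hs : 0 < s) (r : ℝ) : 0 < Gk d s r := by
  unfold Gk; positivity

@[fun_prop]
lemma Gk_meas (d : ℕ) : Measurable fun q : ℝ × ℝ => Gk d q.1 q.2 := by
  unfold Gk; fun_prop

lemma Gk_meas2 {Ω : Type*} [MeasurableSpace Ω] (d : ℕ) {f g : Ω → ℝ} (hf : Measurable f)
    (hg : Measurable g) : Measurable fun q => Gk d (f q) (g q) :=
  (Gk_meas d).comp (hf.prodMk hg)

lemma lint_gauss (d : ℕ) {b : ℝ} (hb : 0 < b) :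
    ∫⁻ v : Ed d, ENNReal.ofReal (exp (-b * ‖v‖ ^ 2)) = ENNReal.ofReal ((π / b) ^ ((d : ℝ) / 2)) := by
  have h := GaussianFourier.integral_rexp_neg_mul_sq_norm (V := Ed d) hb
  have hi : Integrable fun v : Ed d => exp (-b * ‖v‖ ^ 2) := by
    refine Integrable.of_integral_ne_zero ?_
    rw [h]; positivity
  rw [← ofReal_integral_eq_lintegral_ofReal hi (ae_of_all _ fun _ => exp_nonneg _), h]
  simp

lemma Gk_mass (d : ℕ) {s : ℝ} (hs : 0 < s) (x : Ed d) :
    ∫⁻ y : Ed d, ENNReal.ofReal (Gk d s ‖y - x‖) = ENNReal.ofReal (exp (-s)) := by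
  rw [lintegral_sub_right_eq_self (fun y : Ed d => ENNReal.ofReal (Gk d s ‖y‖)) x]
  have h1 : ∀ y : Ed d, ENNReal.ofReal (Gk d s ‖y‖) =
      ENNReal.ofReal ((4 * π * s) ^ (-(d : ℝ) / 2) * exp (-s)) *
        ENNReal.ofReal (exp (-(1 / (4 * s)) * ‖y‖ ^ 2)) := fun y => by
    rw [← ENNReal.ofReal_mul (by positivity), Gk, mul_assoc _ (exp (-s)), ← exp_add]
    congr 3; ring
  simp_rw [h1]
  rw [lintegral_const_mul _ (by fun_prop), lint_gauss d (by positivity),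
    ← ENNReal.ofReal_mul (by positivity)]
  congr 1
  rw [show π / (1 / (4 * s)) = 4 * π * s by field_simp, mul_right_comm, ← rpow_add (by positivity),
    show -(d:ℝ) / 2 + d / 2 = 0 by ring, rpow_zero, one_mul]

lemma sq_complete {d : ℕ} (x y z : Ed d) {s r : ℝ} (hs : 0 < s) (hr : 0 < r) :
    ‖z - x‖ ^ 2 / (4 * s) + ‖y - z‖ ^ 2 / (4 * r) =
      ‖y - x‖ ^ 2 / (4 * (s + r)) +
      (s + r) / (4 * s * r) * ‖z - ((r / (s + r)) • x + (s / (s + r)) • y)‖ ^ 2 := by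
  have hsr : 0 < s + r := by positivity
  have e : z - ((r / (s + r)) • x + (s / (s + r)) • y) =
      (r / (s + r)) • (z - x) - (s / (s + r)) • (y - z) := by
    have h : (r / (s + r)) • z + (s / (s + r)) • z = z := by
      rw [← add_smul, ← add_div, add_comm r s, div_self hsr.ne', one_smul]
    nth_rewrite 1 [← h]
    module
  have e2 : y - x = (z - x) + (y - z) := by abel
  rw [e, e2]
  generalize z - x = p
  generalize y - z = q
  rw [norm_add_sq_real p q, norm_sub_sq_real ((r / (s + r)) • p), norm_smul, norm_smul,
    inner_smul_left, inner_smul_right, Real.norm_of_nonneg (by positivity),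
    Real.norm_of_nonneg (by positivity)]
  simp only [conj_trivial]
  field_simp
  ring

lemma Gk_conv (d : ℕ) {s r : ℝ} (hs : 0 < s) (hr : 0 < r) (x y : Ed d) :
    ∫⁻ z : Ed d, ENNReal.ofReal (Gk d s ‖z - x‖) * ENNReal.ofReal (Gk d r ‖y - z‖) =
      ENNReal.ofReal (Gk d (s + r) ‖y - x‖) := by
  have hsr : 0 < s + r := by positivity
  set w := (r / (s + r)) • x + (s / (s + r)) • y with hw
  have h1 : ∀ z : Ed d, ENNReal.ofReal (Gk d s ‖z - x‖) * ENNReal.ofReal (Gk d r ‖y - z‖) =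
      ENNReal.ofReal ((4 * π * s) ^ (-(d : ℝ) / 2) * (4 * π * r) ^ (-(d : ℝ) / 2) *
        exp (-(s + r) - ‖y - x‖ ^ 2 / (4 * (s + r)))) *
        ENNReal.ofReal (exp (-((s + r) / (4 * s * r)) * ‖z - w‖ ^ 2)) := fun z => by
    rw [← ENNReal.ofReal_mul (Gk_nonneg d hs.le _), ← ENNReal.ofReal_mul (by positivity), Gk, Gk]
    congr 1
    rw [mul_mul_mul_comm, ← exp_add, mul_assoc _ (exp _) (exp _), ← exp_add]
    congr 2
    have := sq_complete x y z hs hr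
    rw [← hw] at this
    linarith
  simp_rw [h1]
  rw [lintegral_const_mul _ (by fun_prop),
    lintegral_sub_right_eq_self (fun z : Ed d => ENNReal.ofReal
      (exp (-((s + r) / (4 * s * r)) * ‖z‖ ^ 2))) w, lint_gauss d (by positivity),
    ← ENNReal.ofReal_mul (by positivity), Gk]
  congr 1
  rw [mul_right_comm]
  congr 1
  rw [show (d:ℝ) / 2 = -(-(d:ℝ) / 2) by ring, rpow_neg (by positivity), ← div_eq_mul_inv,
    ← mul_rpow (by positivity) (by positivity), ← div_rpow (by positivity) (by positivity)]
  congr 1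
  field_simp

lemma Gk_fourier (d : ℕ) {s : ℝ} (hs : 0 < s) (v : Ed d) :
    (2 * π) ^ (-(d : ℝ)) * ∫ z : Ed d, Real.cos ⟪v, z⟫ * exp (-s * (‖z‖ ^ 2 + 1)) = Gk d s ‖v‖ := by
  have h := GaussianFourier.integral_cexp_neg_mul_sq_norm_add (b := (s : ℂ)) (by simpa using hs)
    Complex.I v
  have hi : Integrable (fun z : Ed d => Complex.exp (-(s:ℂ) * ‖z‖ ^ 2 + Complex.I * ⟪v, z⟫)) := by
    refine Integrable.of_integral_ne_zero ?_
    rw [h]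
    refine mul_ne_zero ?_ (Complex.exp_ne_zero _)
    rw [Ne, Complex.cpow_eq_zero_iff, not_and_or]
    left
    exact div_ne_zero (by exact_mod_cast pi_ne_zero) (by exact_mod_cast hs.ne')
  have h2 := congrArg Complex.re h
  rw [show (∫ z : Ed d, Complex.exp (-(s:ℂ) * ‖z‖ ^ 2 + Complex.I * ⟪v, z⟫)).re =
    ∫ z : Ed d, (Complex.exp (-(s:ℂ) * ‖z‖ ^ 2 + Complex.I * ⟪v, z⟫)).re from (integral_re hi).symm] at h2
  have e1 : ∀ z : Ed d, (Complex.exp (-(s:ℂ) * ‖z‖ ^ 2 + Complex.I * ⟪v, z⟫)).re =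
      Real.cos ⟪v, z⟫ * exp (-s * ‖z‖ ^ 2) := fun z => by
    rw [Complex.exp_re]
    have r1 : (-(s:ℂ) * ‖z‖ ^ 2 + Complex.I * ⟪v, z⟫).re = -s * ‖z‖ ^ 2 := by
      simp [← Complex.ofReal_pow]
    have r2 : (-(s:ℂ) * ‖z‖ ^ 2 + Complex.I * ⟪v, z⟫).im = ⟪v, z⟫ := by
      simp [← Complex.ofReal_pow]
    rw [r1, r2, mul_comm]
  simp_rw [e1] at h2
  have e2 : ((π / (s:ℂ)) ^ ((Module.finrank ℝ (Ed d) : ℂ) / 2) *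
      Complex.exp (Complex.I ^ 2 * ‖v‖ ^ 2 / (4 * s))).re =
      (π / s) ^ ((d:ℝ) / 2) * exp (-‖v‖ ^ 2 / (4 * s)) := by
    have : (π / (s:ℂ)) ^ ((Module.finrank ℝ (Ed d) : ℂ) / 2) *
      Complex.exp (Complex.I ^ 2 * ‖v‖ ^ 2 / (4 * s)) =
      (((π / s) ^ ((d:ℝ) / 2) * exp (-‖v‖ ^ 2 / (4 * s)) : ℝ) : ℂ) := by
      rw [Complex.ofReal_mul, Complex.ofReal_cpow (by positivity), Complex.ofReal_exp]
      simp
    rw [this, Complex.ofReal_re]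
  rw [e2] at h2
  have e3 : ∀ z : Ed d, Real.cos ⟪v, z⟫ * exp (-s * (‖z‖ ^ 2 + 1)) =
      exp (-s) * (Real.cos ⟪v, z⟫ * exp (-s * ‖z‖ ^ 2)) := fun z => by
    rw [mul_left_comm, ← exp_add]; congr 2; ring
  simp_rw [e3]
  rw [integral_const_mul, h2, Gk]
  rw [show -s - ‖v‖ ^ 2 / (4 * s) = -s + -‖v‖ ^ 2 / (4 * s) by ring, exp_add]
  have e4 : (4 * π * s) ^ (-(d:ℝ) / 2) = (2 * π) ^ (-(d:ℝ)) * (π / s) ^ ((d:ℝ) / 2) := by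
    have e5 : (2 * π) ^ (-(d:ℝ)) = ((2 * π) ^ (2:ℝ)) ^ (-(d:ℝ) / 2) := by
      rw [← rpow_mul (by positivity)]; congr 1; ring
    rw [show (d:ℝ) / 2 = -(-(d:ℝ) / 2) by ring, e5, rpow_neg (by positivity), ← div_eq_mul_inv,
      ← div_rpow (by positivity) (by positivity)]
    have : (2 * π) ^ (2:ℝ) / (π / s) = 4 * π * s := by
      rw [rpow_two]; field_simp; ring
    rw [this]
  rw [e4]; ring

/-- The subordinated kernel, extended valued. -/
def pe {d : ℕ} (a : ℝ) (η : Measure ℝ) (t : ℝ) (x y : Ed d) : ENNReal :=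
  ∫⁻ s, ENNReal.ofReal (Gk d (t ^ (1 / a) * s) ‖y - x‖) ∂η

lemma pe_symm {d : ℕ} (a : ℝ) (η : Measure ℝ) (t : ℝ) (x y : Ed d) : pe a η t x y = pe a η t y x := by
  unfold pe; rw [norm_sub_rev]

lemma pe_meas {d : ℕ} (a : ℝ) (η : Measure ℝ) [SFinite η] :
    Measurable fun q : ℝ × Ed d × Ed d => pe a η q.1 q.2.1 q.2.2 := by
  unfold pe
  refine Measurable.lintegral_prod_right' (f := fun p : (ℝ × Ed d × Ed d) × ℝ =>
    ENNReal.ofReal (Gk d (p.1.1 ^ (1 / a) * p.2) ‖p.1.2.2 - p.1.2.1‖)) ?_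
  exact ENNReal.measurable_ofReal.comp (Gk_meas2 d (by fun_prop) (by fun_prop))

lemma pe_meas2 {Ω : Type*} [MeasurableSpace Ω] {d : ℕ} {a : ℝ} {η : Measure ℝ} [SFinite η]
    {f : Ω → ℝ} {g h : Ω → Ed d} (hf : Measurable f) (hg : Measurable g) (hh : Measurable h) :
    Measurable fun q => pe a η (f q) (g q) (h q) := by
  have := (pe_meas (d := d) a η).comp (hf.prodMk (hg.prodMk hh))
  exact this

/-- Chapman-Kolmogorov equations. -/
lemma pe_ck {d : ℕ} {a : ℝ} {η : Measure ℝ} (h : IsSub a η) (ha : 0 < a) {t s : ℝ} (ht : 0 < t)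
    (hs : 0 < s) (x y : Ed d) :
    ∫⁻ z, pe a η t x z * pe a η s z y = pe a η (t + s) x y := by
  have := h.prob
  have hmG : ∀ c r : ℝ, Measurable fun u : ℝ => ENNReal.ofReal (Gk d (c * u) r) :=
    fun c r => ENNReal.measurable_ofReal.comp (Gk_meas2 d (by fun_prop) (by fun_prop))
  have e1 : ∀ z : Ed d, pe a η t x z * pe a η s z y =
      ∫⁻ u, ∫⁻ v, ENNReal.ofReal (Gk d (t ^ (1 / a) * u) ‖z - x‖) *
        ENNReal.ofReal (Gk d (s ^ (1 / a) * v) ‖y - z‖) ∂η ∂η := fun z => by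
    unfold pe
    rw [← lintegral_mul_const _ (hmG _ _)]
    refine lintegral_congr fun u => ?_
    rw [lintegral_const_mul _ (hmG _ _)]
  simp_rw [e1]
  have hm3 : Measurable fun q : (Ed d × ℝ) × ℝ =>
      ENNReal.ofReal (Gk d (t ^ (1 / a) * q.1.2) ‖q.1.1 - x‖) *
        ENNReal.ofReal (Gk d (s ^ (1 / a) * q.2) ‖y - q.1.1‖) :=
    (ENNReal.measurable_ofReal.comp (Gk_meas2 d (by fun_prop) (by fun_prop))).mul
     (ENNReal.measurable_ofReal.comp (Gk_meas2 d (by fun_prop) (by fun_prop)))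
  rw [lintegral_lintegral_swap (Measurable.lintegral_prod_right' hm3).aemeasurable]
  have e2 : ∀ᵐ u ∂η, ∫⁻ z : Ed d, ∫⁻ v, ENNReal.ofReal (Gk d (t ^ (1 / a) * u) ‖z - x‖) *
        ENNReal.ofReal (Gk d (s ^ (1 / a) * v) ‖y - z‖) ∂η =
        ∫⁻ v, ENNReal.ofReal (Gk d (t ^ (1 / a) * u + s ^ (1 / a) * v) ‖y - x‖) ∂η := by
    filter_upwards [h.ae_pos] with u hu
    have hm4 : Measurable (Function.uncurry fun (z : Ed d) (v : ℝ) =>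
        ENNReal.ofReal (Gk d (t ^ (1 / a) * u) ‖z - x‖) *
        ENNReal.ofReal (Gk d (s ^ (1 / a) * v) ‖y - z‖)) :=
      (ENNReal.measurable_ofReal.comp (Gk_meas2 d (by fun_prop) (by fun_prop))).mul
        (ENNReal.measurable_ofReal.comp (Gk_meas2 d (by fun_prop) (by fun_prop)))
    rw [lintegral_lintegral_swap hm4.aemeasurable]
    refine lintegral_congr_ae ?_
    filter_upwards [h.ae_pos] with v hv
    exact Gk_conv d (by positivity) (by positivity) x y
  rw [lintegral_congr_ae e2, h.sum_law ha ht hs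
    (F := fun w => ENNReal.ofReal (Gk d w ‖y - x‖)) (ENNReal.measurable_ofReal.comp
      (Gk_meas2 d measurable_id measurable_const))]
  rfl

lemma pe_mass {d : ℕ} {a : ℝ} {η : Measure ℝ} (h : IsSub a η) (ha : 0 < a) {t : ℝ} (ht : 0 < t)
    (x : Ed d) : ∫⁻ y, pe a η t x y = ENNReal.ofReal (exp (-t)) := by
  have := h.prob
  unfold pe
  have hm4 : Measurable (Function.uncurry fun (y : Ed d) (s : ℝ) =>
        ENNReal.ofReal (Gk d (t ^ (1 / a) * s) ‖y - x‖)) :=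
      ENNReal.measurable_ofReal.comp (Gk_meas2 d (by fun_prop) (by fun_prop))
  rw [lintegral_lintegral_swap hm4.aemeasurable]
  have h1 := h.lap (t ^ (1 / a)) (by positivity)
  rw [← rpow_mul ht.le, one_div_mul_cancel ha.ne', rpow_one] at h1
  rw [← h1]
  refine lintegral_congr_ae ?_
  filter_upwards [h.ae_pos] with u hu
  rw [Gk_mass d (by positivity), neg_mul]

lemma Gk_le (d : ℕ) {s : ℝ} (hs : 0 < s) (r : ℝ) : Gk d s r ≤ (4 * π * s) ^ (-(d : ℝ) / 2) := by
  unfold Gk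
  refine mul_le_of_le_one_right (by positivity) ?_
  rw [exp_le_one_iff]
  have : 0 ≤ r ^ 2 / (4 * s) := by positivity
  linarith

/-- On-diagonal upper bound. -/
lemma pe_le_diag {d : ℕ} (hd : 0 < d) {a : ℝ} {η : Measure ℝ} (h : IsSub a η) (ha : 0 < a) :
    ∃ C : ℝ, 0 < C ∧ ∀ t : ℝ, 0 < t → ∀ x y : Ed d,
      pe a η t x y ≤ ENNReal.ofReal (C * t ^ (-(d : ℝ) / (2 * a))) := by
  have hd' : (0:ℝ) < d := by exact_mod_cast hd
  have hG1 := Real.Gamma_pos_of_pos (show 0 < (d:ℝ) / 2 by positivity)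
  have hG2 := Real.Gamma_pos_of_pos (show 0 < (d:ℝ) / 2 / a by positivity)
  refine ⟨(4 * π) ^ (-(d : ℝ) / 2) * (Real.Gamma ((d:ℝ) / 2 / a) / (a * Real.Gamma ((d:ℝ) / 2))),
    by positivity, fun t ht x y => ?_⟩
  calc pe a η t x y ≤ ∫⁻ s, ENNReal.ofReal ((4 * π) ^ (-(d : ℝ) / 2) * t ^ (-(d : ℝ) / (2 * a))) *
        ENNReal.ofReal (s ^ (-((d:ℝ) / 2))) ∂η := by
        refine lintegral_mono_ae ?_
        filter_upwards [h.ae_pos] with s hs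
        rw [← ENNReal.ofReal_mul (by positivity)]
        refine ENNReal.ofReal_le_ofReal ((Gk_le d (by positivity) _).trans (le_of_eq ?_))
        rw [mul_rpow (x := 4 * π) (by positivity) (by positivity),
          mul_rpow (x := t ^ (1 / a)) (by positivity) (by positivity),
          ← rpow_mul ht.le, ← mul_assoc, neg_div]
        congr 3
        field_simp
    _ = _ := by
        rw [lintegral_const_mul _ (by fun_prop), h.neg_moment ha (by positivity),
          ← ENNReal.ofReal_mul (by positivity)]
        congr 1; ring

/-- The real kernel is the subordinated kernel. -/
lemma relKernel_eq {d : ℕ} (hd : 0 < d) {α : ℝ} (hα : 0 < α) {η : Measure ℝ}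
    (h : IsSub (α / 2) η) {t : ℝ} (ht : 0 < t) (x y : Ed d) :
    relKernel d α 1 t x y = (pe (α / 2) η t x y).toReal := by
  have := h.prob
  have ha : 0 < α / 2 := by positivity
  have hd' : (0:ℝ) < d := by exact_mod_cast hd
  set S := t ^ (1 / (α / 2)) with hS
  have hSp : 0 < S := by positivity
  have e1 : ∀ z : Ed d, exp (-t * (‖z‖ ^ 2 + 1 ^ (2 / α)) ^ (α / 2)) =
      ∫ s, exp (-(S * s) * (‖z‖ ^ 2 + 1)) ∂η := fun z => by
    have hz : 0 < ‖z‖ ^ 2 + 1 := by positivity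
    rw [integral_eq_lintegral_of_nonneg_ae (ae_of_all _ fun s => exp_nonneg _) (by fun_prop)]
    have h1 := h.lap (S * (‖z‖ ^ 2 + 1)) (by positivity)
    rw [mul_rpow hSp.le hz.le, hS, ← rpow_mul ht.le, one_div_mul_cancel ha.ne', rpow_one] at h1
    rw [one_rpow, neg_mul, ← ENNReal.toReal_ofReal (exp_nonneg _), ← h1]
    congr 1
    refine lintegral_congr fun s => ?_
    congr 2; ring
  have hIntg : Integrable (Function.uncurry fun (z : Ed d) (s : ℝ) =>
      Real.cos ⟪y - x, z⟫ * exp (-(S * s) * (‖z‖ ^ 2 + 1))) (volume.prod η) := by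
    refine ⟨by unfold Function.uncurry; fun_prop, ?_⟩
    rw [hasFiniteIntegral_iff_enorm]
    have h2 : ∀ q : Ed d × ℝ, ‖Function.uncurry (fun (z : Ed d) (s : ℝ) =>
      Real.cos ⟪y - x, z⟫ * exp (-(S * s) * (‖z‖ ^ 2 + 1))) q‖ₑ ≤
      ENNReal.ofReal (exp (-(S * q.2) * (‖q.1‖ ^ 2 + 1))) := fun q => by
      rw [← ofReal_norm]
      refine ENNReal.ofReal_le_ofReal ?_
      simp only [Function.uncurry, norm_mul, Real.norm_eq_abs, abs_exp]
      exact mul_le_of_le_one_left (exp_nonneg _) (abs_cos_le_one _)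
    refine (lintegral_mono h2).trans_lt ?_
    rw [lintegral_prod_symm _ (by fun_prop)]
    calc _ ≤ ∫⁻ s, ENNReal.ofReal ((π / S) ^ ((d:ℝ) / 2)) * ENNReal.ofReal (s ^ (-((d:ℝ) / 2))) ∂η := by
          refine lintegral_mono_ae ?_
          filter_upwards [h.ae_pos] with s hs
          rw [← ENNReal.ofReal_mul (by positivity)]
          calc _ ≤ ∫⁻ z : Ed d, ENNReal.ofReal (exp (-(S * s) * ‖z‖ ^ 2)) := by
                refine lintegral_mono fun z => ENNReal.ofReal_le_ofReal (exp_le_exp.2 ?_)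
                nlinarith [mul_pos hSp hs]
            _ = _ := by
                rw [lint_gauss d (by positivity), rpow_neg hs.le, ← div_div,
                  div_rpow (by positivity) hs.le, div_eq_mul_inv]
      _ < ⊤ := by
          rw [lintegral_const_mul _ (by fun_prop), h.neg_moment ha (by positivity)]
          exact ENNReal.mul_lt_top ENNReal.ofReal_lt_top ENNReal.ofReal_lt_top
  unfold relKernel
  have e3 : ∀ z : Ed d, Real.cos ⟪y - x, z⟫ * exp (-t * (‖z‖ ^ 2 + 1 ^ (2 / α)) ^ (α / 2)) =
      ∫ s, Real.cos ⟪y - x, z⟫ * exp (-(S * s) * (‖z‖ ^ 2 + 1)) ∂η := fun z => by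
    rw [e1, integral_const_mul]
  simp_rw [e3]
  rw [integral_integral_swap hIntg, ← integral_const_mul]
  have e2 : ∀ᵐ s ∂η, (2 * π) ^ (-(d : ℝ)) *
      ∫ z : Ed d, Real.cos ⟪y - x, z⟫ * exp (-(S * s) * (‖z‖ ^ 2 + 1)) = Gk d (S * s) ‖y - x‖ := by
    filter_upwards [h.ae_pos] with s hs
    exact Gk_fourier d (by positivity) _
  rw [integral_congr_ae e2, integral_eq_lintegral_of_nonneg_ae]
  · rfl
  · filter_upwards [h.ae_pos] with s hs
    exact Gk_nonneg d (by positivity) _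
  · exact (Gk_meas2 d (by fun_prop) (by fun_prop)).aestronglyMeasurable

lemma pe_ne_top {d : ℕ} (hd : 0 < d) {a : ℝ} {η : Measure ℝ} (h : IsSub a η) (ha : 0 < a)
    {t : ℝ} (ht : 0 < t) (x y : Ed d) : pe a η t x y ≠ ⊤ := by
  obtain ⟨C, _, hC⟩ := pe_le_diag hd h ha
  exact ne_top_of_le_ne_top ENNReal.ofReal_ne_top (hC t ht x y)

/-- The integral defining the Bessel function, without prefactors, extended valued. -/
def Jf (ν ρ : ℝ) : ENNReal :=
  ∫⁻ u in Ioi (0:ℝ), ENNReal.ofReal (u ^ (-ν - 1) * exp (-u - ρ ^ 2 / (4 * u)))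

lemma Jf_meas (ν : ℝ) : Measurable (Jf ν) := by
  unfold Jf
  refine Measurable.lintegral_prod_right' (f := fun p : ℝ × ℝ =>
    ENNReal.ofReal (p.2 ^ (-ν - 1) * exp (-p.2 - p.1 ^ 2 / (4 * p.2)))) ?_
  fun_prop

lemma Jf_norm_meas {d : ℕ} (ν : ℝ) : Measurable fun x : Ed d => Jf ν ‖x‖ :=
  (Jf_meas ν).comp measurable_norm

lemma lint_Gk_pow (d : ℕ) (b ρ : ℝ) :
    ∫⁻ u in Ioi (0:ℝ), ENNReal.ofReal (u ^ (b - 1) * Gk d u ρ) =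
      ENNReal.ofReal ((4 * π) ^ (-(d:ℝ) / 2)) * Jf ((d:ℝ) / 2 - b) ρ := by
  unfold Jf
  rw [← lintegral_const_mul _ (by fun_prop)]
  refine setLIntegral_congr_fun measurableSet_Ioi fun u (hu : 0 < u) => ?_
  rw [← ENNReal.ofReal_mul (by positivity)]
  congr 1
  rw [Gk, mul_rpow (by positivity) hu.le, show -((d:ℝ) / 2 - b) - 1 = (b - 1) + -(d:ℝ) / 2 by ring,
    rpow_add hu]
  ring

/-- Power change of variables. -/
lemma lint_subst {a b s : ℝ} (ha : 0 < a) (hs : 0 < s) {F : ℝ → ENNReal} :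
    ∫⁻ r in Ioi (0:ℝ), ENNReal.ofReal (r ^ (b / a - 1)) * F (r ^ (1 / a) * s) =
      ENNReal.ofReal (a * s ^ (-b)) * ∫⁻ u in Ioi (0:ℝ), ENNReal.ofReal (u ^ (b - 1)) * F u := by
  have hinj : InjOn (fun r : ℝ => r ^ (1 / a) * s) (Ioi 0) := fun p hp q hq h => by
    have h2 : p ^ (1 / a) = q ^ (1 / a) := mul_right_cancel₀ hs.ne' h
    exact (rpow_left_inj (le_of_lt hp) (le_of_lt hq) (by positivity)).1 h2
  have himg : (fun r : ℝ => r ^ (1 / a) * s) '' Ioi 0 = Ioi 0 := by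
    ext u
    simp only [mem_image, mem_Ioi]
    refine ⟨?_, fun hu => ⟨(u / s) ^ a, by positivity, ?_⟩⟩
    · rintro ⟨r, hr, rfl⟩; positivity
    · rw [← rpow_mul (by positivity), mul_one_div_cancel ha.ne', rpow_one, div_mul_cancel₀ _ hs.ne']
  have hder : ∀ r ∈ Ioi (0:ℝ), HasDerivWithinAt (fun r : ℝ => r ^ (1 / a) * s)
      (1 / a * r ^ (1 / a - 1) * s) (Ioi 0) r := fun r hr =>
    ((Real.hasDerivAt_rpow_const (Or.inl (ne_of_gt hr))).mul_const s).hasDerivWithinAt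
  have := lintegral_image_eq_lintegral_abs_deriv_mul measurableSet_Ioi hder hinj
    (fun u => ENNReal.ofReal (u ^ (b - 1)) * F u)
  rw [himg] at this
  rw [this, ← lintegral_const_mul' _ _ ENNReal.ofReal_ne_top]
  refine setLIntegral_congr_fun measurableSet_Ioi fun r (hr : 0 < r) => ?_
  rw [← mul_assoc, ← mul_assoc, ← ENNReal.ofReal_mul (by positivity),
    ← ENNReal.ofReal_mul (by positivity)]
  congr 2
  rw [abs_of_pos (by positivity), mul_rpow (by positivity) hs.le, ← rpow_mul hr.le]
  have e1 : r ^ (b / a - 1) = r ^ (1 / a - 1) * r ^ (1 / a * (b - 1)) := by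
    rw [← rpow_add hr]; congr 1; field_simp; ring
  have e2 : s ^ (-b) * (s * s ^ (b - 1)) = 1 := by
    nth_rewrite 2 [← rpow_one s]
    rw [← rpow_add hs, ← rpow_add hs]; simp
  rw [e1]
  generalize r ^ (1 / a - 1) = A
  generalize r ^ (1 / a * (b - 1)) = B
  calc A * B = a * (1 / a) * A * B * (s ^ (-b) * (s * s ^ (b - 1))) := by
        rw [e2, mul_one_div_cancel ha.ne']; ring
    _ = _ := by ring

/-- Potential of the kernel. -/
lemma pe_pot {d : ℕ} {a b : ℝ} {η : Measure ℝ} (h : IsSub a η) (ha : 0 < a) (hb : 0 < b)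
    (x y : Ed d) :
    ∫⁻ r in Ioi (0:ℝ), ENNReal.ofReal (r ^ (b / a - 1)) * pe a η r x y =
      ENNReal.ofReal (Gamma (b / a) / Gamma b * (4 * π) ^ (-(d:ℝ) / 2)) *
        Jf ((d:ℝ) / 2 - b) ‖y - x‖ := by
  have := h.prob
  have hG1 := Real.Gamma_pos_of_pos hb
  have hG2 := Real.Gamma_pos_of_pos (show 0 < b / a by positivity)
  unfold pe
  have hm : Measurable (Function.uncurry fun (r s : ℝ) => ENNReal.ofReal (r ^ (b / a - 1)) *
      ENNReal.ofReal (Gk d (r ^ (1 / a) * s) ‖y - x‖)) :=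
    (by fun_prop : Measurable fun q : ℝ × ℝ => ENNReal.ofReal (q.1 ^ (b / a - 1))).mul
      (ENNReal.measurable_ofReal.comp (Gk_meas2 d (by fun_prop) (by fun_prop)))
  simp_rw [← lintegral_const_mul' _ _ ENNReal.ofReal_ne_top]
  rw [lintegral_lintegral_swap hm.aemeasurable]
  have e1 : ∀ᵐ s ∂η, ∫⁻ r in Ioi (0:ℝ), ENNReal.ofReal (r ^ (b / a - 1)) *
      ENNReal.ofReal (Gk d (r ^ (1 / a) * s) ‖y - x‖) =
      ENNReal.ofReal (s ^ (-b)) * (ENNReal.ofReal (a * (4 * π) ^ (-(d:ℝ) / 2)) *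
        Jf ((d:ℝ) / 2 - b) ‖y - x‖) := by
    filter_upwards [h.ae_pos] with s hs
    rw [lint_subst ha hs (F := fun u => ENNReal.ofReal (Gk d u ‖y - x‖))]
    have := lint_Gk_pow d b ‖y - x‖
    rw [show ∫⁻ u in Ioi (0:ℝ), ENNReal.ofReal (u ^ (b - 1)) * ENNReal.ofReal (Gk d u ‖y - x‖) =
      ∫⁻ u in Ioi (0:ℝ), ENNReal.ofReal (u ^ (b - 1) * Gk d u ‖y - x‖) from
      setLIntegral_congr_fun measurableSet_Ioi fun u (hu : 0 < u) => by
        rw [ENNReal.ofReal_mul (by positivity)], this, ENNReal.ofReal_mul ha.le,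
        ENNReal.ofReal_mul ha.le]
    ring
  rw [lintegral_congr_ae e1, lintegral_mul_const _ (by fun_prop), h.neg_moment ha hb, ← mul_assoc,
    ← ENNReal.ofReal_mul (by positivity)]
  congr 2
  field_simp

lemma lint_layer {k : ℝ} (hk : 0 < k) {F : ℝ → ENNReal} (hF : Measurable F) :
    ∫⁻ w in Ioi (0:ℝ), ENNReal.ofReal (w ^ k) * F w =
      ∫⁻ r in Ioi (0:ℝ), ENNReal.ofReal (k * r ^ (k - 1)) * ∫⁻ w in Ioi r, F w := by
  have e1 : ∀ w ∈ Ioi (0:ℝ), ENNReal.ofReal (w ^ k) * F w = ∫⁻ r in Ioi (0:ℝ),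
      (Ioi r).indicator (fun w => ENNReal.ofReal (k * r ^ (k - 1)) * F w) w := by
    intro w hw
    have hw : 0 < w := hw
    have e2 : ∫⁻ r in Ioi (0:ℝ),
      (Ioi r).indicator (fun w => ENNReal.ofReal (k * r ^ (k - 1)) * F w) w =
      ∫⁻ r in Ioi (0:ℝ), (Iio w).indicator (fun r => ENNReal.ofReal k * ENNReal.ofReal (r ^ (k - 1)) * F w) r := by
      refine lintegral_congr fun r => ?_
      by_cases hr : r < w
      · rw [indicator_of_mem (show w ∈ Ioi r from hr), indicator_of_mem (show r ∈ Iio w from hr),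
          ENNReal.ofReal_mul hk.le]
      · rw [indicator_of_notMem (show w ∉ Ioi r from hr), indicator_of_notMem (show r ∉ Iio w from hr)]
    rw [e2, lintegral_indicator measurableSet_Iio, Measure.restrict_restrict measurableSet_Iio,
      Iio_inter_Ioi, lintegral_mul_const _ (by fun_prop), lintegral_const_mul _ (by fun_prop)]
    rw [lint_rpow_Ioo k w hk hw, ← ENNReal.ofReal_mul hk.le]
    congr 2
    field_simp
  rw [setLIntegral_congr_fun measurableSet_Ioi e1]
  have hm : Measurable (Function.uncurry fun (w r : ℝ) =>
      (Ioi r).indicator (fun w => ENNReal.ofReal (k * r ^ (k - 1)) * F w) w) := by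
    have : (Function.uncurry fun (w r : ℝ) =>
      (Ioi r).indicator (fun w => ENNReal.ofReal (k * r ^ (k - 1)) * F w) w) =
      {q : ℝ × ℝ | q.2 < q.1}.indicator (fun q => ENNReal.ofReal (k * q.2 ^ (k - 1)) * F q.1) := by
      ext q; simp [indicator]; rfl
    rw [this]
    refine Measurable.indicator ?_ (measurableSet_lt measurable_snd measurable_fst)
    exact (by fun_prop : Measurable fun q : ℝ × ℝ => ENNReal.ofReal (k * q.2 ^ (k - 1))).mul
      (hF.comp measurable_fst)
  rw [lintegral_lintegral_swap hm.aemeasurable]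
  refine setLIntegral_congr_fun measurableSet_Ioi fun r (hr : 0 < r) => ?_
  rw [lintegral_indicator measurableSet_Ioi, Measure.restrict_restrict measurableSet_Ioi,
    Ioi_inter_Ioi, max_eq_left hr.le, lintegral_const_mul _ hF]

/-- Normalizing constant. -/
def Wc (d : ℕ) (a ν : ℝ) : ℝ :=
  Gamma ((d:ℝ) / 2 - ν) / Gamma (((d:ℝ) / 2 - ν) / a) * (4 * π) ^ ((d:ℝ) / 2)

/-- The constant in the generator identity. -/
def cnu (d : ℕ) (a ν : ℝ) : ℝ := Gamma ((d:ℝ) / 2 - ν) / Gamma ((d:ℝ) / 2 - ν - a)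

lemma Wc_pos {d : ℕ} {a ν : ℝ} (ha : 0 < a) (hν : ν < (d:ℝ) / 2) : 0 < Wc d a ν := by
  have hG1 := Real.Gamma_pos_of_pos (show 0 < (d:ℝ) / 2 - ν by linarith)
  have hG2 := Real.Gamma_pos_of_pos (show 0 < ((d:ℝ) / 2 - ν) / a from div_pos (by linarith) ha)
  unfold Wc; positivity

lemma cnu_pos {d : ℕ} {a ν : ℝ} (ha : 0 < a) (hν : ν + a < (d:ℝ) / 2) : 0 < cnu d a ν := by
  have hG1 := Real.Gamma_pos_of_pos (show 0 < (d:ℝ) / 2 - ν by linarith)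
  have hG2 := Real.Gamma_pos_of_pos (show 0 < (d:ℝ) / 2 - ν - a by linarith)
  unfold cnu; positivity

lemma Jf_eq_pot {d : ℕ} {a ν : ℝ} {η : Measure ℝ} (h : IsSub a η) (ha : 0 < a)
    (hν : ν < (d:ℝ) / 2) (x : Ed d) :
    Jf ν ‖x‖ = ENNReal.ofReal (Wc d a ν) *
      ∫⁻ r in Ioi (0:ℝ), ENNReal.ofReal (r ^ (((d:ℝ) / 2 - ν) / a - 1)) * pe a η r x 0 := by
  have hb : 0 < (d:ℝ) / 2 - ν := by linarith
  have hG1 := Real.Gamma_pos_of_pos hb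
  have hG2 := Real.Gamma_pos_of_pos (show 0 < ((d:ℝ) / 2 - ν) / a by positivity)
  rw [pe_pot h ha hb, ← mul_assoc, ← ENNReal.ofReal_mul (Wc_pos ha hν).le]
  have : Wc d a ν * (Gamma (((d:ℝ) / 2 - ν) / a) / Gamma ((d:ℝ) / 2 - ν) *
      (4 * π) ^ (-(d:ℝ) / 2)) = 1 := by
    have h2 : (4 * π) ^ ((d:ℝ) / 2) * (4 * π) ^ (-(d:ℝ) / 2) = 1 := by
      rw [← rpow_add (by positivity), neg_div, add_neg_cancel, rpow_zero]
    unfold Wc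
    rw [mul_mul_mul_comm, h2]
    generalize Gamma ((d:ℝ) / 2 - ν) = A at *
    generalize Gamma (((d:ℝ) / 2 - ν) / a) = B at *
    field_simp
  rw [this, ENNReal.ofReal_one, one_mul, zero_sub, norm_neg]
  congr 1; ring

lemma PtJ {d : ℕ} {a ν : ℝ} {η : Measure ℝ} (h : IsSub a η) (ha : 0 < a)
    (hν : ν < (d:ℝ) / 2) {t : ℝ} (ht : 0 < t) (x : Ed d) :
    ∫⁻ z, pe a η t x z * Jf ν ‖z‖ = ENNReal.ofReal (Wc d a ν) *
      ∫⁻ r in Ioi (0:ℝ), ENNReal.ofReal (r ^ (((d:ℝ) / 2 - ν) / a - 1)) * pe a η (t + r) x 0 := by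
  have := h.prob
  set e := ((d:ℝ) / 2 - ν) / a - 1
  have hmz : Measurable fun z : Ed d => pe a η t x z :=
    pe_meas2 measurable_const measurable_const measurable_id
  have hm : Measurable fun q : Ed d × ℝ => ENNReal.ofReal (q.2 ^ e) * pe a η q.2 q.1 0 :=
    (by fun_prop : Measurable fun q : Ed d × ℝ => ENNReal.ofReal (q.2 ^ e)).mul
      (pe_meas2 measurable_snd measurable_fst measurable_const)
  simp_rw [Jf_eq_pot h ha hν]
  calc _ = ∫⁻ z, ENNReal.ofReal (Wc d a ν) * ∫⁻ r in Ioi (0:ℝ),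
        pe a η t x z * (ENNReal.ofReal (r ^ e) * pe a η r z 0) := by
        refine lintegral_congr fun z => ?_
        have hmr : Measurable fun r : ℝ => ENNReal.ofReal (r ^ e) * pe a η r z 0 :=
          (by fun_prop : Measurable fun r : ℝ => ENNReal.ofReal (r ^ e)).mul
            (pe_meas2 measurable_id measurable_const measurable_const)
        rw [lintegral_const_mul _ hmr]
        ring
    _ = ENNReal.ofReal (Wc d a ν) * ∫⁻ z, ∫⁻ r in Ioi (0:ℝ),
        pe a η t x z * (ENNReal.ofReal (r ^ e) * pe a η r z 0) :=
        lintegral_const_mul' _ _ ENNReal.ofReal_ne_top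
    _ = ENNReal.ofReal (Wc d a ν) * ∫⁻ r in Ioi (0:ℝ), ∫⁻ z,
        pe a η t x z * (ENNReal.ofReal (r ^ e) * pe a η r z 0) := by
        congr 1
        refine lintegral_lintegral_swap (Measurable.aemeasurable ?_)
        exact (hmz.comp measurable_fst).mul hm
    _ = _ := by
        congr 1
        refine setLIntegral_congr_fun measurableSet_Ioi fun r (hr : 0 < r) => ?_
        rw [← pe_ck h ha ht hr, ← lintegral_const_mul' _ _ ENNReal.ofReal_ne_top]
        refine lintegral_congr fun z => ?_
        ring

/-- The balance identity. -/
lemma balanceJ {d : ℕ} {a ν : ℝ} {η : Measure ℝ} (h : IsSub a η) (ha : 0 < a)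
    (hν : ν + a < (d:ℝ) / 2) {t : ℝ} (ht : 0 < t) (x : Ed d) :
    (∫⁻ z, pe a η t x z * Jf ν ‖z‖) +
      ∫⁻ s in Ioo 0 t, ∫⁻ z, pe a η s x z * (ENNReal.ofReal (cnu d a ν) * Jf (ν + a) ‖z‖) =
    Jf ν ‖x‖ := by
  have := h.prob
  have hν1 : ν < (d:ℝ) / 2 := by linarith
  set k := ((d:ℝ) / 2 - ν) / a - 1 with hk
  have hk0 : 0 < k := by rw [hk, sub_pos, one_lt_div ha]; linarith
  have hW := Wc_pos (d := d) ha hν1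
  have hm : Measurable fun w : ℝ => pe a η w x 0 :=
    pe_meas2 measurable_id measurable_const measurable_const
  have hmt : ∀ t, Measurable fun w : ℝ => pe a η (t + w) x 0 := fun t =>
    pe_meas2 (by fun_prop) measurable_const measurable_const
  have hek : ((d:ℝ) / 2 - (ν + a)) / a - 1 = k - 1 := by rw [hk]; field_simp; ring
  have hcW : Wc d a (ν + a) * cnu d a ν = Wc d a ν * k := by
    have h1 : 0 < (d:ℝ) / 2 - ν - a := by linarith
    have e1 : ((d:ℝ) / 2 - ν) / a = k + 1 := by rw [hk]; ring
    have e2 : ((d:ℝ) / 2 - (ν + a)) / a = k := by rw [hk]; field_simp; ring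
    unfold Wc cnu
    rw [e1, e2, Real.Gamma_add_one hk0.ne', show (d:ℝ) / 2 - (ν + a) = (d:ℝ) / 2 - ν - a by ring]
    have h3 := Real.Gamma_pos_of_pos h1
    have h4 := Real.Gamma_pos_of_pos hk0
    generalize Gamma ((d:ℝ) / 2 - ν - a) = A at *
    generalize Gamma ((d:ℝ) / 2 - ν) = B at *
    generalize Gamma k = D at *
    field_simp
  have e1 : ∫⁻ s in Ioo 0 t, ∫⁻ z, pe a η s x z * (ENNReal.ofReal (cnu d a ν) * Jf (ν + a) ‖z‖) =
      ENNReal.ofReal (Wc d a ν) * ∫⁻ r in Ioi (0:ℝ), ENNReal.ofReal (k * r ^ (k - 1)) *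
        ∫⁻ s in Ioo 0 t, pe a η (r + s) x 0 := by
    have e2 : ∀ s ∈ Ioo 0 t, ∫⁻ z, pe a η s x z * (ENNReal.ofReal (cnu d a ν) * Jf (ν + a) ‖z‖) =
      ENNReal.ofReal (Wc d a ν) * ∫⁻ r in Ioi (0:ℝ), ENNReal.ofReal (k * r ^ (k - 1)) *
        pe a η (r + s) x 0 := fun s hs => by
      have h3 : ∫⁻ z, pe a η s x z * (ENNReal.ofReal (cnu d a ν) * Jf (ν + a) ‖z‖) =
          ENNReal.ofReal (cnu d a ν) * ∫⁻ z, pe a η s x z * Jf (ν + a) ‖z‖ := by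
        rw [← lintegral_const_mul' _ _ ENNReal.ofReal_ne_top]
        refine lintegral_congr fun z => ?_
        ring
      rw [h3, PtJ h ha hν hs.1, hek, ← mul_assoc, ← ENNReal.ofReal_mul (cnu_pos ha hν).le,
        mul_comm (cnu d a ν), hcW, ENNReal.ofReal_mul hW.le, mul_assoc,
        ← lintegral_const_mul' _ _ ENNReal.ofReal_ne_top]
      congr 1
      refine lintegral_congr fun r => ?_
      rw [← mul_assoc, ← ENNReal.ofReal_mul hk0.le, add_comm s r]
    rw [setLIntegral_congr_fun measurableSet_Ioo e2, lintegral_const_mul' _ _ ENNReal.ofReal_ne_top]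
    congr 1
    have hm3 : Measurable (Function.uncurry fun (s r : ℝ) => ENNReal.ofReal (k * r ^ (k - 1)) *
        pe a η (r + s) x 0) :=
      (by fun_prop : Measurable fun q : ℝ × ℝ => ENNReal.ofReal (k * q.2 ^ (k - 1))).mul
        (pe_meas2 (by fun_prop) measurable_const measurable_const)
    rw [lintegral_lintegral_swap hm3.aemeasurable]
    refine lintegral_congr fun r => ?_
    rw [lintegral_const_mul' _ _ ENNReal.ofReal_ne_top]
  rw [e1, PtJ h ha hν1 ht, Jf_eq_pot h ha hν1 x, ← mul_add]
  congr 1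
  rw [lint_layer hk0 (hmt t), lint_layer hk0 hm, ← lintegral_add_left]
  · refine lintegral_congr fun r => ?_
    rw [← mul_add]
    congr 1
    have e3 : ∫⁻ w in Ioi r, pe a η (t + w) x 0 = ∫⁻ w in Ioi (r + t), pe a η w x 0 := by
      rw [← lint_shift r, ← lint_shift (r + t)]
      refine lintegral_congr fun v => ?_
      congr 1; ring
    have e4 : ∫⁻ s in Ioo 0 t, pe a η (r + s) x 0 = ∫⁻ w in Ioc r (r + t), pe a η w x 0 := by
      rw [← lintegral_indicator measurableSet_Ioo, ← restrict_Ioo_eq_restrict_Ioc,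
        ← lintegral_indicator measurableSet_Ioo,
        ← lintegral_add_left_eq_self ((Ioo r (r + t)).indicator _) r]
      refine lintegral_congr fun s => ?_
      simp only [indicator, mem_Ioo, lt_add_iff_pos_right, add_lt_add_iff_left]
    rw [e3, e4, add_comm, ← lintegral_union measurableSet_Ioi]
    · rw [Ioc_union_Ioi_eq_Ioi (by linarith)]
    · exact disjoint_left.2 fun w h1 h2 => absurd h2 (not_lt.2 h1.2)
  · refine Measurable.mul (by fun_prop) ?_
    have : ∀ r, ∫⁻ w in Ioi r, pe a η (t + w) x 0 = ∫⁻ v in Ioi (0:ℝ), pe a η (t + (r + v)) x 0 :=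
      fun r => (lint_shift r (fun w => pe a η (t + w) x 0)).symm
    simp_rw [this]
    exact Measurable.lintegral_prod_right' (f := fun q : ℝ × ℝ => pe a η (t + (q.1 + q.2)) x 0)
      (pe_meas2 (by fun_prop) measurable_const measurable_const)

section Pert
variable {E : Type*} [MeasureSpace E] [SFinite (volume : Measure E)]

/-- Space-time kernels vanishing for nonpositive times. -/
structure IsKer (A : ℝ → E → E → ENNReal) : Prop where
  meas : Measurable fun p : ℝ × E × E => A p.1 p.2.1 p.2.2
  zero : ∀ t ≤ 0, ∀ x y, A t x y = 0

lemma IsKer.m2 {A : ℝ → E → E → ENNReal} (hA : IsKer A) {Ω : Type*} [MeasurableSpace Ω]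
    {f : Ω → ℝ} {g h : Ω → E} (hf : Measurable f) (hg : Measurable g) (hh : Measurable h) :
    Measurable fun w => A (f w) (g w) (h w) := by
  have := hA.meas.comp (hf.prodMk (hg.prodMk hh))
  exact this

/-- Composition of space-time kernels through the potential. -/
def stq (q : E → ENNReal) (A B : ℝ → E → E → ENNReal) (t : ℝ) (x y : E) : ENNReal :=
  ∫⁻ p : ℝ × E, A p.1 x p.2 * q p.2 * B (t - p.1) p.2 y

/-- Application of a kernel to a function. -/
def Ap (A : ℝ → E → E → ENNReal) (f : E → ENNReal) (s : ℝ) (x : E) : ENNReal :=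
  ∫⁻ z, A s x z * f z

/-- Time integral of the application. -/
def Ti (A : ℝ → E → E → ENNReal) (f : E → ENNReal) (t : ℝ) (x : E) : ENNReal :=
  ∫⁻ s in Iio t, Ap A f s x

lemma lint_tr {F : ℝ × E → ENNReal} (hF : Measurable F) (r : ℝ) :
    ∫⁻ p : ℝ × E, F (p.1 - r, p.2) = ∫⁻ p : ℝ × E, F p := by
  have hm : Measurable fun p : ℝ × E => F (p.1 - r, p.2) :=
    hF.comp ((measurable_fst.sub_const r).prodMk measurable_snd)
  rw [Measure.volume_eq_prod, lintegral_prod _ hm.aemeasurable, lintegral_prod _ hF.aemeasurable]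
  exact lintegral_sub_right_eq_self (fun s => ∫⁻ z, F (s, z)) r

lemma stq_ker {q : E → ENNReal} (hq : Measurable q) {A B : ℝ → E → E → ENNReal} (hA : IsKer A)
    (hB : IsKer B) : IsKer (stq q A B) := by
  constructor
  · unfold stq
    refine Measurable.lintegral_prod_right' (f := fun w : (ℝ × E × E) × (ℝ × E) =>
      A w.2.1 w.1.2.1 w.2.2 * q w.2.2 * B (w.1.1 - w.2.1) w.2.2 w.1.2.2) ?_
    exact ((hA.m2 (by fun_prop) (by fun_prop) (by fun_prop)).mul (hq.comp (by fun_prop))).mul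
      (hB.m2 (by fun_prop) (by fun_prop) (by fun_prop))
  · intro t ht x y
    unfold stq
    rw [lintegral_eq_zero_iff' ]
    · refine ae_of_all _ fun p => ?_
      by_cases hp : p.1 ≤ 0
      · simp [hA.zero _ hp]
      · simp [hB.zero (t - p.1) (by linarith)]
    · exact (((hA.m2 (by fun_prop) (by fun_prop) (by fun_prop)).mul (hq.comp (by fun_prop))).mul
        (hB.m2 (by fun_prop) (by fun_prop) (by fun_prop))).aemeasurable

lemma stq_assoc {q : E → ENNReal} (hq : Measurable q) {A B C : ℝ → E → E → ENNReal} (hA : IsKer A)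
    (hB : IsKer B) (hC : IsKer C) : stq q (stq q A B) C = stq q A (stq q B C) := by
  ext t x y
  have hm : Measurable fun w : (ℝ × E) × (ℝ × E) =>
      A w.2.1 x w.2.2 * q w.2.2 * B (w.1.1 - w.2.1) w.2.2 w.1.2 * (q w.1.2 * C (t - w.1.1) w.1.2 y) :=
    (((hA.m2 (by fun_prop) (by fun_prop) (by fun_prop)).mul (hq.comp (by fun_prop))).mul
      (hB.m2 (by fun_prop) (by fun_prop) (by fun_prop))).mul ((hq.comp (by fun_prop)).mul
      (hC.m2 (by fun_prop) (by fun_prop) (by fun_prop)))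
  calc stq q (stq q A B) C t x y = ∫⁻ p : ℝ × E, ∫⁻ p' : ℝ × E,
        A p'.1 x p'.2 * q p'.2 * B (p.1 - p'.1) p'.2 p.2 * (q p.2 * C (t - p.1) p.2 y) := by
        unfold stq
        refine lintegral_congr fun p => ?_
        rw [lintegral_mul_const, mul_assoc]
        exact ((hA.m2 (by fun_prop) (by fun_prop) (by fun_prop)).mul (hq.comp (by fun_prop))).mul
          (hB.m2 (by fun_prop) (by fun_prop) (by fun_prop))
    _ = ∫⁻ p' : ℝ × E, ∫⁻ p : ℝ × E,
        A p'.1 x p'.2 * q p'.2 * B (p.1 - p'.1) p'.2 p.2 * (q p.2 * C (t - p.1) p.2 y) :=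
        lintegral_lintegral_swap hm.aemeasurable
    _ = _ := by
        unfold stq
        refine lintegral_congr fun p' => ?_
        have hm2 : Measurable fun p : ℝ × E => B p.1 p'.2 p.2 * q p.2 * C (t - p'.1 - p.1) p.2 y :=
          (((hB.m2 (by fun_prop) (by fun_prop) (by fun_prop)).mul (hq.comp (by fun_prop))).mul
            (hC.m2 (by fun_prop) (by fun_prop) (by fun_prop)))
        rw [← lint_tr hm2 p'.1, ← lintegral_const_mul]
        swap
        · exact hm2.comp ((measurable_fst.sub_const p'.1).prodMk measurable_snd)
        refine lintegral_congr fun p => ?_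
        simp only
        rw [show t - p'.1 - (p.1 - p'.1) = t - p.1 by ring]
        ring

lemma Ap_meas {A : ℝ → E → E → ENNReal} (hA : IsKer A) {f : E → ENNReal} (hf : Measurable f) :
    Measurable fun p : ℝ × E => Ap A f p.1 p.2 := by
  unfold Ap
  refine Measurable.lintegral_prod_right' (f := fun w : (ℝ × E) × E => A w.1.1 w.1.2 w.2 * f w.2) ?_
  exact (hA.m2 (by fun_prop) (by fun_prop) (by fun_prop)).mul (hf.comp (by fun_prop))

lemma Ti_eq {A : ℝ → E → E → ENNReal} (hA : IsKer A) {f : E → ENNReal} (hf : Measurable f)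
    (t : ℝ) (x : E) : Ti A f t x = ∫⁻ p : ℝ × E, A p.1 x p.2 * (Iio t).indicator (fun _ => f p.2) p.1 := by
  have hm : Measurable fun p : ℝ × E => A p.1 x p.2 * (Iio t).indicator (fun _ => f p.2) p.1 := by
    refine (hA.m2 (by fun_prop) (by fun_prop) (by fun_prop)).mul ?_
    have : (fun p : ℝ × E => (Iio t).indicator (fun _ => f p.2) p.1) =
      {p : ℝ × E | p.1 < t}.indicator fun p => f p.2 := by ext p; simp [indicator]
    rw [this]
    exact (hf.comp measurable_snd).indicator (measurableSet_lt measurable_fst measurable_const)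
  rw [Measure.volume_eq_prod, lintegral_prod _ hm.aemeasurable, Ti, ← lintegral_indicator measurableSet_Iio]
  refine lintegral_congr fun s => ?_
  by_cases hs : s < t
  · simp [indicator, hs, Ap]
  · simp [indicator, hs]

lemma stq_app {q : E → ENNReal} (hq : Measurable q) {A B : ℝ → E → E → ENNReal} (hA : IsKer A)
    (hB : IsKer B) {f : E → ENNReal} (hf : Measurable f) (t : ℝ) (x : E) :
    Ap (stq q A B) f t x = ∫⁻ p : ℝ × E, A p.1 x p.2 * q p.2 * Ap B f (t - p.1) p.2 := by
  unfold Ap stq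
  have hm : Measurable fun w : E × (ℝ × E) =>
      A w.2.1 x w.2.2 * q w.2.2 * B (t - w.2.1) w.2.2 w.1 * f w.1 :=
    (((hA.m2 (by fun_prop) (by fun_prop) (by fun_prop)).mul (hq.comp (by fun_prop))).mul
      (hB.m2 (by fun_prop) (by fun_prop) (by fun_prop))).mul (hf.comp (by fun_prop))
  calc _ = ∫⁻ z, ∫⁻ p : ℝ × E, A p.1 x p.2 * q p.2 * B (t - p.1) p.2 z * f z := by
        refine lintegral_congr fun z => ?_
        rw [lintegral_mul_const]
        exact ((hA.m2 (by fun_prop) (by fun_prop) (by fun_prop)).mul (hq.comp (by fun_prop))).mul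
          (hB.m2 (by fun_prop) (by fun_prop) (by fun_prop))
    _ = ∫⁻ p : ℝ × E, ∫⁻ z, A p.1 x p.2 * q p.2 * B (t - p.1) p.2 z * f z :=
        lintegral_lintegral_swap hm.aemeasurable
    _ = _ := by
        refine lintegral_congr fun p => ?_
        rw [← lintegral_const_mul]
        · refine lintegral_congr fun z => ?_
          ring
        · exact (hB.m2 (by fun_prop) (by fun_prop) (by fun_prop)).mul hf

lemma Ti_meas {A : ℝ → E → E → ENNReal} (hA : IsKer A) {f : E → ENNReal} (hf : Measurable f) :
    Measurable fun p : ℝ × E => Ti A f p.1 p.2 := by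
  have : (fun p : ℝ × E => Ti A f p.1 p.2) = fun p : ℝ × E =>
      ∫⁻ s, (Iio p.1).indicator (fun s => Ap A f s p.2) s := by
    ext p; rw [Ti, lintegral_indicator measurableSet_Iio]
  rw [this]
  refine Measurable.lintegral_prod_right' (f := fun w : (ℝ × E) × ℝ =>
    (Iio w.1.1).indicator (fun s => Ap A f s w.1.2) w.2) ?_
  have e : (fun w : (ℝ × E) × ℝ => (Iio w.1.1).indicator (fun s => Ap A f s w.1.2) w.2) =
    {w : (ℝ × E) × ℝ | w.2 < w.1.1}.indicator fun w => Ap A f w.2 w.1.2 := by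
    ext w; simp [indicator]
  rw [e]
  refine Measurable.indicator ?_ (measurableSet_lt (by fun_prop) (by fun_prop))
  exact (Ap_meas hA hf).comp (by fun_prop : Measurable fun w : (ℝ × E) × ℝ => (w.2, w.1.2))

lemma stq_tint {q : E → ENNReal} (hq : Measurable q) {A B : ℝ → E → E → ENNReal} (hA : IsKer A)
    (hB : IsKer B) {f : E → ENNReal} (hf : Measurable f) (t : ℝ) (x : E) :
    Ti (stq q A B) f t x = ∫⁻ p : ℝ × E, A p.1 x p.2 * q p.2 * Ti B f (t - p.1) p.2 := by
  have hm : Measurable fun w : ℝ × (ℝ × E) =>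
      A w.2.1 x w.2.2 * q w.2.2 * Ap B f (w.1 - w.2.1) w.2.2 :=
    ((hA.m2 (by fun_prop) (by fun_prop) (by fun_prop)).mul (hq.comp (by fun_prop))).mul
      ((Ap_meas hB hf).comp (by fun_prop : Measurable fun w : ℝ × (ℝ × E) => (w.1 - w.2.1, w.2.2)))
  calc Ti (stq q A B) f t x = ∫⁻ s in Iio t, ∫⁻ p : ℝ × E,
        A p.1 x p.2 * q p.2 * Ap B f (s - p.1) p.2 := by
        unfold Ti
        refine lintegral_congr fun s => ?_
        rw [stq_app hq hA hB hf]
    _ = ∫⁻ p : ℝ × E, ∫⁻ s in Iio t, A p.1 x p.2 * q p.2 * Ap B f (s - p.1) p.2 :=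
        lintegral_lintegral_swap hm.aemeasurable
    _ = _ := by
        refine lintegral_congr fun p => ?_
        have hm2 : Measurable fun s : ℝ => Ap B f (s - p.1) p.2 :=
          (Ap_meas hB hf).comp (by fun_prop : Measurable fun s : ℝ => (s - p.1, p.2))
        rw [lintegral_const_mul _ hm2]
        congr 1
        rw [Ti, ← lintegral_indicator measurableSet_Iio, ← lintegral_indicator measurableSet_Iio,
          ← lintegral_sub_right_eq_self ((Iio (t - p.1)).indicator _) p.1]
        refine lintegral_congr fun s => ?_
        simp [indicator]

/-- Summands of the perturbation series. -/
def kN (k : ℝ → E → E → ENNReal) (q : E → ENNReal) : ℕ → ℝ → E → E → ENNReal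
  | 0 => k
  | n + 1 => stq q (kN k q n) k

lemma kN_ker {k : ℝ → E → E → ENNReal} {q : E → ENNReal} (hk : IsKer k) (hq : Measurable q) (n : ℕ) :
    IsKer (kN k q n) := by
  induction n with
  | zero => exact hk
  | succ n ih => exact stq_ker hq ih hk

lemma kN_first {k : ℝ → E → E → ENNReal} {q : E → ENNReal} (hk : IsKer k) (hq : Measurable q) (n : ℕ) :
    kN k q (n + 1) = stq q k (kN k q n) := by
  induction n with
  | zero => rfl
  | succ n ih =>
    calc kN k q (n + 2) = stq q (kN k q (n + 1)) k := rfl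
      _ = stq q (stq q k (kN k q n)) k := by rw [ih]
      _ = stq q k (stq q (kN k q n) k) := stq_assoc hq hk (kN_ker hk hq n) hk
      _ = _ := rfl

lemma kN_symm {k : ℝ → E → E → ENNReal} {q : E → ENNReal} (hk : IsKer k) (hq : Measurable q)
    (hs : ∀ t x y, k t x y = k t y x) (n : ℕ) : ∀ t x y, kN k q n t x y = kN k q n t y x := by
  induction n with
  | zero => exact hs
  | succ n ih =>
    intro t x y
    have hn := kN_ker hk hq n
    rw [show kN k q (n + 1) t y x = stq q k (kN k q n) t y x by rw [kN_first hk hq]]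
    show stq q (kN k q n) k t x y = _
    unfold stq
    have hm : Measurable fun p : ℝ × E => kN k q n p.1 x p.2 * q p.2 * k (t - p.1) p.2 y :=
      ((hn.m2 (by fun_prop) (by fun_prop) (by fun_prop)).mul (hq.comp (by fun_prop))).mul
        (hk.m2 (by fun_prop) (by fun_prop) (by fun_prop))
    have hm2 : Measurable fun p : ℝ × E => k p.1 y p.2 * q p.2 * kN k q n (t - p.1) p.2 x :=
      ((hk.m2 (by fun_prop) (by fun_prop) (by fun_prop)).mul (hq.comp (by fun_prop))).mul
        (hn.m2 (by fun_prop) (by fun_prop) (by fun_prop))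
    rw [Measure.volume_eq_prod, lintegral_prod _ hm.aemeasurable, lintegral_prod _ hm2.aemeasurable,
      ← lintegral_sub_left_eq_self _ t]
    refine lintegral_congr fun s => lintegral_congr fun z => ?_
    simp only [sub_sub_cancel]
    rw [ih (t - s) x z, hs s z y]
    ring

/-- The perturbed kernel. -/
def kT (k : ℝ → E → E → ENNReal) (q : E → ENNReal) (t : ℝ) (x y : E) : ENNReal :=
  ∑' n, kN k q n t x y

lemma kT_ker {k : ℝ → E → E → ENNReal} {q : E → ENNReal} (hk : IsKer k) (hq : Measurable q) :
    IsKer (kT k q) := by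
  refine ⟨Measurable.tsum fun n => (kN_ker hk hq n).meas, fun t ht x y => ?_⟩
  simp [kT, fun n => (kN_ker hk hq n).zero t ht x y]

lemma kT_symm {k : ℝ → E → E → ENNReal} {q : E → ENNReal} (hk : IsKer k) (hq : Measurable q)
    (hs : ∀ t x y, k t x y = k t y x) (t x y) : kT k q t x y = kT k q t y x :=
  tsum_congr fun n => kN_symm hk hq hs n t x y

lemma le_kT {k : ℝ → E → E → ENNReal} {q : E → ENNReal} (t x y) : k t x y ≤ kT k q t x y :=
  ENNReal.le_tsum 0

end Pert

section Pert
variable {E : Type*} [MeasureSpace E] [SFinite (volume : Measure E)]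

lemma stq_iter {q : E → ENNReal} (hq : Measurable q) {A B : ℝ → E → E → ENNReal} (hA : IsKer A)
    (hB : IsKer B) (t : ℝ) (x y : E) :
    stq q A B t x y = ∫⁻ s, ∫⁻ z, A s x z * q z * B (t - s) z y := by
  unfold stq
  rw [Measure.volume_eq_prod, lintegral_prod]
  exact (((hA.m2 (by fun_prop) (by fun_prop) (by fun_prop)).mul (hq.comp (by fun_prop))).mul
    (hB.m2 (by fun_prop) (by fun_prop) (by fun_prop))).aemeasurable

/-- Super Chapman-Kolmogorov inequality for the summands. -/
lemma kN_sck {k : ℝ → E → E → ENNReal} {q : E → ENNReal} (hk : IsKer k) (hq : Measurable q)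
    (hck : ∀ t s, 0 < t → 0 < s → ∀ x y, ∫⁻ z, k t x z * k s z y = k (t + s) x y) (n : ℕ) :
    ∀ t s, 0 < t → 0 < s → ∀ x y, ∑ ij ∈ Finset.HasAntidiagonal.antidiagonal n,
      ∫⁻ v, kN k q ij.1 t x v * kN k q ij.2 s v y ≤ kN k q n (t + s) x y := by
  induction n with
  | zero =>
    intro t s ht hs x y
    simp only [Finset.HasAntidiagonal.antidiagonal_zero, Finset.sum_singleton]
    exact (hck t s ht hs x y).le
  | succ n ih =>
    intro t s ht hs x y
    have hK := kN_ker hk hq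
    have hmi : ∀ r, Measurable fun w : E × E => kN k q n r x w.1 * q w.1 * k (t + s - r) w.1 y :=
      fun r => (((hK n).m2 (by fun_prop) (by fun_prop) (by fun_prop)).mul (hq.comp (by fun_prop))).mul
        (hk.m2 (by fun_prop) (by fun_prop) (by fun_prop))
    rw [Finset.Nat.sum_antidiagonal_succ']
    have hR : kN k q (n + 1) (t + s) x y =
      (∫⁻ r in Iio t, ∫⁻ z, kN k q n r x z * q z * k (t + s - r) z y) +
      ∫⁻ r in Ici t, ∫⁻ z, kN k q n r x z * q z * k (t + s - r) z y := by
      show stq q (kN k q n) k (t + s) x y = _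
      rw [stq_iter hq (hK n) hk, ← compl_Iio, lintegral_add_compl _ measurableSet_Iio]
    rw [hR]
    refine add_le_add ?_ ?_
    · -- last index zero
      show ∫⁻ v, stq q (kN k q n) k t x v * k s v y ≤ _
      have e1 : ∫⁻ v, stq q (kN k q n) k t x v * k s v y =
          ∫⁻ p : ℝ × E, kN k q n p.1 x p.2 * q p.2 * Ap k (fun v => k s v y) (t - p.1) p.2 := by
        have := stq_app hq (hK n) hk (f := fun v => k s v y)
          (hk.m2 (by fun_prop) (by fun_prop) (by fun_prop)) t x
        exact this
      rw [e1, Measure.volume_eq_prod, lintegral_prod]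
      · rw [← lintegral_indicator measurableSet_Iio]
        refine lintegral_mono fun r => ?_
        by_cases hr : r < t
        · rw [indicator_of_mem (show r ∈ Iio t from hr)]
          refine lintegral_mono fun z => ?_
          refine mul_le_mul_right (le_of_eq ?_) _
          have := hck (t - r) s (by linarith) hs z y
          rw [Ap, this]; congr 1; ring
        · rw [indicator_of_notMem (show r ∉ Iio t from hr)]
          simp [Ap, fun z v => hk.zero (t - r) (by linarith) z v]
      · exact (((hK n).m2 (by fun_prop) (by fun_prop) (by fun_prop)).mul
          (hq.comp (by fun_prop))).mul ((Ap_meas hk (f := fun v => k s v y)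
          (hk.m2 (by fun_prop) (by fun_prop) (by fun_prop))).comp
            (by fun_prop : Measurable fun p : ℝ × E => (t - p.1, p.2))) |>.aemeasurable
    · have e2 : ∫⁻ r in Ici t, ∫⁻ z, kN k q n r x z * q z * k (t + s - r) z y =
          ∫⁻ r in Ici 0, ∫⁻ z, kN k q n (t + r) x z * q z * k (s - r) z y := by
        rw [← lintegral_indicator measurableSet_Ici, ← lintegral_indicator measurableSet_Ici,
          ← lintegral_add_left_eq_self ((Ici t).indicator _) t]
        refine lintegral_congr fun r => ?_
        by_cases hr : 0 ≤ r
        · rw [indicator_of_mem (show t + r ∈ Ici t by simpa using hr),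
            indicator_of_mem (show r ∈ Ici 0 from hr)]
          refine lintegral_congr fun z => ?_
          congr 2; ring
        · rw [indicator_of_notMem (show t + r ∉ Ici t by simpa using hr),
            indicator_of_notMem (show r ∉ Ici 0 from hr)]
      have e3 : ∀ ij ∈ Finset.HasAntidiagonal.antidiagonal n, ∫⁻ v, kN k q ij.1 t x v * kN k q (ij.2 + 1) s v y =
          ∫⁻ r, ∫⁻ z, (∫⁻ v, kN k q ij.1 t x v * kN k q ij.2 r v z) * (q z * k (s - r) z y) := by
        intro ij _
        have hm1 : Measurable fun w : E × (ℝ × E) => kN k q ij.1 t x w.1 *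
            (kN k q ij.2 w.2.1 w.1 w.2.2 * q w.2.2 * k (s - w.2.1) w.2.2 y) :=
          ((hK _).m2 (by fun_prop) (by fun_prop) (by fun_prop)).mul
            ((((hK _).m2 (by fun_prop) (by fun_prop) (by fun_prop)).mul (hq.comp (by fun_prop))).mul
              (hk.m2 (by fun_prop) (by fun_prop) (by fun_prop)))
        have hm2 : Measurable fun w : (ℝ × E) × E => kN k q ij.1 t x w.2 * kN k q ij.2 w.1.1 w.2 w.1.2 :=
          ((hK _).m2 (by fun_prop) (by fun_prop) (by fun_prop)).mul
            ((hK _).m2 (by fun_prop) (by fun_prop) (by fun_prop))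
        calc _ = ∫⁻ v, ∫⁻ p : ℝ × E, kN k q ij.1 t x v *
            (kN k q ij.2 p.1 v p.2 * q p.2 * k (s - p.1) p.2 y) := by
              refine lintegral_congr fun v => ?_
              rw [lintegral_const_mul]
              · rfl
              · exact (((hK _).m2 (by fun_prop) (by fun_prop) (by fun_prop)).mul
                  (hq.comp (by fun_prop))).mul (hk.m2 (by fun_prop) (by fun_prop) (by fun_prop))
          _ = ∫⁻ p : ℝ × E, ∫⁻ v, kN k q ij.1 t x v *
            (kN k q ij.2 p.1 v p.2 * q p.2 * k (s - p.1) p.2 y) :=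
              lintegral_lintegral_swap hm1.aemeasurable
          _ = ∫⁻ p : ℝ × E, (∫⁻ v, kN k q ij.1 t x v * kN k q ij.2 p.1 v p.2) *
                (q p.2 * k (s - p.1) p.2 y) := by
              refine lintegral_congr fun p => ?_
              rw [← lintegral_mul_const]
              · refine lintegral_congr fun v => ?_
                ring
              · exact ((hK _).m2 (by fun_prop) (by fun_prop) (by fun_prop)).mul
                  ((hK _).m2 (by fun_prop) (by fun_prop) (by fun_prop))
          _ = _ := by
              rw [Measure.volume_eq_prod, lintegral_prod]
              exact ((Measurable.lintegral_prod_right' hm2).mul ((hq.comp (by fun_prop)).mul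
                (hk.m2 (by fun_prop) (by fun_prop) (by fun_prop)))).aemeasurable
      have hm4 : ∀ ij : ℕ × ℕ, Measurable fun w : ℝ × E =>
          (∫⁻ v, kN k q ij.1 t x v * kN k q ij.2 w.1 v w.2) * (q w.2 * k (s - w.1) w.2 y) := by
        intro ij
        have hm2 : Measurable fun w : (ℝ × E) × E => kN k q ij.1 t x w.2 * kN k q ij.2 w.1.1 w.2 w.1.2 :=
          ((hK _).m2 (by fun_prop) (by fun_prop) (by fun_prop)).mul
            ((hK _).m2 (by fun_prop) (by fun_prop) (by fun_prop))
        exact ((Measurable.lintegral_prod_right' hm2).mul ((hq.comp (by fun_prop)).mul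
                (hk.m2 (by fun_prop) (by fun_prop) (by fun_prop))))
      rw [e2, Finset.sum_congr rfl e3, ← lintegral_finsetSum]
      · rw [← lintegral_indicator measurableSet_Ici]
        refine lintegral_mono fun r => ?_
        have hm5 : ∀ ij : ℕ × ℕ, Measurable fun z : E =>
            (∫⁻ v, kN k q ij.1 t x v * kN k q ij.2 r v z) * (q z * k (s - r) z y) := fun ij => by
          have := (hm4 ij).comp (by fun_prop : Measurable fun z : E => (r, z))
          exact this
        rw [← lintegral_finsetSum _ fun ij _ => hm5 ij]
        by_cases hr : 0 < r
        · rw [indicator_of_mem (show r ∈ Ici 0 from hr.le)]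
          refine lintegral_mono fun z => ?_
          rw [← Finset.sum_mul, mul_assoc]
          exact mul_le_mul_left (ih t r ht hr x z) _
        · refine le_trans (le_of_eq ?_) bot_le
          simp [fun n z v => (hK n).zero r (not_lt.1 hr) z v]
      · exact fun ij _ => Measurable.lintegral_prod_right' (hm4 ij)

lemma kT_sck {k : ℝ → E → E → ENNReal} {q : E → ENNReal} (hk : IsKer k) (hq : Measurable q)
    (hck : ∀ t s, 0 < t → 0 < s → ∀ x y, ∫⁻ z, k t x z * k s z y = k (t + s) x y)
    {t s : ℝ} (ht : 0 < t) (hs : 0 < s) (x y : E) :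
    ∫⁻ v, kT k q t x v * kT k q s v y ≤ kT k q (t + s) x y := by
  have hK := kN_ker hk hq
  have hm : ∀ i j, Measurable fun v => kN k q i t x v * kN k q j s v y := fun i j =>
    ((hK _).m2 (by fun_prop) (by fun_prop) (by fun_prop)).mul
      ((hK _).m2 (by fun_prop) (by fun_prop) (by fun_prop))
  calc ∫⁻ v, kT k q t x v * kT k q s v y
      = ∫⁻ v, ∑' ij : ℕ × ℕ, kN k q ij.1 t x v * kN k q ij.2 s v y := by
        refine lintegral_congr fun v => ?_
        rw [ENNReal.tsum_prod' (f := fun ij : ℕ × ℕ => kN k q ij.1 t x v * kN k q ij.2 s v y)]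
        simp_rw [ENNReal.tsum_mul_left, ENNReal.tsum_mul_right]
        rfl
    _ = ∑' ij : ℕ × ℕ, ∫⁻ v, kN k q ij.1 t x v * kN k q ij.2 s v y :=
        lintegral_tsum fun ij => (hm _ _).aemeasurable
    _ = ∑' n, ∑ ij ∈ Finset.HasAntidiagonal.antidiagonal n, ∫⁻ v, kN k q ij.1 t x v * kN k q ij.2 s v y := by
        rw [← Finset.HasAntidiagonal.sigmaAntidiagonalEquivProd.tsum_eq, ENNReal.tsum_sigma']
        refine tsum_congr fun n => ?_
        rw [tsum_fintype, ← Finset.sum_coe_sort (Finset.HasAntidiagonal.antidiagonal n)]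
        rfl
    _ ≤ _ := ENNReal.tsum_le_tsum fun n => kN_sck hk hq hck n t s ht hs x y

end Pert

section Pert
variable {E : Type*} [MeasureSpace E] [SFinite (volume : Measure E)]

lemma Ap_zero {A : ℝ → E → E → ENNReal} (hA : IsKer A) {t : ℝ} (ht : t ≤ 0) (f : E → ENNReal) (x : E) :
    Ap A f t x = 0 := by
  simp [Ap, fun z => hA.zero t ht x z]

lemma Ti_zero {A : ℝ → E → E → ENNReal} (hA : IsKer A) {t : ℝ} (ht : t ≤ 0) (f : E → ENNReal) (x : E) :
    Ti A f t x = 0 := by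
  unfold Ti
  rw [setLIntegral_congr_fun measurableSet_Iio (g := fun _ => 0)
    (fun s (hs : s < t) => Ap_zero hA (hs.le.trans ht) f x)]
  simp

lemma Ti_Ioo {A : ℝ → E → E → ENNReal} (hA : IsKer A) (t : ℝ) (f : E → ENNReal) (x : E) :
    Ti A f t x = ∫⁻ s in Ioo 0 t, Ap A f s x := by
  unfold Ti
  rw [← lintegral_indicator measurableSet_Iio, ← lintegral_indicator measurableSet_Ioo]
  refine lintegral_congr fun s => ?_
  by_cases hs : 0 < s
  · simp [indicator, hs]
  · simp [indicator, hs, Ap_zero hA (not_lt.1 hs)]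

lemma Ap_mono {A : ℝ → E → E → ENNReal} {f g : E → ENNReal} (h : ∀ᵐ z, f z ≤ g z) (s : ℝ) (x : E) :
    Ap A f s x ≤ Ap A g s x := by
  refine lintegral_mono_ae ?_
  filter_upwards [h] with z hz
  exact mul_le_mul_right hz _

lemma Ti_mono {A : ℝ → E → E → ENNReal} {f g : E → ENNReal} (h : ∀ᵐ z, f z ≤ g z) (s : ℝ) (x : E) :
    Ti A f s x ≤ Ti A g s x := lintegral_mono fun _ => Ap_mono h _ _

lemma Ap_mono_ker {A B : ℝ → E → E → ENNReal} (h : ∀ t x y, A t x y ≤ B t x y) (f : E → ENNReal)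
    (s : ℝ) (x : E) : Ap A f s x ≤ Ap B f s x :=
  lintegral_mono fun z => mul_le_mul_left (h s x z) _

lemma Ti_mono_ker {A B : ℝ → E → E → ENNReal} (h : ∀ t x y, A t x y ≤ B t x y) (f : E → ENNReal)
    (s : ℝ) (x : E) : Ti A f s x ≤ Ti B f s x :=
  lintegral_mono fun _ => Ap_mono_ker h f _ x

lemma Ap_add {A : ℝ → E → E → ENNReal} (hA : IsKer A) {f g : E → ENNReal} (hf : Measurable f)
    (s : ℝ) (x : E) : Ap A (fun z => f z + g z) s x = Ap A f s x + Ap A g s x := by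
  unfold Ap
  simp_rw [mul_add]
  rw [lintegral_add_left]
  exact (hA.m2 (by fun_prop) (by fun_prop) (by fun_prop)).mul hf

lemma Ti_add {A : ℝ → E → E → ENNReal} (hA : IsKer A) {f g : E → ENNReal} (hf : Measurable f)
    (s : ℝ) (x : E) : Ti A (fun z => f z + g z) s x = Ti A f s x + Ti A g s x := by
  unfold Ti
  simp_rw [Ap_add hA hf]
  rw [lintegral_add_left]
  exact (Ap_meas hA hf).comp (by fun_prop : Measurable fun s : ℝ => (s, x))

lemma Ap_smul {A : ℝ → E → E → ENNReal} (hA : IsKer A) {f : E → ENNReal} (hf : Measurable f)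
    (c : ENNReal) (s : ℝ) (x : E) : Ap A (fun z => c * f z) s x = c * Ap A f s x := by
  unfold Ap
  rw [← lintegral_const_mul]
  · refine lintegral_congr fun z => ?_
    ring
  exact (hA.m2 (by fun_prop) (by fun_prop) (by fun_prop)).mul hf

lemma Ti_smul {A : ℝ → E → E → ENNReal} (hA : IsKer A) {f : E → ENNReal} (hf : Measurable f)
    (c : ENNReal) (s : ℝ) (x : E) : Ti A (fun z => c * f z) s x = c * Ti A f s x := by
  unfold Ti
  simp_rw [Ap_smul hA hf]
  rw [lintegral_const_mul]
  exact (Ap_meas hA hf).comp (by fun_prop : Measurable fun s : ℝ => (s, x))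

variable {k : ℝ → E → E → ENNReal} {q : E → ENNReal} (hk : IsKer k) (hq : Measurable q)

lemma Ap_kT (hk : IsKer k) (hq : Measurable q) {f : E → ENNReal} (hf : Measurable f) (t : ℝ) (x : E) :
    Ap (kT k q) f t x = ∑' n, Ap (kN k q n) f t x := by
  unfold Ap kT
  simp_rw [← ENNReal.tsum_mul_right]
  exact lintegral_tsum fun n =>
    (((kN_ker hk hq n).m2 (by fun_prop) (by fun_prop) (by fun_prop)).mul hf).aemeasurable

lemma Ti_kT (hk : IsKer k) (hq : Measurable q) {f : E → ENNReal} (hf : Measurable f) (t : ℝ) (x : E) :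
    Ti (kT k q) f t x = ∑' n, Ti (kN k q n) f t x := by
  unfold Ti
  simp_rw [Ap_kT hk hq hf]
  refine lintegral_tsum fun n => Measurable.aemeasurable ?_
  exact (Ap_meas (kN_ker hk hq n) hf).comp (by fun_prop : Measurable fun s : ℝ => (s, x))

/-- The balance identity for a pair of functions. -/
def Bal (k : ℝ → E → E → ENNReal) (u g : E → ENNReal) : Prop :=
  ∀ t, 0 < t → ∀ x, Ap k u t x + Ti k g t x = u x

lemma Bal.succ {u g : E → ENNReal} (hb : Bal k u g) (hk : IsKer k) (hq : Measurable q)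
    (hu : Measurable u) (hg : Measurable g) (n : ℕ) (t : ℝ) (x : E) :
    Ap (kN k q (n + 1)) u t x + Ti (kN k q (n + 1)) g t x = Ti (kN k q n) (fun z => q z * u z) t x := by
  have hn := kN_ker hk hq n
  have hmA : Measurable fun p : ℝ × E => Ap k u (t - p.1) p.2 :=
    (Ap_meas hk hu).comp (by fun_prop : Measurable fun p : ℝ × E => (t - p.1, p.2))
  show Ap (stq q (kN k q n) k) u t x + Ti (stq q (kN k q n) k) g t x = _
  have hqu : Measurable fun z => q z * u z := hq.mul hu
  rw [stq_app hq hn hk hu, stq_tint hq hn hk hg, Ti_eq hn hqu, ← lintegral_add_left]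
  · refine lintegral_congr fun p => ?_
    rw [← mul_add]
    by_cases hp : p.1 < t
    · rw [hb _ (by linarith), indicator_of_mem (show p.1 ∈ Iio t from hp), mul_assoc]
    · rw [Ap_zero hk (by linarith), Ti_zero hk (by linarith),
        indicator_of_notMem (show p.1 ∉ Iio t from hp)]
      simp
  · exact ((hn.m2 (by fun_prop) (by fun_prop) (by fun_prop)).mul (hq.comp (by fun_prop))).mul hmA

lemma Bal.weighted {u g : E → ENNReal} (hb : Bal k u g) (hk : IsKer k) (hq : Measurable q)
    (hu : Measurable u) (hg : Measurable g) (θ : ENNReal) {t : ℝ} (ht : 0 < t) (x : E) :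
    (∑' n, θ ^ n * Ap (kN k q n) u t x) + ∑' n, θ ^ n * Ti (kN k q n) g t x =
      u x + θ * ∑' n, θ ^ n * Ti (kN k q n) (fun z => q z * u z) t x := by
  rw [← ENNReal.tsum_add]
  simp_rw [← mul_add]
  rw [tsum_eq_zero_add' ENNReal.summable]
  simp_rw [hb.succ hk hq hu hg]
  rw [pow_zero, one_mul, show Ap (kN k q 0) u t x + Ti (kN k q 0) g t x = u x from hb t ht x,
    ← ENNReal.tsum_mul_left]
  congr 1
  refine tsum_congr fun n => ?_
  ring

lemma Ti_gbound (hk : IsKer k) (hq : Measurable q) {u g : E → ENNReal}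
    (hu : Measurable u) {ρ C : ENNReal}
    (hgu : ∀ᵐ z, g z ≤ (ρ * q z + C) * u z) (n : ℕ) (t : ℝ) (x : E) :
    Ti (kN k q n) g t x ≤ ρ * Ti (kN k q n) (fun z => q z * u z) t x + C * Ti (kN k q n) u t x := by
  have hn := kN_ker hk hq n
  have hqu : Measurable fun z => q z * u z := hq.mul hu
  rw [← Ti_smul hn hqu, ← Ti_smul hn hu, ← Ti_add hn (by fun_prop)]
  refine Ti_mono ?_ _ _
  filter_upwards [hgu] with z hz
  refine hz.trans (le_of_eq ?_)
  ring

lemma Bal.key {u g : E → ENNReal} (hb : Bal k u g) (hk : IsKer k) (hq : Measurable q)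
    (hu : Measurable u) (hg : Measurable g) {θ ρ C : ENNReal} (hθ : θ ≤ 1)
    (hgu : ∀ᵐ z, g z ≤ (ρ * q z + C) * u z) {t : ℝ} (ht : 0 < t) (x : E) :
    u x + θ * ∑' n, θ ^ n * Ti (kN k q n) (fun z => q z * u z) t x ≤
      Ap (kT k q) u t x + C * Ti (kT k q) u t x +
        ρ * ∑' n, θ ^ n * Ti (kN k q n) (fun z => q z * u z) t x := by
  rw [← hb.weighted hk hq hu hg θ ht x, Ap_kT hk hq hu, Ti_kT hk hq hu, ← ENNReal.tsum_mul_left,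
    ← ENNReal.tsum_mul_left, add_assoc]
  have hp : ∀ n : ℕ, θ ^ n ≤ 1 := fun n => pow_le_one₀ bot_le hθ
  refine add_le_add (ENNReal.tsum_le_tsum fun n => mul_le_of_le_one_left bot_le (hp n)) ?_
  rw [← ENNReal.tsum_add]
  refine ENNReal.tsum_le_tsum fun n => ?_
  calc _ ≤ θ ^ n * (ρ * Ti (kN k q n) (fun z => q z * u z) t x + C * Ti (kN k q n) u t x) :=
        mul_le_mul_right (Ti_gbound hk hq hu hgu n t x) _
    _ = θ ^ n * (C * Ti (kN k q n) u t x) + ρ * (θ ^ n * Ti (kN k q n) (fun z => q z * u z) t x) := by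
        ring
    _ ≤ _ := add_le_add (mul_le_of_le_one_left bot_le (hp n)) le_rfl

/-- Lower bound for the perturbed semigroup (K1). -/
lemma Bal.lower {u g : E → ENNReal} (hb : Bal k u g) (hk : IsKer k) (hq : Measurable q)
    (hu : Measurable u) (hg : Measurable g) {θ C : ENNReal} (hθ : θ ≤ 1)
    (hgu : ∀ᵐ z, g z ≤ (θ * q z + C) * u z) {t : ℝ} (ht : 0 < t) (x : E)
    (hfin : ∑' n, θ ^ n * Ti (kN k q n) (fun z => q z * u z) t x ≠ ⊤) :
    u x ≤ Ap (kT k q) u t x + C * Ti (kT k q) u t x := by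
  have h := hb.key hk hq hu hg hθ hgu ht x
  exact (ENNReal.add_le_add_iff_right (ENNReal.mul_ne_top (ne_top_of_le_ne_top ENNReal.one_ne_top hθ)
    hfin)).1 h

/-- Upper bound for the potential of the perturbed semigroup (K2). -/
lemma Bal.upper {u g : E → ENNReal} (hb : Bal k u g) (hk : IsKer k) (hq : Measurable q)
    (hu : Measurable u) (hg : Measurable g) {ρ : ℝ} {C : ENNReal} (hρ0 : 0 ≤ ρ) (hρ : ρ < 1)
    (hgu : ∀ᵐ z, g z ≤ (ENNReal.ofReal ρ * q z + C) * u z) {t : ℝ} (ht : 0 < t) (x : E)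
    (hfin : ∀ θ : ENNReal, θ < 1 → ∑' n, θ ^ n * Ti (kN k q n) (fun z => q z * u z) t x ≠ ⊤) :
    ENNReal.ofReal ((1 - ρ) / 4) * Ti (kT k q) (fun z => q z * u z) t x ≤
      Ap (kT k q) u t x + C * Ti (kT k q) u t x := by
  have hqu : Measurable fun z => q z * u z := hq.mul hu
  rw [Ti_kT hk hq hqu, ← ENNReal.tsum_mul_left]
  refine ENNReal.tsum_le_of_sum_range_le fun N => ?_
  rw [← Finset.mul_sum]
  -- choose the weight
  obtain ⟨θ, hθ1, hθ2, hθ3⟩ : ∃ θ : ℝ, θ < 1 ∧ (1 + ρ) / 2 ≤ θ ∧ 1 / 2 ≤ θ ^ N := by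
    have hc : Tendsto (fun θ : ℝ => θ ^ N) (nhdsWithin 1 (Iio 1)) (nhds 1) := by
      have : ContinuousAt (fun θ : ℝ => θ ^ N) 1 := (continuous_pow N).continuousAt
      have h2 := this.tendsto
      simp only [one_pow] at h2
      exact h2.mono_left nhdsWithin_le_nhds
    have h1 : ∀ᶠ θ in nhdsWithin (1:ℝ) (Iio 1), 1 / 2 < θ ^ N :=
      hc.eventually (lt_mem_nhds (by norm_num))
    have h2 : ∀ᶠ θ in nhdsWithin (1:ℝ) (Iio 1), (1 + ρ) / 2 < θ :=
      nhdsWithin_le_nhds (lt_mem_nhds (by linarith))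
    obtain ⟨θ, h⟩ := (h1.and (h2.and self_mem_nhdsWithin)).exists
    exact ⟨θ, h.2.2, h.2.1.le, h.1.le⟩
  have hθ0 : 0 < θ := by linarith
  have hlt : ENNReal.ofReal θ < 1 := by
    rw [← ENNReal.ofReal_one]; exact (ENNReal.ofReal_lt_ofReal_iff one_pos).2 hθ1
  set S := ∑' n, ENNReal.ofReal θ ^ n * Ti (kN k q n) (fun z => q z * u z) t x with hS
  have hSf : S ≠ ⊤ := hfin _ hlt
  have h := hb.key hk hq hu hg hlt.le hgu ht x
  rw [← hS] at h
  have h2 : ENNReal.ofReal (θ - ρ) * S ≤ Ap (kT k q) u t x + C * Ti (kT k q) u t x := by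
    refine (ENNReal.add_le_add_iff_right (ENNReal.mul_ne_top (ENNReal.ofReal_ne_top (r := ρ)) hSf)).1 ?_
    rw [← add_mul, ← ENNReal.ofReal_add (by linarith) hρ0, sub_add_cancel]
    exact le_trans le_add_self h
  refine le_trans ?_ h2
  have h3 : ENNReal.ofReal (1 / 2) * ∑ n ∈ Finset.range N, Ti (kN k q n) (fun z => q z * u z) t x ≤ S := by
    refine le_trans ?_ (ENNReal.sum_le_tsum (Finset.range N))
    rw [Finset.mul_sum]
    refine Finset.sum_le_sum fun n hn => mul_le_mul_left ?_ _
    rw [← ENNReal.ofReal_pow hθ0.le]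
    refine ENNReal.ofReal_le_ofReal (hθ3.trans ?_)
    exact pow_le_pow_of_le_one hθ0.le hθ1.le (Finset.mem_range.1 hn).le
  calc _ = ENNReal.ofReal ((1 - ρ) / 2) * (ENNReal.ofReal (1 / 2) *
        ∑ n ∈ Finset.range N, Ti (kN k q n) (fun z => q z * u z) t x) := by
        rw [← mul_assoc, ← ENNReal.ofReal_mul (by linarith)]
        congr 2; ring
    _ ≤ _ := mul_le_mul' (ENNReal.ofReal_le_ofReal (by linarith)) h3

/-- Supermedian property. -/
lemma Bal.sup {h g : E → ENNReal} (hb : Bal k h g) (hk : IsKer k) (hq : Measurable q)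
    (hh : Measurable h) (hg : Measurable g) (hgq : ∀ᵐ z, g z = q z * h z) {t : ℝ} (ht : 0 < t) (x : E)
    (N : ℕ) : ∑ n ∈ Finset.range (N + 1), Ap (kN k q n) h t x +
      Ti (kN k q N) (fun z => q z * h z) t x = h x := by
  have he : ∀ n, Ti (kN k q n) g t x = Ti (kN k q n) (fun z => q z * h z) t x := fun n =>
    le_antisymm (Ti_mono (hgq.mono fun _ hz => hz.le) _ _) (Ti_mono (hgq.mono fun _ hz => hz.ge) _ _)
  induction N with
  | zero =>
    rw [← he 0]
    simp only [zero_add, Finset.range_one, Finset.sum_singleton]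
    exact hb t ht x
  | succ N ih =>
    rw [Finset.sum_range_succ, add_assoc, ← he (N + 1), hb.succ hk hq hh hg, ih]

lemma Bal.sup_Ap {h g : E → ENNReal} (hb : Bal k h g) (hk : IsKer k) (hq : Measurable q)
    (hh : Measurable h) (hg : Measurable g) (hgq : ∀ᵐ z, g z = q z * h z) {t : ℝ} (ht : 0 < t) (x : E) :
    Ap (kT k q) h t x ≤ h x := by
  rw [Ap_kT hk hq hh]
  refine ENNReal.tsum_le_of_sum_range_le fun N => ?_
  rw [← hb.sup hk hq hh hg hgq ht x N]
  exact le_trans (Finset.sum_le_sum_of_subset (Finset.range_mono (Nat.le_succ N))) le_self_add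

lemma Bal.sup_Ti {h g : E → ENNReal} (hb : Bal k h g) (hk : IsKer k) (hq : Measurable q)
    (hh : Measurable h) (hg : Measurable g) (hgq : ∀ᵐ z, g z = q z * h z) {t : ℝ} (ht : 0 < t) (x : E)
    (N : ℕ) : Ti (kN k q N) (fun z => q z * h z) t x ≤ h x := by
  rw [← hb.sup hk hq hh hg hgq ht x N]
  exact le_add_self

end Pert

section Pert
variable {E : Type*} [MeasureSpace E] [SFinite (volume : Measure E)]
variable {k : ℝ → E → E → ENNReal} {q : E → ENNReal}

lemma lint_exp_Ioo {Q s : ℝ} (hQ : 0 ≤ Q) (hs : 0 < s) :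
    ∫⁻ r in Ioo 0 s, ENNReal.ofReal (Q * Real.exp (Q * r)) = ENNReal.ofReal (Real.exp (Q * s) - 1) := by
  rw [setLIntegral_congr Ioo_ae_eq_Ioc]
  have hi : IntervalIntegrable (fun r => Q * Real.exp (Q * r)) volume 0 s :=
    Continuous.intervalIntegrable (by fun_prop) _ _
  have hd : ∀ r ∈ uIcc 0 s, HasDerivAt (fun r => Real.exp (Q * r)) (Q * Real.exp (Q * r)) r := by
    intro r _
    have := ((hasDerivAt_id r).const_mul Q).exp
    simp only [id, mul_one] at this
    rwa [mul_comm] at this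
  rw [← ofReal_integral_eq_lintegral_ofReal hi.1 (Filter.Eventually.of_forall fun r => by positivity),
    ← intervalIntegral.integral_of_le hs.le, intervalIntegral.integral_eq_sub_of_hasDerivAt hd hi]
  simp

lemma Ap_one_split (hk : IsKer k) (hq : Measurable q) {B : Set E} {h : E → ENNReal}
    (hh : Measurable h) {m Q : ENNReal} {t : ℝ}
    (hB1 : ∀ z ∈ B, ∀ u, 0 < u → u ≤ t → 1 ≤ m * Ap k h u z) (hB2 : ∀ z, z ∉ B → q z ≤ Q)
    (h1 : ∀ u x, Ap k (fun _ => 1) u x ≤ 1) (n : ℕ) {s : ℝ} (hst : s ≤ t) (x : E) :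
    Ap (kN k q (n + 1)) (fun _ => 1) s x ≤
      m * Ap (kN k q (n + 1)) h s x + Q * Ti (kN k q n) (fun _ => 1) s x := by
  have hn := kN_ker hk hq n
  have hmA : Measurable fun p : ℝ × E => Ap k h (s - p.1) p.2 :=
    (Ap_meas hk hh).comp (by fun_prop : Measurable fun p : ℝ × E => (s - p.1, p.2))
  have hm1 : Measurable fun p : ℝ × E => kN k q n p.1 x p.2 * q p.2 * Ap k h (s - p.1) p.2 :=
    ((hn.m2 (by fun_prop) (by fun_prop) (by fun_prop)).mul (hq.comp (by fun_prop))).mul hmA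
  have hm2 : Measurable fun p : ℝ × E => kN k q n p.1 x p.2 * (Iio s).indicator (fun _ => 1) p.1 :=
    (hn.m2 (by fun_prop) (by fun_prop) (by fun_prop)).mul
      ((measurable_const.indicator measurableSet_Iio).comp measurable_fst)
  show Ap (stq q (kN k q n) k) (fun _ => 1) s x ≤ m * Ap (stq q (kN k q n) k) h s x + _
  rw [stq_app hq hn hk measurable_const, stq_app hq hn hk hh, Ti_eq hn measurable_const,
    ← lintegral_const_mul _ hm1, ← lintegral_const_mul _ hm2, ← lintegral_add_left (hm1.const_mul _)]
  refine lintegral_mono_ae ?_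
  -- times outside the range contribute nothing
  refine Filter.Eventually.of_forall fun p => ?_
  show kN k q n p.1 x p.2 * q p.2 * Ap k (fun _ => 1) (s - p.1) p.2 ≤
    m * (kN k q n p.1 x p.2 * q p.2 * Ap k h (s - p.1) p.2) +
      Q * (kN k q n p.1 x p.2 * (Iio s).indicator (fun _ => 1) p.1)
  by_cases hp : p.1 < s
  swap
  · rw [Ap_zero hk (by linarith)]; simp
  by_cases hp0 : 0 < p.1
  swap
  · rw [hn.zero _ (by linarith)]; simp
  by_cases hz : p.2 ∈ B
  · refine le_trans ?_ le_self_add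
    calc _ ≤ kN k q n p.1 x p.2 * q p.2 * (m * Ap k h (s - p.1) p.2) :=
          mul_le_mul_right ((h1 _ _).trans (hB1 _ hz _ (by linarith) (by linarith))) _
      _ = _ := by ring
  · refine le_trans ?_ le_add_self
    rw [indicator_of_mem (show p.1 ∈ Iio s from hp), mul_one, mul_comm Q]
    calc _ ≤ kN k q n p.1 x p.2 * Q * 1 := mul_le_mul' (mul_le_mul_right (hB2 _ hz) _) (h1 _ _)
      _ = _ := by ring

/-- The bound on the mass of the perturbed semigroup (U1). -/
lemma Ap_one_bound (hk : IsKer k) (hq : Measurable q) {B : Set E} {h : E → ENNReal}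
    (hh : Measurable h) {m : ENNReal} {Q : ℝ} (hQ : 0 ≤ Q) {t : ℝ}
    (hB1 : ∀ z ∈ B, ∀ u, 0 < u → u ≤ t → 1 ≤ m * Ap k h u z)
    (hB2 : ∀ z, z ∉ B → q z ≤ ENNReal.ofReal Q)
    (h1 : ∀ u x, Ap k (fun _ => 1) u x ≤ 1) (x : E)
    (hsup : ∀ s, 0 < s → Ap (kT k q) h s x ≤ h x) {s : ℝ} (hs : 0 < s) (hst : s ≤ t) :
    Ap (kT k q) (fun _ => 1) s x ≤ (1 + m * h x) * ENNReal.ofReal (Real.exp (Q * s)) := by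
  rw [Ap_kT hk hq measurable_const]
  refine ENNReal.tsum_le_of_sum_range_le fun N => ?_
  induction N generalizing s with
  | zero => simp
  | succ N ih =>
    rw [Finset.sum_range_succ']
    have hms : ∀ n, Measurable fun s : ℝ => Ap (kN k q n) (fun _ => 1) s x := fun n =>
      (Ap_meas (kN_ker hk hq n) measurable_const).comp (by fun_prop : Measurable fun s : ℝ => (s, x))
    have hA : ∑ n ∈ Finset.range N, Ap (kN k q (n + 1)) (fun _ => 1) s x ≤
        m * h x + ENNReal.ofReal Q * ∫⁻ r in Ioo 0 s, ∑ n ∈ Finset.range N,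
          Ap (kN k q n) (fun _ => 1) r x := by
      refine (Finset.sum_le_sum fun n _ => Ap_one_split hk hq hh hB1 hB2 h1 n hst x).trans ?_
      rw [Finset.sum_add_distrib, ← Finset.mul_sum, ← Finset.mul_sum, lintegral_finsetSum]
      · refine add_le_add (mul_le_mul_right ?_ _) (mul_le_mul_right (le_of_eq ?_) _)
        · refine le_trans ?_ (hsup s hs)
          rw [Ap_kT hk hq hh]
          refine le_trans ?_ (ENNReal.sum_le_tsum (Finset.range (N + 1)))
          rw [Finset.sum_range_succ']
          exact le_self_add
        · exact Finset.sum_congr rfl fun n _ => Ti_Ioo (kN_ker hk hq n) _ _ _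
      · exact fun n _ => hms n
    have hI : ENNReal.ofReal Q * ∫⁻ r in Ioo 0 s, ∑ n ∈ Finset.range N,
          Ap (kN k q n) (fun _ => 1) r x ≤ (1 + m * h x) * ENNReal.ofReal (Real.exp (Q * s) - 1) := by
      rw [← lint_exp_Ioo hQ hs, ← lintegral_const_mul _ (Finset.measurable_fun_sum _ fun n _ => hms n),
        ← lintegral_const_mul _ (by fun_prop)]
      refine setLIntegral_mono (by fun_prop) fun r hr => ?_
      rw [ENNReal.ofReal_mul hQ]
      calc _ ≤ ENNReal.ofReal Q * ((1 + m * h x) * ENNReal.ofReal (Real.exp (Q * r))) :=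
            mul_le_mul_right (ih hr.1 (hr.2.le.trans hst)) _
        _ = _ := by ring
    have h0 : Ap (kN k q 0) (fun _ => 1) s x ≤ 1 := h1 s x
    calc _ ≤ (m * h x + (1 + m * h x) * ENNReal.ofReal (Real.exp (Q * s) - 1)) + 1 :=
          add_le_add (hA.trans (add_le_add le_rfl hI)) h0
      _ = (1 + m * h x) * (1 + ENNReal.ofReal (Real.exp (Q * s) - 1)) := by ring
      _ = _ := by
          have : 1 ≤ Real.exp (Q * s) := Real.one_le_exp (by positivity)
          rw [← ENNReal.ofReal_one, ← ENNReal.ofReal_add zero_le_one (by linarith)]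
          congr 2; ring

/-- Pointwise finiteness. -/
lemma kT_bound (hk : IsKer k) (hq : Measurable q)
    (hck : ∀ t s, 0 < t → 0 < s → ∀ x y, ∫⁻ z, k t x z * k s z y = k (t + s) x y)
    {t τ : ℝ} {C D : ENNReal} (hτ : ENNReal.ofReal τ * C ≤ 1 / 2) (y : E)
    (hy : ∀ z u, 0 < u → u < t → (q z ≤ C ∧ u < τ) ∨ k u z y ≤ D * Ap k (fun _ => 1) u z) (x : E) :
    kT k q t x y ≤ 2 * (k t x y + D * Ap (kT k q) (fun _ => 1) t x) := by
  have hstep : ∀ n, kN k q (n + 1) t x y ≤ 1 / 2 * kN k q n t x y +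
      D * Ap (kN k q (n + 1)) (fun _ => 1) t x := by
    intro n
    have hn := kN_ker hk hq n
    have hmA : Measurable fun p : ℝ × E => Ap k (fun _ => 1) (t - p.1) p.2 :=
      (Ap_meas hk measurable_const).comp (by fun_prop : Measurable fun p : ℝ × E => (t - p.1, p.2))
    have hm1 : Measurable fun p : ℝ × E =>
        kN k q n p.1 x p.2 * q p.2 * Ap k (fun _ => 1) (t - p.1) p.2 :=
      ((hn.m2 (by fun_prop) (by fun_prop) (by fun_prop)).mul (hq.comp (by fun_prop))).mul hmA
    have hm3 : Measurable fun p : ℝ × E => kN k q n p.1 x p.2 * k (t - p.1) p.2 y :=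
      (hn.m2 (by fun_prop) (by fun_prop) (by fun_prop)).mul
        (hk.m2 (by fun_prop) (by fun_prop) (by fun_prop))
    have hm2 : Measurable fun p : ℝ × E => (Ioo (t - τ) t).indicator (fun _ => (1:ENNReal)) p.1 *
        (kN k q n p.1 x p.2 * k (t - p.1) p.2 y) :=
      ((measurable_const.indicator measurableSet_Ioo).comp measurable_fst).mul hm3
    have h2 : ∫⁻ p : ℝ × E, (Ioo (t - τ) t).indicator (fun _ => (1:ENNReal)) p.1 *
        (kN k q n p.1 x p.2 * k (t - p.1) p.2 y) ≤ ENNReal.ofReal τ * kN k q n t x y := by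
      rw [Measure.volume_eq_prod, lintegral_prod _ hm2.aemeasurable]
      calc _ ≤ ∫⁻ s, (Ioo (t - τ) t).indicator (fun _ => kN k q n t x y) s := by
            refine lintegral_mono fun s => ?_
            by_cases hs : s ∈ Ioo (t - τ) t
            · simp only [indicator_of_mem hs, one_mul]
              by_cases hs0 : 0 < s
              · have := kN_sck hk hq hck n s (t - s) hs0 (by linarith [hs.2]) x y
                rw [add_sub_cancel] at this
                refine le_trans ?_ this
                exact Finset.single_le_sum (f := fun ij : ℕ × ℕ =>
                  ∫⁻ v, kN k q ij.1 s x v * kN k q ij.2 (t - s) v y) (a := (n, 0))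
                  (fun _ _ => bot_le) (by simp)
              · simp [fun z => hn.zero s (not_lt.1 hs0) x z]
            · simp [indicator_of_notMem hs]
        _ = _ := by
            rw [lintegral_indicator measurableSet_Ioo, setLIntegral_const, Real.volume_Ioo, mul_comm]
            congr 2; ring
    calc kN k q (n + 1) t x y = ∫⁻ p : ℝ × E, kN k q n p.1 x p.2 * q p.2 * k (t - p.1) p.2 y := rfl
      _ ≤ ∫⁻ p : ℝ × E, (C * ((Ioo (t - τ) t).indicator (fun _ => (1:ENNReal)) p.1 *
          (kN k q n p.1 x p.2 * k (t - p.1) p.2 y)) +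
          D * (kN k q n p.1 x p.2 * q p.2 * Ap k (fun _ => 1) (t - p.1) p.2)) := by
          refine lintegral_mono fun p => ?_
          by_cases hp : p.1 < t
          swap
          · simp only []
            rw [hk.zero (t - p.1) (by linarith)]; simp
          by_cases hp0 : 0 < p.1
          swap
          · simp only []
            rw [hn.zero _ (by linarith)]; simp
          rcases hy p.2 (t - p.1) (by linarith) (by linarith) with ⟨h1, h2⟩ | h1
          · refine le_trans ?_ le_self_add
            rw [indicator_of_mem (show p.1 ∈ Ioo (t - τ) t from ⟨by linarith, hp⟩), one_mul]
            calc _ ≤ kN k q n p.1 x p.2 * C * k (t - p.1) p.2 y :=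
                  mul_le_mul_left (mul_le_mul_right h1 _) _
              _ = _ := by ring
          · refine le_trans ?_ le_add_self
            calc _ ≤ kN k q n p.1 x p.2 * q p.2 * (D * Ap k (fun _ => 1) (t - p.1) p.2) :=
                  mul_le_mul_right h1 _
              _ = _ := by ring
      _ = C * (∫⁻ p : ℝ × E, (Ioo (t - τ) t).indicator (fun _ => (1:ENNReal)) p.1 *
          (kN k q n p.1 x p.2 * k (t - p.1) p.2 y)) + D * Ap (kN k q (n + 1)) (fun _ => 1) t x := by
          rw [lintegral_add_left (hm2.const_mul _), lintegral_const_mul _ hm2, lintegral_const_mul _ hm1]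
          rw [show kN k q (n + 1) = stq q (kN k q n) k from rfl, stq_app hq hn hk measurable_const]
      _ ≤ C * (ENNReal.ofReal τ * kN k q n t x y) + D * Ap (kN k q (n + 1)) (fun _ => 1) t x :=
          add_le_add (mul_le_mul_right h2 _) le_rfl
      _ ≤ _ := by
          refine add_le_add ?_ le_rfl
          rw [← mul_assoc, mul_comm C]
          exact mul_le_mul_left hτ _
  refine ENNReal.tsum_le_of_sum_range_le fun N => ?_
  induction N with
  | zero => simp
  | succ N ih =>
    rw [Finset.sum_range_succ']
    have h1 : ∑ n ∈ Finset.range N, kN k q (n + 1) t x y ≤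
        1 / 2 * ∑ n ∈ Finset.range N, kN k q n t x y + D * Ap (kT k q) (fun _ => 1) t x := by
      refine (Finset.sum_le_sum fun n _ => hstep n).trans ?_
      rw [Finset.sum_add_distrib, ← Finset.mul_sum, ← Finset.mul_sum]
      refine add_le_add le_rfl (mul_le_mul_right ?_ _)
      rw [Ap_kT hk hq measurable_const]
      refine le_trans ?_ (ENNReal.sum_le_tsum (Finset.range (N + 1)))
      rw [Finset.sum_range_succ']
      exact le_self_add
    have h2 : 1 / 2 * ∑ n ∈ Finset.range N, kN k q n t x y ≤
        k t x y + D * Ap (kT k q) (fun _ => 1) t x := by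
      refine (mul_le_mul_right ih _).trans (le_of_eq ?_)
      rw [← mul_assoc, one_div, ENNReal.inv_mul_cancel (by simp) (by simp), one_mul]
    calc _ ≤ (k t x y + D * Ap (kT k q) (fun _ => 1) t x) + D * Ap (kT k q) (fun _ => 1) t x + k t x y :=
          add_le_add (h1.trans (add_le_add h2 le_rfl)) le_rfl
      _ = _ := by ring

end Pert

lemma Jf_inv (ν : ℝ) {ρ : ℝ} (hρ : 0 < ρ) :
    Jf ν ρ = ENNReal.ofReal ((ρ ^ 2 / 4) ^ (-ν)) *
      ∫⁻ v in Ioi (0:ℝ), ENNReal.ofReal (v ^ (ν - 1) * exp (-v - (ρ ^ 2 / 4) / v)) := by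
  have hY : 0 < ρ ^ 2 / 4 := by positivity
  set Y := ρ ^ 2 / 4 with hYd
  have hinj : InjOn (fun v : ℝ => Y / v) (Ioi 0) := fun p hp q hq h => by
    have hp : 0 < p := hp
    have hq : 0 < q := hq
    have h : Y / p = Y / q := h
    rw [div_eq_div_iff hp.ne' hq.ne'] at h
    exact (mul_left_cancel₀ hY.ne' h).symm
  have himg : (fun v : ℝ => Y / v) '' Ioi 0 = Ioi 0 := by
    ext u
    simp only [mem_image, mem_Ioi]
    refine ⟨?_, fun hu => ⟨Y / u, by positivity, by field_simp⟩⟩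
    rintro ⟨r, hr, rfl⟩; positivity
  have hder : ∀ r ∈ Ioi (0:ℝ), HasDerivWithinAt (fun v : ℝ => Y / v)
      (Y * (-(r ^ 2)⁻¹)) (Ioi 0) r := fun r hr => by
    have := ((hasDerivAt_inv (ne_of_gt hr)).const_mul Y).hasDerivWithinAt (s := Ioi 0)
    simpa [div_eq_mul_inv] using this
  have := lintegral_image_eq_lintegral_abs_deriv_mul measurableSet_Ioi hder hinj
    (fun u => ENNReal.ofReal (u ^ (-ν - 1) * exp (-u - ρ ^ 2 / (4 * u))))
  rw [himg] at this
  unfold Jf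
  rw [this, ← lintegral_const_mul' _ _ ENNReal.ofReal_ne_top]
  refine setLIntegral_congr_fun measurableSet_Ioi fun r (hr : 0 < r) => ?_
  rw [← ENNReal.ofReal_mul (by positivity), ← ENNReal.ofReal_mul (by positivity)]
  congr 1
  have e0 : -(Y / r) - ρ ^ 2 / (4 * (Y / r)) = -r - Y / r := by
    rw [show ρ ^ 2 = 4 * Y by rw [hYd]; ring]; field_simp; ring
  rw [e0, ← mul_assoc, ← mul_assoc]
  congr 1
  rw [abs_of_neg (by have : 0 < (r ^ 2)⁻¹ := by positivity
                     nlinarith), div_rpow hY.le hr.le]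
  have e1 : Y ^ (-ν) = Y * Y ^ (-ν - 1) := by
    nth_rewrite 2 [← rpow_one Y]; rw [← rpow_add hY]; congr 1; ring
  have e2 : r ^ (ν - 1) = (r ^ 2)⁻¹ * (r ^ (-ν - 1))⁻¹ := by
    rw [← rpow_neg hr.le, ← rpow_natCast r 2, ← rpow_neg hr.le, ← rpow_add hr]; congr 1; push_cast; ring
  rw [e1, e2]
  field_simp

lemma Jf_le {ν ρ : ℝ} (hν : 0 < ν) (hρ : 0 < ρ) :
    Jf ν ρ ≤ ENNReal.ofReal (Gamma ν * (ρ ^ 2 / 4) ^ (-ν)) := by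
  have hG := Real.Gamma_pos_of_pos hν
  rw [Jf_inv ν hρ, mul_comm (Gamma ν), ENNReal.ofReal_mul (by positivity)]
  refine mul_le_mul_right ?_ _
  have h := lint_gamma ν 1 hν one_pos
  rw [one_rpow, mul_one] at h
  rw [← h]
  refine setLIntegral_mono (by fun_prop) fun v (hv : 0 < v) => ENNReal.ofReal_le_ofReal ?_
  refine mul_le_mul_of_nonneg_left (exp_le_exp.2 ?_) (by positivity)
  have : 0 ≤ ρ ^ 2 / 4 / v := by positivity
  linarith

lemma Jf_ne_top {ν ρ : ℝ} (hν : 0 < ν) (hρ : 0 < ρ) : Jf ν ρ ≠ ⊤ :=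
  ne_top_of_le_ne_top ENNReal.ofReal_ne_top (Jf_le hν hρ)

lemma Jf_ge {ν κ ρ : ℝ} (hκ : 0 < κ) (hκ1 : κ ≤ 1) (hν : κ < ν) (hρ : 0 < ρ) :
    ENNReal.ofReal (Gamma ν * (ρ ^ 2 / 4) ^ (-ν)) ≤
      Jf ν ρ + ENNReal.ofReal (Gamma (ν - κ) * (ρ ^ 2 / 4) ^ (κ - ν)) := by
  have hY : 0 < ρ ^ 2 / 4 := by positivity
  rw [Jf_inv ν hρ]
  set Y := ρ ^ 2 / 4 with hYd
  have hG := Real.Gamma_pos_of_pos (show 0 < ν by linarith)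
  have hG2 := Real.Gamma_pos_of_pos (show 0 < ν - κ by linarith)
  have h := lint_gamma ν 1 (by linarith) one_pos
  have h2 := lint_gamma (ν - κ) 1 (by linarith) one_pos
  rw [one_rpow, mul_one] at h h2
  rw [show κ - ν = -ν + κ by ring, rpow_add hY, mul_comm (Gamma ν), ENNReal.ofReal_mul (by positivity),
    show Gamma (ν - κ) * (Y ^ (-ν) * Y ^ κ) = Y ^ (-ν) * (Y ^ κ * Gamma (ν - κ)) by ring,
    ENNReal.ofReal_mul (by positivity), ENNReal.ofReal_mul (by positivity), ← mul_add, ← h, ← h2]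
  refine mul_le_mul_right ?_ _
  rw [← lintegral_const_mul' _ _ ENNReal.ofReal_ne_top, ← lintegral_add_left (by fun_prop)]
  refine setLIntegral_mono (by fun_prop) fun v (hv : 0 < v) => ?_
  rw [← ENNReal.ofReal_mul (by positivity), ← ENNReal.ofReal_add (by positivity) (by positivity)]
  refine ENNReal.ofReal_le_ofReal ?_
  have e1 : exp (-v - Y / v) = exp (-v) * exp (-(Y / v)) := by rw [← exp_add]; ring_nf
  have e2 : v ^ (ν - κ - 1) = v ^ (ν - 1) * (v ^ κ)⁻¹ := by
    rw [← rpow_neg hv.le, ← rpow_add hv]; congr 1; ring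
  have e3 : 1 ≤ exp (-(Y / v)) + (Y / v) ^ κ := by
    have hx : 0 < Y / v := by positivity
    rcases le_total (Y / v) 1 with h1 | h1
    · have := add_one_le_exp (-(Y / v))
      have h3 : (Y / v) ^ (1:ℝ) ≤ (Y / v) ^ κ := rpow_le_rpow_of_exponent_ge hx h1 hκ1
      rw [rpow_one] at h3
      linarith
    · have := one_le_rpow h1 hκ.le
      have := exp_pos (-(Y / v))
      linarith
  rw [div_rpow hY.le hv.le] at e3
  rw [e1, e2, neg_mul, one_mul]
  calc _ = v ^ (ν - 1) * exp (-v) * 1 := by ring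
    _ ≤ v ^ (ν - 1) * exp (-v) * (exp (-(Y / v)) + Y ^ κ / v ^ κ) := by gcongr
    _ = _ := by ring

lemma Jf_anti (ν : ℝ) {ρ ρ' : ℝ} (h0 : 0 ≤ ρ) (h : ρ ≤ ρ') : Jf ν ρ' ≤ Jf ν ρ := by
  unfold Jf
  refine setLIntegral_mono (by fun_prop) fun u (hu : 0 < u) => ENNReal.ofReal_le_ofReal ?_
  refine mul_le_mul_of_nonneg_left (exp_le_exp.2 ?_) (by positivity)
  have : ρ ^ 2 / (4 * u) ≤ ρ' ^ 2 / (4 * u) := by gcongr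
  linarith

lemma lint_pos {f : ℝ → ℝ} (hf : Measurable f) (hp : ∀ u, 0 < u → 0 < f u) :
    0 < ∫⁻ u in Ioi (0:ℝ), ENNReal.ofReal (f u) := by
  rw [setLIntegral_pos_iff (by fun_prop)]
  have : Ioi (0:ℝ) ⊆ (Function.support fun u => ENNReal.ofReal (f u)) ∩ Ioi 0 := fun u hu =>
    ⟨by simpa [Function.mem_support] using hp u hu, hu⟩
  exact lt_of_lt_of_le (by simp) (measure_mono this)

lemma Jf_pos (ν ρ : ℝ) : 0 < Jf ν ρ := by
  unfold Jf
  exact lint_pos (by fun_prop) fun u hu => by positivity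

lemma Jf_ge_L (ν : ℝ) {L : ℝ} (hν : 0 < ν) : ∃ c : ℝ, 0 < c ∧ ∀ ρ, 0 < ρ → ρ ≤ L →
    ENNReal.ofReal (c * ρ ^ (-(2 * ν))) ≤ Jf ν ρ := by
  set I := ∫⁻ v in Ioi (0:ℝ), ENNReal.ofReal (v ^ (ν - 1) * exp (-v - (L ^ 2 / 4) / v)) with hI
  have hI0 : 0 < I := lint_pos (by fun_prop) fun u hu => by positivity
  have hIt : I ≠ ⊤ := by
    have h := lint_gamma ν 1 hν one_pos
    refine ne_top_of_le_ne_top (ENNReal.ofReal_ne_top (r := Gamma ν * 1 ^ (-ν))) ?_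
    rw [← h]
    refine setLIntegral_mono (by fun_prop) fun v (hv : 0 < v) => ENNReal.ofReal_le_ofReal ?_
    refine mul_le_mul_of_nonneg_left (exp_le_exp.2 ?_) (by positivity)
    have : 0 ≤ L ^ 2 / 4 / v := by positivity
    linarith
  refine ⟨I.toReal * (1 / 4) ^ (-ν), mul_pos (ENNReal.toReal_pos hI0.ne' hIt) (by positivity),
    fun ρ hρ hL => ?_⟩
  rw [Jf_inv ν hρ]
  have e : (ρ ^ 2 / 4) ^ (-ν) = (1 / 4) ^ (-ν) * ρ ^ (-(2 * ν)) := by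
    rw [show ρ ^ 2 / 4 = (1 / 4) * ρ ^ 2 by ring, mul_rpow (by norm_num) (by positivity),
      ← rpow_natCast ρ 2, ← rpow_mul hρ.le]
    congr 2; push_cast; ring
  rw [e, mul_assoc, ENNReal.ofReal_mul ENNReal.toReal_nonneg, ENNReal.ofReal_toReal hIt, mul_comm]
  refine mul_le_mul_right ?_ _
  rw [hI]
  refine setLIntegral_mono (by fun_prop) fun v (hv : 0 < v) => ENNReal.ofReal_le_ofReal ?_
  refine mul_le_mul_of_nonneg_left (exp_le_exp.2 ?_) (by positivity)
  have : ρ ^ 2 / 4 / v ≤ L ^ 2 / 4 / v := by gcongr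
  linarith

lemma Jf_le_add_one {ν ν' : ℝ} (h0 : 0 < ν') (h : ν' ≤ ν) (ρ : ℝ) : Jf ν' ρ ≤ Jf ν ρ + 1 := by
  have h1 := lint_gamma 1 1 one_pos one_pos
  simp only [sub_self, rpow_zero, one_mul, Gamma_one, one_rpow, mul_one, neg_mul,
    ENNReal.ofReal_one] at h1
  rw [← h1]
  unfold Jf
  rw [← lintegral_add_left (by fun_prop)]
  refine setLIntegral_mono (by fun_prop) fun u (hu : 0 < u) => ?_
  rw [← ENNReal.ofReal_add (by positivity) (by positivity)]
  refine ENNReal.ofReal_le_ofReal ?_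
  rcases le_total u 1 with h1 | h1
  · have : u ^ (-ν' - 1) ≤ u ^ (-ν - 1) := rpow_le_rpow_of_exponent_ge hu h1 (by linarith)
    have h2 := exp_pos (-u - ρ ^ 2 / (4 * u))
    have h3 := exp_pos (-u)
    nlinarith
  · have : u ^ (-ν' - 1) ≤ 1 := rpow_le_one_of_one_le_of_nonpos h1 (by linarith)
    have h2 := exp_pos (-u - ρ ^ 2 / (4 * u))
    have h3 : exp (-u - ρ ^ 2 / (4 * u)) ≤ exp (-u) := exp_le_exp.2 (by
      have : 0 ≤ ρ ^ 2 / (4 * u) := by positivity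
      linarith)
    have h4 : 0 < u ^ (-ν - 1) := by positivity
    nlinarith [mul_pos h4 h2]

lemma Jf_shift {a ρ0 N : ℝ} (ha : 0 < a) (ha1 : a < 1) (hρ0 : 0 < ρ0) (hN : 0 ≤ N) : ∃ C : ℝ, 0 < C ∧
    ∀ ν ρ, ν ≤ N → ρ0 ≤ ρ → Jf (ν + a) ρ ≤ ENNReal.ofReal C * Jf ν ρ := by
  refine ⟨1 + 2 ^ (N + 1) * exp 1 * (8 / ρ0 ^ 2), by positivity, fun ν ρ hν hρ => ?_⟩
  set C1 := 2 ^ (N + 1) * exp 1 * (8 / ρ0 ^ 2) with hC1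
  have hC1p : 0 < C1 := by positivity
  set f : ℝ → ENNReal := fun u => ENNReal.ofReal (u ^ (-ν - 1) * exp (-u - ρ ^ 2 / (4 * u))) with hf
  have hfm : Measurable f := by rw [hf]; fun_prop
  have hsc := lint_scale (c := 2) two_pos 0 hfm
  rw [mul_zero] at hsc
  have hJ : Jf ν ρ = ∫⁻ u in Ioi (0:ℝ), f u := rfl
  have hmain : Jf (ν + a) ρ ≤ ∫⁻ u in Ioi (0:ℝ), (f u + ENNReal.ofReal C1 * f (2 * u)) := by
    unfold Jf
    refine setLIntegral_mono (by fun_prop) fun u (hu : 0 < u) => ?_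
    rw [hf]
    simp only
    rw [← ENNReal.ofReal_mul hC1p.le, ← ENNReal.ofReal_add (by positivity) (by positivity)]
    refine ENNReal.ofReal_le_ofReal ?_
    have e1 : u ^ (-(ν + a) - 1) = u ^ (-ν - 1) * u ^ (-a) := by
      rw [← rpow_add hu]; congr 1; ring
    rcases le_total u 1 with h1 | h1
    · have h2 : u ^ (-a) ≤ u⁻¹ := by
        rw [← rpow_neg_one]; exact rpow_le_rpow_of_exponent_ge hu h1 (by linarith)
      have hR : 0 < ρ := by linarith
      have h3 : u⁻¹ * exp (-(ρ ^ 2 / (8 * u))) ≤ 8 / ρ0 ^ 2 := by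
        have h4 : ρ ^ 2 / (8 * u) ≤ exp (ρ ^ 2 / (8 * u)) := by
          linarith [add_one_le_exp (ρ ^ 2 / (8 * u))]
        rw [exp_neg, ← div_eq_mul_inv, div_le_iff₀ (exp_pos _)]
        have h5 : u⁻¹ = 8 / ρ ^ 2 * (ρ ^ 2 / (8 * u)) := by field_simp
        rw [h5]
        have h6 : 8 / ρ ^ 2 ≤ 8 / ρ0 ^ 2 := by gcongr
        have : 0 ≤ ρ ^ 2 / (8 * u) := by positivity
        exact mul_le_mul h6 h4 this (by positivity)
      have e2 : exp (-u - ρ ^ 2 / (4 * u)) =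
          exp (-(ρ ^ 2 / (8 * u))) * exp u * exp (-(2 * u) - ρ ^ 2 / (4 * (2 * u))) := by
        rw [← exp_add, ← exp_add]; congr 1; field_simp; ring
      have e3 : (2 * u) ^ (-ν - 1) = 2 ^ (-ν - 1) * u ^ (-ν - 1) := mul_rpow two_pos.le hu.le
      have e4 : (1:ℝ) ≤ 2 ^ (N + 1) * 2 ^ (-ν - 1) := by
        rw [← rpow_add two_pos]; exact one_le_rpow one_le_two (by linarith)
      have e5 : exp u ≤ exp 1 := exp_le_exp.2 h1
      have hnn : 0 ≤ u ^ (-ν - 1) * exp (-u - ρ ^ 2 / (4 * u)) := by positivity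
      refine le_trans ?_ (le_add_of_nonneg_left hnn)
      rw [e1, e2, e3, hC1]
      set X := exp (-(2 * u) - ρ ^ 2 / (4 * (2 * u)))
      calc _ = u ^ (-ν - 1) * X * (1 * exp u * (u ^ (-a) * exp (-(ρ ^ 2 / (8 * u))))) := by ring
        _ ≤ u ^ (-ν - 1) * X * ((2 ^ (N + 1) * 2 ^ (-ν - 1)) * exp 1 * (8 / ρ0 ^ 2)) := by
            have : u ^ (-a) * exp (-(ρ ^ 2 / (8 * u))) ≤ 8 / ρ0 ^ 2 :=
              le_trans (mul_le_mul_of_nonneg_right h2 (exp_pos _).le) h3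
            gcongr
        _ = _ := by ring
    · have h2 : u ^ (-a) ≤ 1 := rpow_le_one_of_one_le_of_nonpos h1 (by linarith)
      rw [e1]
      have hnn : 0 ≤ C1 * ((2 * u) ^ (-ν - 1) * exp (-(2 * u) - ρ ^ 2 / (4 * (2 * u)))) := by positivity
      refine le_trans ?_ (le_add_of_nonneg_right hnn)
      have h3 : 0 < u ^ (-ν - 1) := by positivity
      gcongr
      exact mul_le_of_le_one_right h3.le h2
  refine hmain.trans ?_
  rw [lintegral_add_left hfm, lintegral_const_mul' _ _ ENNReal.ofReal_ne_top, hsc, ← hJ,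
    ENNReal.ofReal_add zero_le_one hC1p.le, add_mul, ENNReal.ofReal_one, one_mul]
  refine add_le_add le_rfl (mul_le_mul_right ?_ _)
  refine mul_le_of_le_one_left bot_le ?_
  rw [← ENNReal.ofReal_one]; exact ENNReal.ofReal_le_ofReal (by norm_num)

lemma IsSub.exists_Icc {a : ℝ} {η : Measure ℝ} (h : IsSub a η) :
    ∃ M : ℝ, 1 ≤ M ∧ 0 < η (Icc M⁻¹ M) := by
  have := h.prob
  have hne : η (⋃ n : ℕ, Icc ((n:ℝ) + 1)⁻¹ ((n:ℝ) + 1)) ≠ 0 := by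
    intro h0
    have : η univ = 0 := by
      refine measure_mono_null (t := Iic 0 ∪ ⋃ n : ℕ, Icc ((n:ℝ) + 1)⁻¹ ((n:ℝ) + 1)) ?_
        (measure_union_null h.null h0)
      intro s _
      rcases le_or_gt s 0 with hs | hs
      · exact Or.inl hs
      · right
        obtain ⟨n, hn⟩ := exists_nat_ge (max s s⁻¹)
        refine mem_iUnion.2 ⟨n, ?_, ?_⟩
        · rw [inv_le_comm₀ (by positivity) hs]
          linarith [le_max_right s s⁻¹]
        · linarith [le_max_left s s⁻¹]
    simp at this
  obtain ⟨n, hn⟩ := exists_measure_pos_of_not_measure_iUnion_null hne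
  exact ⟨n + 1, by linarith [(Nat.cast_nonneg n : (0:ℝ) ≤ n)], hn⟩

/-- Near-diagonal lower bound. -/
lemma pe_ge {d : ℕ} {a : ℝ} {η : Measure ℝ} (h : IsSub a η) (ha : 0 < a) {T K : ℝ} (hT : 0 < T)
    (hK : 0 < K) : ∃ c : ℝ, 0 < c ∧ ∀ t w : ℝ, 0 < t → t ≤ T → t / 2 ≤ w → w ≤ 3 * t →
      ∀ x y : Ed d, ‖y - x‖ ≤ K * t ^ (1 / (2 * a)) →
        ENNReal.ofReal (c * t ^ (-(d:ℝ) / (2 * a))) ≤ pe a η w x y := by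
  have := h.prob
  obtain ⟨M, hM, hη⟩ := h.exists_Icc
  have hM0 : 0 < M := by linarith
  set m := (1 / 2 : ℝ) ^ (1 / a) * M⁻¹ with hm
  set M' := (3:ℝ) ^ (1 / a) * M with hM'
  have hm0 : 0 < m := by positivity
  have hM'0 : 0 < M' := by positivity
  have hηt : η (Icc M⁻¹ M) ≠ ⊤ := measure_ne_top _ _
  set c1 := (4 * π * M') ^ (-(d:ℝ) / 2) * exp (-(M' * T ^ (1 / a)) - K ^ 2 / (4 * m)) with hc1
  have hc1p : 0 < c1 := by positivity
  refine ⟨(η (Icc M⁻¹ M)).toReal * c1, mul_pos (ENNReal.toReal_pos hη.ne' hηt) hc1p,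
    fun t w ht htT hw1 hw2 x y hxy => ?_⟩
  set S := t ^ (1 / a) with hS
  have hS0 : 0 < S := by positivity
  have hST : S ≤ T ^ (1 / a) := rpow_le_rpow ht.le htT (by positivity)
  have hw0 : 0 < w := by linarith
  have hwl : (1 / 2 : ℝ) ^ (1 / a) * S ≤ w ^ (1 / a) := by
    rw [hS, ← mul_rpow (by norm_num) ht.le]; exact rpow_le_rpow (by positivity) (by linarith) (by positivity)
  have hwu : w ^ (1 / a) ≤ 3 ^ (1 / a) * S := by
    rw [hS, ← mul_rpow (by norm_num) ht.le]; exact rpow_le_rpow hw0.le (by linarith) (by positivity)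
  have hr2 : ‖y - x‖ ^ 2 ≤ K ^ 2 * S := by
    have : (t ^ (1 / (2 * a))) ^ 2 = S := by
      rw [← rpow_natCast, ← rpow_mul ht.le, hS]; congr 1; push_cast; field_simp
    rw [← this, ← mul_pow]
    exact pow_le_pow_left₀ (norm_nonneg _) hxy 2
  have hpt : ∀ s ∈ Icc M⁻¹ M, ENNReal.ofReal (c1 * t ^ (-(d:ℝ) / (2 * a))) ≤
      ENNReal.ofReal (Gk d (w ^ (1 / a) * s) ‖y - x‖) := by
    intro s hs
    have hs0 : 0 < s := lt_of_lt_of_le (by positivity) hs.1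
    refine ENNReal.ofReal_le_ofReal ?_
    have hσ0 : 0 < w ^ (1 / a) * s := by positivity
    have hσl : m * S ≤ w ^ (1 / a) * s := by
      calc m * S = ((1 / 2 : ℝ) ^ (1 / a) * S) * M⁻¹ := by rw [hm]; ring
        _ ≤ _ := mul_le_mul hwl hs.1 (by positivity) (by positivity)
    have hσu : w ^ (1 / a) * s ≤ M' * S := by
      calc w ^ (1 / a) * s ≤ (3 ^ (1 / a) * S) * M := mul_le_mul hwu hs.2 hs0.le (by positivity)
        _ = _ := by rw [hM']; ring
    set σ := w ^ (1 / a) * s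
    have e1 : t ^ (-(d:ℝ) / (2 * a)) = S ^ (-(d:ℝ) / 2) := by
      rw [hS, ← rpow_mul ht.le]; congr 1; field_simp
    rw [e1, hc1, Gk]
    calc _ = (4 * π * (M' * S)) ^ (-(d:ℝ) / 2) * exp (-(M' * T ^ (1 / a)) - K ^ 2 / (4 * m)) := by
          rw [show 4 * π * (M' * S) = 4 * π * M' * S by ring, mul_rpow (x := 4 * π * M') (by positivity) hS0.le]; ring
      _ ≤ _ := by
          refine mul_le_mul ?_ (exp_le_exp.2 ?_) (exp_pos _).le (by positivity)
          · refine rpow_le_rpow_of_nonpos (by positivity) (by gcongr) ?_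
            have : (0:ℝ) ≤ d := Nat.cast_nonneg d
            linarith
          · have h1 : σ ≤ M' * T ^ (1 / a) := hσu.trans (by gcongr)
            have h2 : ‖y - x‖ ^ 2 / (4 * σ) ≤ K ^ 2 / (4 * m) := by
              rw [div_le_div_iff₀ (by positivity) (by positivity)]
              calc ‖y - x‖ ^ 2 * (4 * m) ≤ K ^ 2 * S * (4 * m) := by gcongr
                _ = K ^ 2 * (4 * (m * S)) := by ring
                _ ≤ _ := by gcongr
            linarith
  calc ENNReal.ofReal ((η (Icc M⁻¹ M)).toReal * c1 * t ^ (-(d:ℝ) / (2 * a)))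
      = ∫⁻ s in Icc M⁻¹ M, ENNReal.ofReal (c1 * t ^ (-(d:ℝ) / (2 * a))) ∂η := by
        rw [setLIntegral_const, mul_assoc, ENNReal.ofReal_mul ENNReal.toReal_nonneg,
          ENNReal.ofReal_toReal hηt, mul_comm]
    _ ≤ ∫⁻ s in Icc M⁻¹ M, ENNReal.ofReal (Gk d (w ^ (1 / a) * s) ‖y - x‖) ∂η :=
        setLIntegral_mono' measurableSet_Icc hpt
    _ ≤ _ := setLIntegral_le_lintegral _ _

lemma rpow_half_exp (d : ℕ) {x : ℝ} (hx : 0 ≤ x) :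
    x ^ ((d:ℝ) / 2) * exp (-x) ≤ 1 + d.factorial := by
  have hd : (0:ℝ) ≤ d := Nat.cast_nonneg d
  have h1 : x ^ ((d:ℝ) / 2) ≤ 1 + x ^ d := by
    rcases le_total x 1 with h | h
    · have := rpow_le_one hx h (by positivity : 0 ≤ (d:ℝ) / 2)
      have : 0 ≤ x ^ d := by positivity
      linarith
    · have := rpow_le_rpow_of_exponent_le h (by linarith : (d:ℝ) / 2 ≤ d)
      rw [rpow_natCast] at this; linarith
  have h2 := pow_div_factorial_le_exp x hx d
  rw [div_le_iff₀ (by positivity)] at h2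
  have h3 : 1 ≤ exp x := one_le_exp hx
  rw [exp_neg, ← div_eq_mul_inv, div_le_iff₀ (exp_pos _)]
  nlinarith

/-- Off-diagonal uniform bound. -/
lemma pe_le_off {d : ℕ} {a : ℝ} {η : Measure ℝ} (h : IsSub a η) {t : ℝ} (ht : 0 < t)
    (x y : Ed d) (hxy : x ≠ y) :
    pe a η t x y ≤ ENNReal.ofReal ((1 + d.factorial) * ‖y - x‖ ^ (-(d:ℝ))) := by
  have := h.prob
  have hr : 0 < ‖y - x‖ := norm_pos_iff.2 (sub_ne_zero.2 hxy.symm)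
  set r := ‖y - x‖ with hrd
  have hpt : ∀ᵐ s ∂η, ENNReal.ofReal (Gk d (t ^ (1 / a) * s) r) ≤
      ENNReal.ofReal ((1 + d.factorial) * r ^ (-(d:ℝ))) := by
    filter_upwards [h.ae_pos] with s hs
    refine ENNReal.ofReal_le_ofReal ?_
    have hσ : 0 < t ^ (1 / a) * s := by positivity
    set σ := t ^ (1 / a) * s
    have hd : (0:ℝ) ≤ d := Nat.cast_nonneg d
    set X := r ^ 2 / (4 * σ) with hX
    have hX0 : 0 < X := by positivity
    have e1 : (4 * π * σ) ^ (-(d:ℝ) / 2) = π ^ (-(d:ℝ) / 2) * r ^ (-(d:ℝ)) * X ^ ((d:ℝ) / 2) := by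
      have : 4 * π * σ = π * r ^ 2 * X⁻¹ := by rw [hX]; field_simp
      rw [this, mul_rpow (by positivity) (by positivity), mul_rpow (by positivity) (by positivity),
        ← rpow_natCast r 2, ← rpow_mul hr.le, inv_rpow hX0.le, ← rpow_neg hX0.le]
      congr 3
      · push_cast; ring
      · ring
    have hπ : π ^ (-(d:ℝ) / 2) ≤ 1 :=
      rpow_le_one_of_one_le_of_nonpos (by linarith [pi_gt_three]) (by linarith)
    rw [Gk, e1]
    have h2 := rpow_half_exp d hX0.le
    have h3 : exp (-σ - X) ≤ exp (-X) := exp_le_exp.2 (by linarith)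
    calc _ ≤ 1 * r ^ (-(d:ℝ)) * X ^ ((d:ℝ) / 2) * exp (-X) := by gcongr
      _ = r ^ (-(d:ℝ)) * (X ^ ((d:ℝ) / 2) * exp (-X)) := by ring
      _ ≤ r ^ (-(d:ℝ)) * (1 + d.factorial) := by gcongr
      _ = _ := by ring
  calc pe a η t x y ≤ ∫⁻ s, ENNReal.ofReal ((1 + d.factorial) * r ^ (-(d:ℝ))) ∂η := lintegral_mono_ae hpt
    _ = _ := by simp

/-- Doubling argument: the part near zero is controlled by the rest. -/
lemma head_tail {F : ℝ → ENNReal} (hF : Measurable F) {b : ℝ} (hb : 0 < b)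
    (h2 : ∀ s, 0 < s → s ≤ b → F s ≤ F (2 * s)) (hfin : ∫⁻ s in Ioi (0:ℝ), F s ≠ ⊤) :
    ∫⁻ s in Ioi (0:ℝ), F s ≤ 2 * ∫⁻ s in Ioi b, F s := by
  have hU : Ioc 0 b ∪ Ioi b = Ioi (0:ℝ) := Ioc_union_Ioi_eq_Ioi hb.le
  have hsplit : ∫⁻ s in Ioi (0:ℝ), F s = (∫⁻ s in Ioc 0 b, F s) + ∫⁻ s in Ioi b, F s := by
    rw [← hU, lintegral_union measurableSet_Ioi]
    exact Set.disjoint_left.2 fun s hs hs' => absurd hs.2 (not_le.2 hs')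
  have hsc := lint_scale (c := 2) two_pos 0 hF
  rw [mul_zero] at hsc
  have hA : ∫⁻ s in Ioc 0 b, F s ≤ ENNReal.ofReal 2⁻¹ * ∫⁻ s in Ioi (0:ℝ), F s := by
    rw [← hsc]
    calc _ ≤ ∫⁻ s in Ioc 0 b, F (2 * s) :=
          setLIntegral_mono' measurableSet_Ioc fun s hs => h2 s hs.1 hs.2
      _ ≤ _ := lintegral_mono_set Ioc_subset_Ioi_self
  set I := ∫⁻ s in Ioi (0:ℝ), F s
  set B := ∫⁻ s in Ioi b, F s
  have hh : ENNReal.ofReal 2⁻¹ = 2⁻¹ := by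
    rw [ENNReal.ofReal_inv_of_pos two_pos]; simp
  rw [hh] at hA
  have h3 : 2⁻¹ * I + 2⁻¹ * I ≤ B + 2⁻¹ * I := by
    rw [← add_mul, ENNReal.inv_two_add_inv_two, one_mul]
    calc I = _ := hsplit
      _ ≤ _ := by rw [add_comm]; exact add_le_add le_rfl hA
  have h4 : 2⁻¹ * I ≤ B :=
    (ENNReal.add_le_add_iff_right (ENNReal.mul_ne_top (by simp) hfin)).1 h3
  calc I = 2 * (2⁻¹ * I) := by rw [← mul_assoc, ENNReal.mul_inv_cancel (by simp) (by simp), one_mul]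
    _ ≤ _ := mul_le_mul_right h4 _

lemma Gk_double (d : ℕ) {b L s ρ : ℝ} (hL0 : 0 ≤ L) (hL : (d:ℝ) / 2 + 1 + b ≤ L) (hρ : 0 < ρ) (hs : 0 < s)
    (hs2 : s ≤ 1 / (8 * (L + 1)) * min ρ (ρ ^ 2)) :
    Gk d s ρ * s ^ (-1 - b) ≤ Gk d (2 * s) ρ * (2 * s) ^ (-1 - b) := by
  have hθ : 0 < 1 / (8 * (L + 1)) := by positivity
  have h1 : s ≤ 1 / (8 * (L + 1)) * ρ := hs2.trans (by gcongr; exact min_le_left _ _)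
  have h2 : s ≤ 1 / (8 * (L + 1)) * ρ ^ 2 := hs2.trans (by gcongr; exact min_le_right _ _)
  -- the exponent gain
  have hE : L ≤ ρ ^ 2 / (8 * s) - s := by
    rw [le_sub_iff_add_le, le_div_iff₀ (by positivity)]
    rw [div_mul_eq_mul_div, one_mul, le_div_iff₀ (by positivity)] at h1 h2
    have h3 : s * 8 * s ≤ ρ ^ 2 := by
      have : s * 8 ≤ ρ := by nlinarith
      nlinarith
    have h5 : 8 * (L + 1) * s ≤ ρ ^ 2 := by linarith
    by_cases hs1 : s ≤ 1
    · nlinarith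
    · push Not at hs1
      have h6 : (s * (8 * (L + 1))) ^ 2 ≤ ρ ^ 2 := by gcongr
      have h7 : (L + s) * (8 * s) ≤ (s * (8 * (L + 1))) ^ 2 := by
        have : (s * (8 * (L + 1))) ^ 2 = 64 * (s * s) * (L + 1) ^ 2 := by ring
        rw [this]
        have h8 : (L + s) ≤ s * (L + 1) := by nlinarith
        have h9 : (L + 1) ≤ (L + 1) ^ 2 := by nlinarith
        calc (L + s) * (8 * s) ≤ s * (L + 1) * (8 * s) := by gcongr
          _ = 8 * (s * s) * (L + 1) := by ring
          _ ≤ 8 * (s * s) * (L + 1) ^ 2 := by gcongr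
          _ ≤ _ := by nlinarith [mul_pos hs hs, sq_nonneg (L + 1), mul_nonneg (mul_pos hs hs).le (sq_nonneg (L + 1))]
      linarith
  have e1 : (4 * π * (2 * s)) ^ (-(d:ℝ) / 2) = 2 ^ (-(d:ℝ) / 2) * (4 * π * s) ^ (-(d:ℝ) / 2) := by
    rw [← mul_rpow (by positivity) (by positivity)]; congr 1; ring
  have e2 : (2 * s) ^ (-1 - b) = 2 ^ (-1 - b) * s ^ (-1 - b) := mul_rpow (by positivity) hs.le
  have e3 : exp (-(2 * s) - ρ ^ 2 / (4 * (2 * s))) = exp (-s - ρ ^ 2 / (4 * s)) * exp (ρ ^ 2 / (8 * s) - s) := by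
    rw [← exp_add]; congr 1; field_simp; ring
  have e4 : 1 ≤ (2:ℝ) ^ (-(d:ℝ) / 2) * 2 ^ (-1 - b) * exp (ρ ^ 2 / (8 * s) - s) := by
    rw [← rpow_add two_pos]
    have h5 : (2:ℝ) ^ ((d:ℝ) / 2 + 1 + b) ≤ exp (ρ ^ 2 / (8 * s) - s) := by
      calc (2:ℝ) ^ ((d:ℝ) / 2 + 1 + b) ≤ 2 ^ L := rpow_le_rpow_of_exponent_le one_le_two hL
        _ ≤ exp 1 ^ L := rpow_le_rpow two_pos.le (by linarith [add_one_le_exp (1:ℝ)]) hL0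
        _ = exp L := exp_one_rpow L
        _ ≤ _ := exp_le_exp.2 hE
    have h6 : (2:ℝ) ^ (-(d:ℝ) / 2 + (-1 - b)) = (2 ^ ((d:ℝ) / 2 + 1 + b))⁻¹ := by
      rw [← rpow_neg two_pos.le]; congr 1; ring
    rw [h6, inv_mul_eq_div, le_div_iff₀ (by positivity), one_mul]
    exact h5
  rw [Gk, Gk, e1, e2, e3]
  set A := (4 * π * s) ^ (-(d:ℝ) / 2)
  set B := exp (-s - ρ ^ 2 / (4 * s))
  calc A * B * s ^ (-1 - b) = A * B * s ^ (-1 - b) * 1 := by ring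
    _ ≤ A * B * s ^ (-1 - b) * (2 ^ (-(d:ℝ) / 2) * 2 ^ (-1 - b) * exp (ρ ^ 2 / (8 * s) - s)) := by
        gcongr
    _ = _ := by ring

set_option maxHeartbeats 2000000 in
lemma pe_harnack_far {d : ℕ} {a : ℝ} {η : Measure ℝ} (h : IsSub a η) (ha : 0 < a) (ha1 : a < 1)
    {T K : ℝ} (hT : 0 < T) (hK : 0 < K) : ∃ (K' : ℝ) (C : ENNReal), 0 < K' ∧ C ≠ ⊤ ∧
      ∀ t r : ℝ, 0 < t → t ≤ T → t / 2 ≤ r → r ≤ t → ∀ x x' y : Ed d,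
        ‖x - x'‖ ≤ K * t ^ (1 / (2 * a)) → K' * t ^ (1 / (2 * a)) ≤ ‖y - x‖ →
        pe a η t x y ≤ C * pe a η r x' y := by
  have := h.prob
  obtain ⟨k, C0, hC0, hup⟩ := h.upper ha ha1
  obtain ⟨M, hM, hηM⟩ := h.exists_Icc
  have hM0 : 0 < M := by linarith
  have hlo := h.lower ha ha1 hM0
  have hηI : 0 < η (Iic M) := lt_of_lt_of_le hηM (measure_mono fun s hs => hs.2)
  have hG := Real.Gamma_pos_of_pos (show 0 < 1 - a by linarith)
  set L : ℝ := (d:ℝ) / 2 + 1 + (k + 1) * a with hL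
  have hL0 : 0 ≤ L := by positivity
  set θ := 1 / (8 * (L + 1)) with hθ
  have hθ0 : 0 < θ := by positivity
  set T' := T ^ (1 / (2 * a)) with hT'
  have hT'0 : 0 < T' := by positivity
  set K' := K + (M / θ + 1) + M * T' / θ with hK'
  have hK'0 : 0 < K' := by positivity
  set D := (3 * K * T' + 3) / (4 * θ) with hD
  set c0 := ENNReal.ofReal (a / Gamma (1 - a)) * η (Iic M) with hc0
  have hc00 : c0 ≠ 0 := mul_ne_zero (by simp; positivity) hηI.ne'
  have hc0t : c0 ≠ ⊤ := ENNReal.mul_ne_top ENNReal.ofReal_ne_top (measure_ne_top _ _)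
  refine ⟨K', C0 * (((k + 1 : ℕ) : ENNReal) * (2 * ENNReal.ofReal (exp D) * (2 * c0⁻¹))), hK'0, ?_,
    fun t r ht htT hr1 hr2 x x' y hxx hxy => ?_⟩
  · exact ENNReal.mul_ne_top hC0 (ENNReal.mul_ne_top (by simp) (ENNReal.mul_ne_top
      (ENNReal.mul_ne_top (by simp) (by simp)) (ENNReal.mul_ne_top (by simp) (by simp [hc00]))))
  set R := t ^ (1 / (2 * a)) with hR
  have hR0 : 0 < R := by positivity
  have hRT : R ≤ T' := rpow_le_rpow ht.le htT (by positivity)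
  set S := t ^ (1 / a) with hS
  have hS0 : 0 < S := by positivity
  have hRS : R ^ 2 = S := by
    rw [hR, ← rpow_natCast, ← rpow_mul ht.le, hS]; congr 1; push_cast; field_simp
  have hSa : S ^ a = t := by
    rw [hS, ← rpow_mul ht.le, one_div_mul_cancel ha.ne', rpow_one]
  set ρ := ‖y - x‖ with hρd
  set ρ' := ‖y - x'‖ with hρd'
  have hρ : 0 < ρ := lt_of_lt_of_le (by positivity) hxy
  have hKρ : K * R ≤ ρ := le_trans (by gcongr; rw [hK']; have : 0 < M / θ := by positivity
                                       have : 0 < M * T' / θ := by positivity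
                                       linarith) hxy
  have hρρ : ρ' ≤ ρ + K * R := by
    calc ρ' = ‖(y - x) + (x - x')‖ := by rw [hρd']; congr 1; abel
      _ ≤ ‖y - x‖ + ‖x - x'‖ := norm_add_le _ _
      _ ≤ _ := by gcongr
  set b := θ * min ρ (ρ ^ 2) with hb
  have hb0 : 0 < b := by positivity
  have hMb : M * S ≤ b := by
    rw [hb, mul_min_of_nonneg _ _ hθ0.le]
    refine le_min ?_ ?_
    · have h1 : M * T' / θ * R ≤ ρ := le_trans (by gcongr; rw [hK']; have : 0 < M / θ := by positivity
                                                   linarith) hxy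
      rw [← hRS]
      have h2 : M * R ^ 2 ≤ M * T' * R := by nlinarith [mul_le_mul_of_nonneg_left hRT (mul_pos hM0 hR0).le]
      have h3 : M * T' * R = θ * (M * T' / θ * R) := by field_simp
      rw [h3] at h2
      exact h2.trans (by gcongr)
    · have h1 : (M / θ + 1) * R ≤ ρ := le_trans (by gcongr; rw [hK']; have : 0 < M * T' / θ := by positivity
                                                    linarith) hxy
      have h2 : ((M / θ + 1) * R) ^ 2 ≤ ρ ^ 2 := by gcongr
      have h3 : M / θ ≤ (M / θ + 1) ^ 2 := by nlinarith [div_pos hM0 hθ0]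
      rw [← hRS]
      calc M * R ^ 2 = θ * (M / θ * R ^ 2) := by field_simp
        _ ≤ θ * ((M / θ + 1) ^ 2 * R ^ 2) := by gcongr
        _ = θ * ((M / θ + 1) * R) ^ 2 := by ring
        _ ≤ _ := by gcongr
  have hSb : S ≤ b := le_trans (by nlinarith) hMb
  -- comparison of Gaussians
  have hG1 : ∀ s, b < s → Gk d s ρ ≤ exp D * Gk d s ρ' := by
    intro s hs
    have hs0 : 0 < s := hb0.trans hs
    rw [Gk, Gk, mul_left_comm, ← exp_add]
    refine mul_le_mul_of_nonneg_left (exp_le_exp.2 ?_) (by positivity)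
    have h1 : ρ' ^ 2 - ρ ^ 2 ≤ 3 * K * R * ρ := by
      have h0 : 0 ≤ ρ' := norm_nonneg _
      have h2 : ρ' ^ 2 ≤ (ρ + K * R) ^ 2 := by gcongr
      nlinarith [mul_le_mul_of_nonneg_left hKρ (mul_pos hK hR0).le]
    have h2 : 3 * K * R * ρ ≤ (3 * K * T' + 3) * min ρ (ρ ^ 2) := by
      rcases le_total ρ (ρ ^ 2) with hc | hc
      · rw [min_eq_left hc]
        refine mul_le_mul_of_nonneg_right ?_ hρ.le
        nlinarith [mul_le_mul_of_nonneg_left hRT hK.le]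
      · rw [min_eq_right hc]
        have : 0 < 3 * K * T' := by positivity
        nlinarith [mul_pos hρ hρ]
    have h3 : (ρ' ^ 2 - ρ ^ 2) / (4 * s) ≤ D := by
      rw [div_le_iff₀ (by positivity)]
      calc _ ≤ (3 * K * T' + 3) * min ρ (ρ ^ 2) := h1.trans h2
        _ = D * (4 * b) := by rw [hD, hb]; field_simp
        _ ≤ D * (4 * s) := by gcongr
    have h4 : (ρ' ^ 2 - ρ ^ 2) / (4 * s) = ρ' ^ 2 / (4 * s) - ρ ^ 2 / (4 * s) := sub_div _ _ _
    linarith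
  have hFm : ∀ ρ : ℝ, Measurable fun s : ℝ => ENNReal.ofReal (Gk d s ρ) := fun ρ =>
    ENNReal.measurable_ofReal.comp (Gk_meas2 d measurable_id measurable_const)
  have hpm : ∀ e : ℝ, Measurable fun s : ℝ => ENNReal.ofReal (s ^ e) := fun e => by fun_prop
  set N := ∫⁻ s in Ioi b, ENNReal.ofReal (Gk d s ρ') * ENNReal.ofReal (s ^ (-1 - a)) with hN
  -- each term
  have hterm : ∀ j ∈ Finset.range (k + 1), ENNReal.ofReal (t ^ (j + 1)) * ∫⁻ s in Ioi (0:ℝ),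
      ENNReal.ofReal (Gk d s ρ) * ENNReal.ofReal (s ^ (-1 - ((j:ℝ) + 1) * a)) ≤
      2 * ENNReal.ofReal (exp D) * (ENNReal.ofReal t * N) := by
    intro j hj
    have hjk : (j:ℝ) ≤ k := by exact_mod_cast Nat.lt_succ_iff.1 (Finset.mem_range.1 hj)
    have hht := head_tail (F := fun s => ENNReal.ofReal (Gk d s ρ) *
      ENNReal.ofReal (s ^ (-1 - ((j:ℝ) + 1) * a))) ((hFm ρ).mul (hpm _)) hb0 (fun s hs0 hsb => by
        rw [← ENNReal.ofReal_mul (Gk_nonneg d hs0.le _), ← ENNReal.ofReal_mul (Gk_nonneg d (by positivity) _)]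
        refine ENNReal.ofReal_le_ofReal (Gk_double d hL0 ?_ hρ hs0 hsb)
        rw [hL]; gcongr) (by
        have hJ := lint_Gk_pow d (-(((j:ℝ) + 1) * a)) ρ
        have hJ2 : ∫⁻ s in Ioi (0:ℝ), ENNReal.ofReal (Gk d s ρ) *
            ENNReal.ofReal (s ^ (-1 - ((j:ℝ) + 1) * a)) =
            ∫⁻ u in Ioi (0:ℝ), ENNReal.ofReal (u ^ (-(((j:ℝ) + 1) * a) - 1) * Gk d u ρ) := by
          refine setLIntegral_congr_fun measurableSet_Ioi fun s (hs : 0 < s) => ?_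
          rw [← ENNReal.ofReal_mul (Gk_nonneg d hs.le _), mul_comm]
          congr 3; ring
        rw [hJ2, hJ]
        refine ENNReal.mul_ne_top ENNReal.ofReal_ne_top (Jf_ne_top ?_ hρ)
        have : 0 < ((j:ℝ) + 1) * a := by positivity
        have : (0:ℝ) ≤ d := Nat.cast_nonneg d
        linarith)
    calc _ ≤ ENNReal.ofReal (t ^ (j + 1)) * (2 * ∫⁻ s in Ioi b, ENNReal.ofReal (Gk d s ρ) *
            ENNReal.ofReal (s ^ (-1 - ((j:ℝ) + 1) * a))) := mul_le_mul_right hht _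
      _ = 2 * ∫⁻ s in Ioi b, ENNReal.ofReal (t ^ (j + 1)) * (ENNReal.ofReal (Gk d s ρ) *
            ENNReal.ofReal (s ^ (-1 - ((j:ℝ) + 1) * a))) := by
          rw [lintegral_const_mul' _ _ ENNReal.ofReal_ne_top]; ring
      _ ≤ 2 * ∫⁻ s in Ioi b, ENNReal.ofReal (exp D) * ENNReal.ofReal t * (ENNReal.ofReal (Gk d s ρ') *
            ENNReal.ofReal (s ^ (-1 - a))) := by
          refine mul_le_mul_right (setLIntegral_mono' measurableSet_Ioi fun s (hs : b < s) => ?_) _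
          have hs0 : 0 < s := hb0.trans hs
          rw [← ENNReal.ofReal_mul (Gk_nonneg d hs0.le _), ← ENNReal.ofReal_mul (Gk_nonneg d hs0.le _),
            ← ENNReal.ofReal_mul (by positivity), ← ENNReal.ofReal_mul (by positivity),
            ← ENNReal.ofReal_mul (by positivity)]
          refine ENNReal.ofReal_le_ofReal ?_
          have h1 : t ^ (j + 1) * s ^ (-1 - ((j:ℝ) + 1) * a) ≤ t * s ^ (-1 - a) := by
            have h2 : s ^ (-1 - ((j:ℝ) + 1) * a) = s ^ (-1 - a) * ((s ^ a) ^ j)⁻¹ := by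
              rw [← rpow_natCast, ← rpow_mul hs0.le, ← rpow_neg hs0.le, ← rpow_add hs0]; congr 1; ring
            have h3 : t ^ j ≤ (s ^ a) ^ j := by
              refine pow_le_pow_left₀ ht.le ?_ j
              rw [← hSa]; exact rpow_le_rpow hS0.le (hSb.trans hs.le) ha.le
            rw [h2, pow_succ]
            calc t ^ j * t * (s ^ (-1 - a) * ((s ^ a) ^ j)⁻¹) = (t * s ^ (-1 - a)) * (t ^ j * ((s ^ a) ^ j)⁻¹) := by ring
              _ ≤ (t * s ^ (-1 - a)) * 1 := by
                  refine mul_le_mul_of_nonneg_left ?_ (by positivity)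
                  rw [← div_eq_mul_inv, div_le_one (by positivity)]; exact h3
              _ = _ := mul_one _
          calc _ = Gk d s ρ * (t ^ (j + 1) * s ^ (-1 - ((j:ℝ) + 1) * a)) := by ring
            _ ≤ (exp D * Gk d s ρ') * (t * s ^ (-1 - a)) :=
                mul_le_mul (hG1 s hs) h1 (by positivity) (mul_nonneg (exp_pos _).le (Gk_nonneg d hs0.le _))
            _ = _ := by ring
      _ = _ := by
          rw [lintegral_const_mul' _ _ (ENNReal.mul_ne_top ENNReal.ofReal_ne_top ENNReal.ofReal_ne_top)]
          ring
  have hr0 : 0 < r := by linarith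
  have hlow : ENNReal.ofReal t * N ≤ 2 * c0⁻¹ * pe a η r x' y := by
    have h1 := hlo (fun s => ENNReal.ofReal (Gk d s ρ')) (hFm ρ') r hr0
    have h2 : N ≤ ∫⁻ s in Ioi (M * r ^ (1 / a)), ENNReal.ofReal (Gk d s ρ') * ENNReal.ofReal (s ^ (-1 - a)) := by
      refine lintegral_mono_set (Ioi_subset_Ioi ?_)
      refine le_trans ?_ hMb
      exact mul_le_mul_of_nonneg_left (rpow_le_rpow hr0.le hr2 (by positivity)) hM0.le
    have h3 : ENNReal.ofReal t ≤ 2 * ENNReal.ofReal r := by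
      rw [show (2:ENNReal) = ENNReal.ofReal 2 by simp, ← ENNReal.ofReal_mul two_pos.le]
      exact ENNReal.ofReal_le_ofReal (by linarith)
    calc ENNReal.ofReal t * N ≤ 2 * ENNReal.ofReal r * ∫⁻ s in Ioi (M * r ^ (1 / a)),
            ENNReal.ofReal (Gk d s ρ') * ENNReal.ofReal (s ^ (-1 - a)) := mul_le_mul' h3 h2
      _ = 2 * (c0⁻¹ * c0) * ENNReal.ofReal r * ∫⁻ s in Ioi (M * r ^ (1 / a)),
            ENNReal.ofReal (Gk d s ρ') * ENNReal.ofReal (s ^ (-1 - a)) := by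
          rw [ENNReal.inv_mul_cancel hc00 hc0t, mul_one]
      _ = 2 * c0⁻¹ * (c0 * ENNReal.ofReal r * ∫⁻ s in Ioi (M * r ^ (1 / a)),
            ENNReal.ofReal (Gk d s ρ') * ENNReal.ofReal (s ^ (-1 - a))) := by ring
      _ ≤ _ := mul_le_mul_right h1 _
  calc pe a η t x y ≤ C0 * ∑ j ∈ Finset.range (k + 1), ENNReal.ofReal (t ^ (j + 1)) * ∫⁻ s in Ioi (0:ℝ),
        ENNReal.ofReal (Gk d s ρ) * ENNReal.ofReal (s ^ (-1 - ((j:ℝ) + 1) * a)) :=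
        hup (fun s => ENNReal.ofReal (Gk d s ρ)) (hFm ρ) t ht
    _ ≤ C0 * ∑ j ∈ Finset.range (k + 1), 2 * ENNReal.ofReal (exp D) * (ENNReal.ofReal t * N) :=
        mul_le_mul_right (Finset.sum_le_sum hterm) _
    _ = C0 * (((k + 1 : ℕ) : ENNReal) * (2 * ENNReal.ofReal (exp D) * (ENNReal.ofReal t * N))) := by
        rw [Finset.sum_const, Finset.card_range, nsmul_eq_mul]
    _ ≤ C0 * (((k + 1 : ℕ) : ENNReal) * (2 * ENNReal.ofReal (exp D) * (2 * c0⁻¹ * pe a η r x' y))) := by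
        gcongr
    _ = _ := by ring

/-- Harnack inequality for the relativistic kernel. -/
lemma pe_harnack {d : ℕ} (hd : 0 < d) {a : ℝ} {η : Measure ℝ} (h : IsSub a η) (ha : 0 < a) (ha1 : a < 1)
    {T K : ℝ} (hT : 0 < T) (hK : 0 < K) : ∃ C : ENNReal, C ≠ ⊤ ∧
      ∀ t r : ℝ, 0 < t → t ≤ T → t / 2 ≤ r → r ≤ t → ∀ x x' y : Ed d,
        ‖x - x'‖ ≤ K * t ^ (1 / (2 * a)) → pe a η t x y ≤ C * pe a η r x' y := by
  obtain ⟨K', C1, hK', hC1, h1⟩ := pe_harnack_far (d := d) h ha ha1 hT hK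
  obtain ⟨C2, hC2, h2⟩ := pe_le_diag hd h ha
  obtain ⟨c, hc, h3⟩ := pe_ge (d := d) h ha hT (K := K + K') (by positivity)
  refine ⟨C1 + ENNReal.ofReal (C2 / c), ENNReal.add_ne_top.2 ⟨hC1, ENNReal.ofReal_ne_top⟩,
    fun t r ht htT hr1 hr2 x x' y hxx => ?_⟩
  rw [add_mul]
  rcases le_total (K' * t ^ (1 / (2 * a))) ‖y - x‖ with hc' | hc'
  · exact (h1 t r ht htT hr1 hr2 x x' y hxx hc').trans le_self_add
  · refine le_trans ?_ le_add_self
    have h4 : ‖y - x'‖ ≤ (K + K') * t ^ (1 / (2 * a)) := by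
      calc ‖y - x'‖ = ‖(x - x') + (y - x)‖ := by congr 1; abel
        _ ≤ ‖x - x'‖ + ‖y - x‖ := norm_add_le _ _
        _ ≤ _ := by rw [add_mul]; exact add_le_add hxx hc'
    have h5 := h3 t r ht htT hr1 (by linarith) x' y h4
    calc _ ≤ ENNReal.ofReal (C2 * t ^ (-(d:ℝ) / (2 * a))) := h2 t ht x y
      _ = ENNReal.ofReal (C2 / c) * ENNReal.ofReal (c * t ^ (-(d:ℝ) / (2 * a))) := by
          rw [← ENNReal.ofReal_mul (by positivity)]; congr 1; field_simp
      _ ≤ _ := mul_le_mul_right h5 _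

/-- Lower bound for the free semigroup acting on `Jf` (F7). -/
lemma PtJ_ge {d : ℕ} {a ν : ℝ} {η : Measure ℝ} (h : IsSub a η) (ha : 0 < a)
    (hν : ν + a < (d:ℝ) / 2) {T : ℝ} (hT : 0 < T) : ∃ c : ℝ, 0 < c ∧ ∀ t u : ℝ, 0 < u → u ≤ t → t ≤ T →
      ∀ z : Ed d, ‖z‖ ≤ t ^ (1 / (2 * a)) →
        ENNReal.ofReal (c * t ^ (-(ν / a))) ≤ ∫⁻ v, pe a η u z v * Jf ν ‖v‖ := by
  obtain ⟨c, hc, h3⟩ := pe_ge (d := d) h ha hT (K := 1) one_pos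
  have hW := Wc_pos (d := d) ha (show ν < (d:ℝ) / 2 by linarith)
  refine ⟨Wc d a ν * c, by positivity, fun t u hu hut htT z hz => ?_⟩
  have ht : 0 < t := by linarith
  rw [PtJ h ha (by linarith) hu]
  set e := ((d:ℝ) / 2 - ν) / a - 1 with he
  have he0 : 0 < e := by rw [he, sub_pos, one_lt_div ha]; linarith
  have e1 : t ^ e * t ^ (-(d:ℝ) / (2 * a)) * t = t ^ (-(ν / a)) := by
    nth_rewrite 3 [← rpow_one t]
    rw [← rpow_add ht, ← rpow_add ht]; congr 1; rw [he]; field_simp; ring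
  rw [mul_assoc, ENNReal.ofReal_mul hW.le]
  refine mul_le_mul_right ?_ _
  calc ENNReal.ofReal (c * t ^ (-(ν / a)))
      = ∫⁻ r in Ioo t (2 * t), ENNReal.ofReal (t ^ e) * ENNReal.ofReal (c * t ^ (-(d:ℝ) / (2 * a))) := by
        rw [setLIntegral_const, Real.volume_Ioo, ← ENNReal.ofReal_mul (by positivity),
          ← ENNReal.ofReal_mul (by positivity), ← e1]
        congr 1; ring
    _ ≤ ∫⁻ r in Ioo t (2 * t), ENNReal.ofReal (r ^ e) * pe a η (u + r) z 0 := by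
        refine setLIntegral_mono' measurableSet_Ioo fun r hr => ?_
        refine mul_le_mul' (ENNReal.ofReal_le_ofReal (rpow_le_rpow ht.le hr.1.le he0.le)) ?_
        exact h3 t (u + r) ht htT (by linarith [hr.1]) (by linarith [hr.2]) z 0 (by simpa using hz)
    _ ≤ _ := lintegral_mono_set fun r hr => ht.trans hr.1

/-- The Hardy-type constant `Γ(x+a)Γ(n-x+a)/(Γ(x)Γ(n-x))`. -/
def Dn (n a x : ℝ) : ℝ := Gamma (x + a) * Gamma (n - x + a) / (Gamma x * Gamma (n - x))

lemma Dn_pos {n a x : ℝ} (ha : 0 < a) (hx : 0 < x) (hxn : x < n) : 0 < Dn n a x := by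
  have h1 := Gamma_pos_of_pos hx
  have h2 := Gamma_pos_of_pos (show 0 < n - x by linarith)
  have h3 := Gamma_pos_of_pos (show 0 < x + a by linarith)
  have h4 := Gamma_pos_of_pos (show 0 < n - x + a by linarith)
  unfold Dn; positivity

lemma GammaSeq_pos {s : ℝ} (hs : 0 < s) {N : ℕ} (hN : 0 < N) : 0 < Real.GammaSeq s N := by
  unfold Real.GammaSeq
  have h1 : (0:ℝ) < N := by exact_mod_cast hN
  have h2 : 0 < ∏ j ∈ Finset.range (N + 1), (s + (j:ℝ)) := Finset.prod_pos fun j _ => by positivity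
  positivity

lemma Dn_seq {n a x : ℝ} (ha : 0 < a) (hx : 0 < x) (hxn : x < n) {N : ℕ} (hN : 0 < N) :
    Real.GammaSeq (x + a) N * Real.GammaSeq (n - x + a) N / (Real.GammaSeq x N * Real.GammaSeq (n - x) N)
    = (N:ℝ) ^ (2 * a) * ∏ j ∈ Finset.range (N + 1), ((x + j) * (n - x + j) / ((x + a + j) * (n - x + a + j))) := by
  have h1 : (0:ℝ) < N := by exact_mod_cast hN
  have hy : 0 < n - x := by linarith
  have e1 : (N:ℝ) ^ (x + a) = (N:ℝ) ^ x * (N:ℝ) ^ a := rpow_add h1 _ _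
  have e2 : (N:ℝ) ^ (n - x + a) = (N:ℝ) ^ (n - x) * (N:ℝ) ^ a := rpow_add h1 _ _
  have e3 : (N:ℝ) ^ (2 * a) = (N:ℝ) ^ a * (N:ℝ) ^ a := by rw [← rpow_add h1]; congr 1; ring
  have p1 : ∏ j ∈ Finset.range (N + 1), (x + (j:ℝ)) ≠ 0 := (Finset.prod_pos fun j _ => by positivity).ne'
  have p2 : ∏ j ∈ Finset.range (N + 1), (n - x + (j:ℝ)) ≠ 0 := (Finset.prod_pos fun j _ => by positivity).ne'
  have p3 : ∏ j ∈ Finset.range (N + 1), (x + a + (j:ℝ)) ≠ 0 := (Finset.prod_pos fun j _ => by positivity).ne'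
  have p4 : ∏ j ∈ Finset.range (N + 1), (n - x + a + (j:ℝ)) ≠ 0 := (Finset.prod_pos fun j _ => by positivity).ne'
  have hf : ((N.factorial : ℕ) : ℝ) ≠ 0 := by positivity
  rw [Finset.prod_div_distrib, Finset.prod_mul_distrib, Finset.prod_mul_distrib]
  unfold Real.GammaSeq
  rw [e1, e2, e3]
  have q1 : (N:ℝ) ^ x ≠ 0 := by positivity
  have q2 : (N:ℝ) ^ (n - x) ≠ 0 := by positivity
  generalize (∏ j ∈ Finset.range (N + 1), (x + (j:ℝ))) = A at *
  generalize (∏ j ∈ Finset.range (N + 1), (n - x + (j:ℝ))) = B at *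
  generalize (∏ j ∈ Finset.range (N + 1), (x + a + (j:ℝ))) = C at *
  generalize (∏ j ∈ Finset.range (N + 1), (n - x + a + (j:ℝ))) = D at *
  generalize ((N.factorial : ℕ) : ℝ) = F at *
  generalize (N:ℝ) ^ x = X at *
  generalize (N:ℝ) ^ (n - x) = Y at *
  field_simp

lemma Dn_strict {n a x₁ x₂ : ℝ} (ha : 0 < a) (hx : 0 < x₁) (h12 : x₁ < x₂) (hxn : x₂ ≤ n / 2) :
    Dn n a x₁ < Dn n a x₂ := by
  have hn : 0 < n := by linarith
  have hP : x₁ * (n - x₁) < x₂ * (n - x₂) := by nlinarith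
  have hP1 : 0 < x₁ * (n - x₁) := by apply mul_pos <;> linarith
  have fle : ∀ c e : ℝ, 0 ≤ c → c ≤ e → (x₁ * (n - x₁) + c) / (x₁ * (n - x₁) + e) ≤
      (x₂ * (n - x₂) + c) / (x₂ * (n - x₂) + e) := by
    intro c e hc he
    rw [div_le_div_iff₀ (by linarith) (by linarith)]
    nlinarith
  set f : ℝ → ℕ → ℝ := fun x j => (x + j) * (n - x + j) / ((x + a + j) * (n - x + a + j)) with hf
  have hfe : ∀ x (j : ℕ), f x j = (x * (n - x) + (j * n + j ^ 2)) / (x * (n - x) + ((a + j) * n + (a + j) ^ 2)) := by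
    intro x j; rw [hf]; simp only; congr 1 <;> ring
  have hfp : ∀ x, 0 < x → x < n → ∀ j, 0 < f x j := by
    intro x h0 h1 j
    have : 0 < n - x := by linarith
    rw [hf]; positivity
  have hfj : ∀ j, f x₁ j ≤ f x₂ j := fun j => by
    rw [hfe, hfe]; refine fle _ _ (by positivity) ?_
    have : (0:ℝ) ≤ j := Nat.cast_nonneg j
    nlinarith
  have hf0 : f x₁ 0 < f x₂ 0 := by
    rw [hfe, hfe]; simp only [Nat.cast_zero, zero_mul, add_zero]
    have : 0 < a * n + a ^ 2 := by positivity
    rw [div_lt_div_iff₀ (by nlinarith) (by nlinarith)]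
    nlinarith
  have hlim : ∀ x, 0 < x → x < n → Tendsto (fun N : ℕ => (N:ℝ) ^ (2 * a) * ∏ j ∈ Finset.range (N + 1), f x j)
      atTop (nhds (Dn n a x)) := by
    intro x h0 h1
    have t1 := (Real.GammaSeq_tendsto_Gamma (x + a)).mul (Real.GammaSeq_tendsto_Gamma (n - x + a))
    have t2 := (Real.GammaSeq_tendsto_Gamma x).mul (Real.GammaSeq_tendsto_Gamma (n - x))
    have t3 := t1.div t2 (mul_pos (Gamma_pos_of_pos h0) (Gamma_pos_of_pos (show 0 < n - x by linarith))).ne'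
    refine t3.congr' ?_
    filter_upwards [eventually_gt_atTop 0] with N hN
    exact Dn_seq ha h0 h1 hN
  have key : Dn n a x₁ * f x₂ 0 ≤ Dn n a x₂ * f x₁ 0 := by
    refine le_of_tendsto_of_tendsto' ((hlim x₁ hx (by linarith)).mul_const _)
      ((hlim x₂ (by linarith) (by linarith)).mul_const _) fun N => ?_
    rw [Finset.prod_range_succ', Finset.prod_range_succ']
    have h1 : ∏ j ∈ Finset.range N, f x₁ (j + 1) ≤ ∏ j ∈ Finset.range N, f x₂ (j + 1) :=
      Finset.prod_le_prod (fun j _ => (hfp _ hx (by linarith) _).le) fun j _ => hfj _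
    have p1 := hfp x₁ hx (by linarith) 0
    have p2 := hfp x₂ (by linarith) (by linarith) 0
    have : 0 ≤ (N:ℝ) ^ (2 * a) * (f x₁ 0 * f x₂ 0) := by positivity
    nlinarith [mul_le_mul_of_nonneg_left h1 this]
  have p2 := hfp x₂ (by linarith) (by linarith) 0
  have p1 := hfp x₁ hx (by linarith) 0
  have hD := Dn_pos ha (show 0 < x₂ by linarith) (show x₂ < n by linarith)
  by_contra hcon
  push Not at hcon
  nlinarith

def Jr (ν ρ : ℝ) : ℝ := (Jf ν ρ).toReal

lemma ofReal_Jr {ν ρ : ℝ} (hν : 0 < ν) (hρ : 0 < ρ) : ENNReal.ofReal (Jr ν ρ) = Jf ν ρ :=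
  ENNReal.ofReal_toReal (Jf_ne_top hν hρ)

lemma Jr_pos {ν ρ : ℝ} (hν : 0 < ν) (hρ : 0 < ρ) : 0 < Jr ν ρ :=
  ENNReal.toReal_pos (Jf_pos ν ρ).ne' (Jf_ne_top hν hρ)

lemma Jr_le {ν ρ : ℝ} (hν : 0 < ν) (hρ : 0 < ρ) : Jr ν ρ ≤ Gamma ν * (ρ ^ 2 / 4) ^ (-ν) := by
  have := Gamma_pos_of_pos hν
  exact ENNReal.toReal_le_of_le_ofReal (by positivity) (Jf_le hν hρ)

lemma Jr_ge {ν κ ρ : ℝ} (hκ : 0 < κ) (hκ1 : κ ≤ 1) (hν : κ < ν) (hρ : 0 < ρ) :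
    Gamma ν * (ρ ^ 2 / 4) ^ (-ν) ≤ Jr ν ρ + Gamma (ν - κ) * (ρ ^ 2 / 4) ^ (κ - ν) := by
  have h := Jf_ge hκ hκ1 hν hρ
  have h1 := Gamma_pos_of_pos (show 0 < ν - κ by linarith)
  rw [← ofReal_Jr (by linarith) hρ, ← ENNReal.ofReal_add (Jr_pos (by linarith) hρ).le (by positivity)] at h
  exact (ENNReal.ofReal_le_ofReal_iff (add_nonneg (Jr_pos (by linarith) hρ).le (by positivity))).1 h

lemma Jr_shift {a ρ0 N : ℝ} (ha : 0 < a) (ha1 : a < 1) (hρ0 : 0 < ρ0) (hN : 0 ≤ N) :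
    ∃ C : ℝ, 0 < C ∧ ∀ ν ρ : ℝ, 0 < ν → ν ≤ N → ρ0 ≤ ρ → Jr (ν + a) ρ ≤ C * Jr ν ρ := by
  obtain ⟨C, hC, h⟩ := Jf_shift ha ha1 hρ0 hN
  refine ⟨C, hC, fun ν ρ h0 h1 h2 => ?_⟩
  have h3 := h ν ρ h1 h2
  have hρ : 0 < ρ := by linarith
  rw [← ofReal_Jr h0 hρ, ← ofReal_Jr (by linarith) hρ, ← ENNReal.ofReal_mul hC.le] at h3
  exact (ENNReal.ofReal_le_ofReal_iff (mul_nonneg hC.le ENNReal.toReal_nonneg)).1 h3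

/-- The potential, as a function of the radius. -/
def Vr (d : ℕ) (a ν ρ : ℝ) : ℝ := cnu d a ν * (Jr (ν + a) ρ / Jr ν ρ)

lemma Vr_pos {d : ℕ} {a ν ρ : ℝ} (ha : 0 < a) (hν : 0 < ν) (hνd : ν + a < (d:ℝ) / 2) (hρ : 0 < ρ) :
    0 < Vr d a ν ρ := by
  have := cnu_pos ha hνd
  have := Jr_pos hν hρ
  have := Jr_pos (show 0 < ν + a by linarith) hρ
  unfold Vr; positivity

lemma cnu_Dn {d : ℕ} {a ν : ℝ} (hν : 0 < ν) :
    cnu d a ν * Gamma (ν + a) = Dn ((d:ℝ) / 2 - a) a ν * Gamma ν := by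
  have h1 := (Gamma_pos_of_pos hν).ne'
  unfold cnu Dn
  rw [show (d:ℝ) / 2 - a - ν + a = d / 2 - ν by ring, show (d:ℝ) / 2 - a - ν = d / 2 - ν - a by ring]
  field_simp

/-- Near the origin the potential is almost `D * w^{-a}`. -/
lemma Vr_ge {d : ℕ} {a ν κ ρ : ℝ} (ha : 0 < a) (hν : 0 < ν) (hνd : ν + a < (d:ℝ) / 2) (hκ : 0 < κ)
    (hκ1 : κ ≤ 1) (hκa : κ < ν) (hρ : 0 < ρ) :
    Dn ((d:ℝ) / 2 - a) a ν * (ρ ^ 2 / 4) ^ (-a) *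
      (1 - Gamma (ν + a - κ) / Gamma (ν + a) * (ρ ^ 2 / 4) ^ κ) ≤ Vr d a ν ρ := by
  have hc := cnu_pos ha hνd
  have hJ := Jr_pos hν hρ
  have h1 := Jr_le hν hρ
  have h2 := Jr_ge hκ hκ1 (show κ < ν + a by linarith) hρ
  have hJa := Jr_pos (show 0 < ν + a by linarith) hρ
  have hcD := cnu_Dn (d := d) (a := a) hν
  have hw : 0 < ρ ^ 2 / 4 := by positivity
  set w := ρ ^ 2 / 4 with hwd
  have hG := Gamma_pos_of_pos hν
  have hGa := Gamma_pos_of_pos (show 0 < ν + a by linarith)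
  have e1 : w ^ (-(ν + a)) = w ^ (-ν) * w ^ (-a) := by rw [← rpow_add hw]; congr 1; ring
  have e2 : w ^ (κ - (ν + a)) = w ^ (-ν) * w ^ (-a) * w ^ κ := by
    rw [← rpow_add hw, ← rpow_add hw]; congr 1; ring
  rw [e1, e2] at h2
  have hp1 : 0 < w ^ (-ν) := by positivity
  have hp2 : 0 < w ^ (-a) := by positivity
  have hD : Dn ((d:ℝ) / 2 - a) a ν = cnu d a ν * Gamma (ν + a) / Gamma ν := by
    rw [hcD]; field_simp
  by_cases hs : 0 ≤ 1 - Gamma (ν + a - κ) / Gamma (ν + a) * w ^ κ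
  · unfold Vr
    rw [hD, ← mul_div_assoc, le_div_iff₀ hJ]
    calc cnu d a ν * Gamma (ν + a) / Gamma ν * w ^ (-a) * (1 - Gamma (ν + a - κ) / Gamma (ν + a) * w ^ κ) * Jr ν ρ
        ≤ cnu d a ν * Gamma (ν + a) / Gamma ν * w ^ (-a) * (1 - Gamma (ν + a - κ) / Gamma (ν + a) * w ^ κ)
          * (Gamma ν * w ^ (-ν)) := by gcongr
      _ = cnu d a ν * (Gamma (ν + a) * (w ^ (-ν) * w ^ (-a)) - Gamma (ν + a - κ) * (w ^ (-ν) * w ^ (-a) * w ^ κ)) := by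
          generalize Gamma (ν + a) = A at *
          generalize Gamma ν = B at *
          generalize Gamma (ν + a - κ) = E at *
          field_simp
      _ ≤ _ := by
          refine mul_le_mul_of_nonneg_left ?_ hc.le
          linarith
  · refine le_trans ?_ (Vr_pos ha hν hνd hρ).le
    refine mul_nonpos_of_nonneg_of_nonpos ?_ (not_le.1 hs).le
    rw [hD]; positivity

set_option maxHeartbeats 2000000 in
lemma near_alg {Wa p p' e D D0 D' D'' G G' G'' A1 A2 ε K q J1 J2 L1 L2 : ℝ}
    (hWa : 0 < Wa) (hp : 0 < p) (hp' : 0 < p') (he : 0 ≤ e) (hep : e * p ≤ p')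
    (hD' : 0 < D') (hD0 : D' < D0) (hD0'' : D0 ≤ D'') (hDD : D'' < D)
    (hG' : 0 < G') (hG'' : 0 < G'') (hGG : G'' ≤ G)
    (hA1 : 0 < A1) (hA2 : 0 < A2) (h1 : A1 * e ≤ ε) (h2 : A2 * e ≤ ε)
    (hε : ε = (D0 - D') / (4 * D0)) (hK : K = 2 * D0 * G * (1 + A1) / (G' * (D0 - D')))
    (hq : D * Wa * (1 - A1 * e) ≤ q)
    (hJ1 : 0 ≤ J1) (hJ2 : 0 ≤ J2) (hJ1' : G'' * p - G * p' ≤ J1) (hJ2' : G' * p' * (1 - A2 * e) ≤ J2)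
    (hL1 : L1 ≤ Wa * D'' * G'' * p) (hL2 : L2 ≤ Wa * D' * G' * p') :
    L1 + K * L2 ≤ D'' / D * q * (J1 + K * J2) := by
  have hD0p : 0 < D0 := by linarith
  have hG : 0 < G := by linarith
  have hdd : 0 < D0 - D' := by linarith
  have hε1 : ε ≤ 1 / 4 := by
    rw [hε, div_le_iff₀ (by positivity)]; linarith
  have hε0 : 0 < ε := by rw [hε]; positivity
  have hK0 : 0 < K := by rw [hK]; positivity
  have hKm : K * G' * (D0 - D') = 2 * D0 * G * (1 + A1) := by rw [hK]; field_simp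
  have hεm : ε * (4 * D0) = D0 - D' := by rw [hε]; field_simp
  have hKG : G ≤ K * G' * (1 - ε) := by
    have h3 : 2 * G ≤ K * G' := by
      by_contra hcon
      push Not at hcon
      have h4 : K * G' * (D0 - D') < 2 * G * (D0 - D') := by gcongr
      have h5 : 0 < G * D' := by positivity
      have h6 : 0 < D0 * G * A1 := by positivity
      nlinarith
    nlinarith
  have hZ : G'' * p + p' * (K * G' * (1 - ε) - G) ≤ J1 + K * J2 := by
    have h3 : K * (G' * p' * (1 - ε)) ≤ K * J2 := by
      refine mul_le_mul_of_nonneg_left (le_trans ?_ hJ2') hK0.le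
      gcongr
    nlinarith
  have hDp : 0 < D := by linarith
  have hDp'' : 0 < D'' := by linarith
  have hθq : D'' * Wa * (1 - A1 * e) ≤ D'' / D * q := by
    calc D'' * Wa * (1 - A1 * e) = D'' / D * (D * Wa * (1 - A1 * e)) := by field_simp
      _ ≤ _ := by gcongr
  have hone : 0 ≤ 1 - A1 * e := by linarith
  have hZ2 : G'' * p + p' * (K * G' * (1 - ε) ^ 2 - G * (1 + A1)) ≤
      (1 - A1 * e) * (G'' * p + p' * (K * G' * (1 - ε) - G)) := by
    have h3 : A1 * e * (G'' * p) ≤ A1 * G * p' := by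
      calc A1 * e * (G'' * p) = A1 * G'' * (e * p) := by ring
        _ ≤ A1 * G * p' := by gcongr
    have h4 : (1 - ε) * (p' * (K * G' * (1 - ε) - G)) ≤ (1 - A1 * e) * (p' * (K * G' * (1 - ε) - G)) := by
      refine mul_le_mul_of_nonneg_right (by linarith) (mul_nonneg hp'.le (by linarith))
    have h5 : 0 < ε * (p' * G) := by positivity
    nlinarith
  have hfin : K * D' * G' ≤ D'' * (K * G' * (1 - ε) ^ 2 - G * (1 + A1)) := by
    have h3 : K * G' * (D0 - D') = 2 * (D0 * (G * (1 + A1))) := by rw [hKm]; ring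
    have h4 : (D0 + D') / 2 ≤ D0 * (1 - ε) ^ 2 := by nlinarith
    have hKG0 : 0 < K * G' := by positivity
    have h5 : K * G' * ((D0 + D') / 2) ≤ K * G' * (D0 * (1 - ε) ^ 2) := by gcongr
    have h6 : K * D' * G' ≤ D0 * (K * G' * (1 - ε) ^ 2 - G * (1 + A1)) := by nlinarith
    have h7 : 0 ≤ K * G' * (1 - ε) ^ 2 - G * (1 + A1) := by
      have : 0 < K * D' * G' := by positivity
      by_contra hcon
      push Not at hcon
      nlinarith
    exact h6.trans (by gcongr)
  calc L1 + K * L2 ≤ Wa * D'' * G'' * p + K * (Wa * D' * G' * p') := by gcongr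
    _ = Wa * (D'' * G'' * p + p' * (K * D' * G')) := by ring
    _ ≤ Wa * (D'' * G'' * p + p' * (D'' * (K * G' * (1 - ε) ^ 2 - G * (1 + A1)))) := by gcongr
    _ = D'' * Wa * (G'' * p + p' * (K * G' * (1 - ε) ^ 2 - G * (1 + A1))) := by ring
    _ ≤ D'' * Wa * ((1 - A1 * e) * (G'' * p + p' * (K * G' * (1 - ε) - G))) := by gcongr
    _ ≤ D'' * Wa * ((1 - A1 * e) * (J1 + K * J2)) := by gcongr
    _ = D'' * Wa * (1 - A1 * e) * (J1 + K * J2) := by ring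
    _ ≤ _ := by
      refine mul_le_mul_of_nonneg_right hθq (by positivity)

lemma near_alg2 {Wa p' e D D0 D' G' A1 A2 ε q J2 L2 : ℝ}
    (hWa : 0 < Wa) (hp' : 0 < p')
    (hD' : 0 < D') (hD0 : D' < D0) (hDD : D0 < D)
    (hG' : 0 < G') (h1 : A1 * e ≤ ε) (h2 : A2 * e ≤ ε)
    (hε : ε = (D0 - D') / (4 * D0))
    (hq : D * Wa * (1 - A1 * e) ≤ q)
    (hJ2 : 0 ≤ J2) (hJ2' : G' * p' * (1 - A2 * e) ≤ J2)
    (hL2 : L2 ≤ Wa * D' * G' * p') :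
    L2 ≤ D0 / D * q * J2 := by
  have hD0p : 0 < D0 := by linarith
  have hε1 : ε ≤ 1 / 4 := by
    rw [hε, div_le_iff₀ (by positivity)]; linarith
  have hεm : ε * (4 * D0) = D0 - D' := by rw [hε]; field_simp
  have hDp : 0 < D := by linarith
  have hθq : D0 * Wa * (1 - ε) ≤ D0 / D * q := by
    calc D0 * Wa * (1 - ε) ≤ D0 * Wa * (1 - A1 * e) := by gcongr
      _ = D0 / D * (D * Wa * (1 - A1 * e)) := by field_simp
      _ ≤ _ := by gcongr
  have h4 : D' ≤ D0 * (1 - ε) ^ 2 := by nlinarith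
  have h5 : 0 ≤ 1 - ε := by linarith
  calc L2 ≤ Wa * D' * G' * p' := hL2
    _ ≤ Wa * (D0 * (1 - ε) ^ 2) * G' * p' := by gcongr
    _ = D0 * Wa * (1 - ε) * (G' * p' * (1 - ε)) := by ring
    _ ≤ D0 * Wa * (1 - ε) * J2 := by
      refine mul_le_mul_of_nonneg_left (le_trans ?_ hJ2') (by positivity)
      gcongr
    _ ≤ _ := by gcongr

lemma Gamma_contAt {x : ℝ} (hx : 0 < x) : ContinuousAt Gamma x :=
  (Real.differentiableAt_Gamma fun m h => by
    have : (0:ℝ) ≤ m := Nat.cast_nonneg m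
    linarith).continuousAt

lemma Gamma_bound {l r : ℝ} (hl : 0 < l) : ∃ G : ℝ, 0 < G ∧ ∀ x ∈ Icc l r, Gamma x ≤ G := by
  obtain ⟨G, hG⟩ := isCompact_Icc.exists_bound_of_continuousOn (s := Icc l r) (f := Gamma)
    (fun x hx => (Gamma_contAt (show (0:ℝ) < x by linarith [hx.1])).continuousWithinAt)
  exact ⟨|G| + 1, by positivity, fun x hx =>
    ((le_abs_self _).trans ((hG x hx).trans (le_abs_self G))).trans (by linarith)⟩

lemma cnu_bound {d : ℕ} {a ν0 ν : ℝ} (ha : 0 < a) (hν : ν + a < (d:ℝ) / 2) :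
    ∃ G : ℝ, 0 < G ∧ ∀ x ∈ Icc ν0 ν, cnu d a x ≤ G := by
  have hc : ContinuousOn (fun x => cnu d a x) (Icc ν0 ν) := by
    unfold cnu
    intro x hx
    have h1 : ContinuousAt Gamma ((d:ℝ) / 2 - x) 
      := Gamma_contAt (show (0:ℝ) < d / 2 - x by linarith [hx.2])
    have h2 : ContinuousAt Gamma ((d:ℝ) / 2 - x - a) 
      := Gamma_contAt (show (0:ℝ) < d / 2 - x - a by linarith [hx.2])
    refine ContinuousAt.continuousWithinAt ?_
    refine ContinuousAt.div ?_ ?_ (Gamma_pos_of_pos (by linarith [hx.2])).ne'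
    · exact ContinuousAt.comp (f := fun x : ℝ => (d:ℝ) / 2 - x) h1 (by fun_prop)
    · exact ContinuousAt.comp (f := fun x : ℝ => (d:ℝ) / 2 - x - a) h2 (by fun_prop)
  obtain ⟨G, hG⟩ := isCompact_Icc.exists_bound_of_continuousOn hc
  exact ⟨|G| + 1, by positivity, fun x hx =>
    ((le_abs_self _).trans ((hG x hx).trans (le_abs_self G))).trans (by linarith)⟩

lemma rpow_half_sq {ρ : ℝ} (hρ : 0 < ρ) (e : ℝ) : (ρ ^ 2 / 4) ^ (-e) = 4 ^ e * ρ ^ (-(2 * e)) := by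
  rw [div_rpow (by positivity) (by norm_num), ← rpow_natCast, ← rpow_mul hρ.le,
    rpow_neg (by norm_num : (0:ℝ) ≤ 4), div_inv_eq_mul, mul_comm]
  congr 2; push_cast; ring

/-- `V ≥ c ρ^{-2 a}` for `ρ ≤ L`. -/
lemma Vr_lower {d : ℕ} {a ν L : ℝ} (ha : 0 < a) (hν : 0 < ν) (hνd : ν + a < (d:ℝ) / 2) :
    ∃ c : ℝ, 0 < c ∧ ∀ ρ, 0 < ρ → ρ ≤ L → c * ρ ^ (-(2 * a)) ≤ Vr d a ν ρ := by
  obtain ⟨c, hc, h⟩ := Jf_ge_L (ν + a) (L := L) (by linarith)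
  have hcn := cnu_pos ha hνd
  have hG := Gamma_pos_of_pos hν
  refine ⟨cnu d a ν * (c / (Gamma ν * 4 ^ ν)), by positivity, fun ρ hρ hL => ?_⟩
  have h1 := Jr_le hν hρ
  have h2 := h ρ hρ hL
  have hJ := Jr_pos hν hρ
  have hJa := Jr_pos (show 0 < ν + a by linarith) hρ
  rw [← ofReal_Jr (by linarith) hρ, ENNReal.ofReal_le_ofReal_iff hJa.le] at h2
  rw [rpow_half_sq hρ] at h1
  unfold Vr
  rw [mul_assoc]
  refine mul_le_mul_of_nonneg_left ?_ hcn.le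
  rw [le_div_iff₀ hJ]
  calc c / (Gamma ν * 4 ^ ν) * ρ ^ (-(2 * a)) * Jr ν ρ
      ≤ c / (Gamma ν * 4 ^ ν) * ρ ^ (-(2 * a)) * (Gamma ν * (4 ^ ν * ρ ^ (-(2 * ν)))) := by gcongr
    _ = c * (ρ ^ (-(2 * a)) * ρ ^ (-(2 * ν))) := by
        generalize Gamma ν = B at *; field_simp
    _ = c * ρ ^ (-(2 * (ν + a))) := by rw [← rpow_add hρ]; congr 2; ring
    _ ≤ _ := h2

/-- `V ≤ C (ρ^{-2 a} + 1)`. -/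
lemma Vr_upper {d : ℕ} {a ν : ℝ} (ha : 0 < a) (ha1 : a < 1) (hν : 0 < ν) (hνd : ν + a < (d:ℝ) / 2) :
    ∃ C : ℝ, 0 < C ∧ ∀ ρ, 0 < ρ → Vr d a ν ρ ≤ C * (ρ ^ (-(2 * a)) + 1) := by
  obtain ⟨c, hc, h⟩ := Jf_ge_L ν (L := 1) hν
  obtain ⟨C, hC, h'⟩ := Jr_shift ha ha1 one_pos hν.le
  have hcn := cnu_pos ha hνd
  have hG := Gamma_pos_of_pos (show 0 < ν + a by linarith)
  refine ⟨cnu d a ν * (Gamma (ν + a) * 4 ^ (ν + a) / c) + cnu d a ν * C, by positivity, fun ρ hρ => ?_⟩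
  have hJ := Jr_pos hν hρ
  have hJa := Jr_pos (show 0 < ν + a by linarith) hρ
  have hpp : 0 < ρ ^ (-(2 * a)) := by positivity
  rcases le_total ρ 1 with h1 | h1
  · have h2 := h ρ hρ h1
    rw [← ofReal_Jr (by linarith) hρ, ENNReal.ofReal_le_ofReal_iff hJ.le] at h2
    have h3 := Jr_le (show 0 < ν + a by linarith) hρ
    rw [rpow_half_sq hρ] at h3
    have h4 : Vr d a ν ρ ≤ cnu d a ν * (Gamma (ν + a) * 4 ^ (ν + a) / c) * ρ ^ (-(2 * a)) := by
      unfold Vr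
      rw [mul_assoc (cnu d a ν)]
      refine mul_le_mul_of_nonneg_left ?_ hcn.le
      rw [div_le_iff₀ hJ]
      calc Jr (ν + a) ρ ≤ Gamma (ν + a) * (4 ^ (ν + a) * ρ ^ (-(2 * (ν + a)))) := h3
        _ = Gamma (ν + a) * 4 ^ (ν + a) / c * ρ ^ (-(2 * a)) * (c * ρ ^ (-(2 * ν))) := by
            rw [show -(2 * (ν + a)) = -(2 * a) + -(2 * ν) by ring, rpow_add hρ]
            field_simp
        _ ≤ _ := by gcongr
    refine h4.trans ?_
    have h5 : 0 < cnu d a ν * C := by positivity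
    have h6 : 0 < cnu d a ν * (Gamma (ν + a) * 4 ^ (ν + a) / c) := by positivity
    nlinarith
  · have h2 := h' ν ρ hν le_rfl h1
    have h4 : Vr d a ν ρ ≤ cnu d a ν * C := by
      unfold Vr
      refine mul_le_mul_of_nonneg_left ?_ hcn.le
      rwa [div_le_iff₀ hJ]
    have h5 : 0 < cnu d a ν * C := by positivity
    have h6 : 0 < cnu d a ν * (Gamma (ν + a) * 4 ^ (ν + a) / c) := by positivity
    nlinarith

/-- Choice of the auxiliary exponents and comparison inequalities. -/
lemma exists_aux {d : ℕ} {a ν : ℝ} (ha : 0 < a) (ha1 : a < 1) (hν : 0 < ν)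
    (hνn : ν ≤ ((d:ℝ) / 2 - a) / 2) :
    ∃ ν' ν0 K C σ : ℝ, 0 < ν' ∧ ν' < ν0 ∧ ν0 < ν ∧ ν - ν' < a ∧ 0 < K ∧ 0 ≤ C ∧ 0 ≤ σ ∧ σ < 1 ∧
      (∀ ρ, 0 < ρ → cnu d a ν' * Jr (ν' + a) ρ ≤ (σ * Vr d a ν ρ + C) * Jr ν' ρ) ∧
      ∀ ν'', ν0 ≤ ν'' → ν'' < ν → ∃ θ, 0 ≤ θ ∧ θ < 1 ∧ ∀ ρ, 0 < ρ →
        cnu d a ν'' * Jr (ν'' + a) ρ + K * (cnu d a ν' * Jr (ν' + a) ρ) ≤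
          (θ * Vr d a ν ρ + C) * (Jr ν'' ρ + K * Jr ν' ρ) := by
  set n := (d:ℝ) / 2 - a with hn
  have hνd : ν + a < (d:ℝ) / 2 := by rw [hn] at hνn; linarith
  obtain ⟨κ, hκ0, hκa, hκν⟩ : ∃ κ, 0 < κ ∧ κ ≤ a / 4 ∧ κ ≤ ν / 4 :=
    ⟨min a ν / 4, by positivity, by gcongr; exact min_le_left _ _, by gcongr; exact min_le_right _ _⟩
  have hκ1 : κ ≤ 1 := by linarith
  set ν' := ν - κ with hν'
  set ν0 := ν - κ / 2 with hν0
  have hν'0 : 0 < ν' := by linarith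
  set D := Dn n a ν with hD
  set D0 := Dn n a ν0 with hD0
  set D' := Dn n a ν' with hD'
  have hD'p : 0 < D' := Dn_pos ha hν'0 (by linarith)
  have hDD0 : D' < D0 := Dn_strict ha hν'0 (by linarith) (by linarith)
  have hD0D : D0 < D := Dn_strict ha (by linarith) (by linarith) hνn
  obtain ⟨G1, hG1, hG1b⟩ := Gamma_bound (l := ν / 4) (r := ν) (by linarith)
  set A1 := Gamma (ν + a - κ) / Gamma (ν + a) with hA1
  have hA1p : 0 < A1 := div_pos (Gamma_pos_of_pos (by linarith)) (Gamma_pos_of_pos (by linarith))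
  set A2 := Gamma (ν' - κ) / Gamma ν' with hA2
  have hA2p : 0 < A2 := div_pos (Gamma_pos_of_pos (by linarith)) (Gamma_pos_of_pos (by linarith))
  have hG'p := Gamma_pos_of_pos hν'0
  obtain ⟨ε, hε⟩ : ∃ ε, ε = (D0 - D') / (4 * D0) := ⟨_, rfl⟩
  obtain ⟨K, hK⟩ : ∃ K, K = 2 * D0 * G1 * (1 + A1) / (Gamma ν' * (D0 - D')) := ⟨_, rfl⟩
  have hD0p : 0 < D0 := by linarith
  have hDp : 0 < D := by linarith
  have hdd : 0 < D0 - D' := by linarith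
  have hε0 : 0 < ε := by rw [hε]; positivity
  have hε1 : ε ≤ 1 / 4 := by rw [hε, div_le_iff₀ (by positivity)]; linarith
  have hK0 : 0 < K := by rw [hK]; positivity
  set w0 := (ε / (A1 + A2 + 1)) ^ (1 / κ) with hw0
  have hw0p : 0 < w0 := by positivity
  have hw01 : w0 ≤ 1 := by
    refine rpow_le_one (by positivity) ?_ (by positivity)
    rw [div_le_one (by positivity)]; linarith
  have hw0κ : w0 ^ κ = ε / (A1 + A2 + 1) := by
    rw [hw0, ← rpow_mul (by positivity), one_div_mul_cancel hκ0.ne', rpow_one]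
  set ρ0 := 2 * sqrt w0 with hρ0
  have hρ0p : 0 < ρ0 := by positivity
  obtain ⟨C1, hC1, hsh⟩ := Jr_shift ha ha1 hρ0p hν.le
  obtain ⟨C2, hC2, hcb⟩ := cnu_bound (ν0 := ν') ha hνd
  have hsmall : ∀ ρ, 0 < ρ → ρ < ρ0 → ρ ^ 2 / 4 ≤ 1 ∧ A1 * (ρ ^ 2 / 4) ^ κ ≤ ε ∧ A2 * (ρ ^ 2 / 4) ^ κ ≤ ε := by
    intro ρ h0 h1
    have h2 : ρ ^ 2 / 4 ≤ w0 := by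
      have h3 : ρ ^ 2 ≤ ρ0 ^ 2 := by gcongr
      rw [hρ0, mul_pow, sq_sqrt hw0p.le] at h3; linarith
    have h3 : (ρ ^ 2 / 4) ^ κ ≤ ε / (A1 + A2 + 1) := by
      rw [← hw0κ]; exact rpow_le_rpow (by positivity) h2 hκ0.le
    have h4 : (A1 + A2 + 1) * (ε / (A1 + A2 + 1)) = ε := by field_simp
    have h5 : 0 < ε / (A1 + A2 + 1) := by positivity
    refine ⟨h2.trans hw01, ?_, ?_⟩
    · calc _ ≤ A1 * (ε / (A1 + A2 + 1)) := by gcongr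
        _ ≤ (A1 + A2 + 1) * (ε / (A1 + A2 + 1)) := by gcongr; linarith
        _ = _ := h4
    · calc _ ≤ A2 * (ε / (A1 + A2 + 1)) := by gcongr
        _ ≤ (A1 + A2 + 1) * (ε / (A1 + A2 + 1)) := by gcongr; linarith
        _ = _ := h4
  have hL : ∀ μ ρ, 0 < μ → μ ≤ ν → 0 < ρ → cnu d a μ * Jr (μ + a) ρ ≤
      (ρ ^ 2 / 4) ^ (-a) * Dn n a μ * Gamma μ * (ρ ^ 2 / 4) ^ (-μ) := by
    intro μ ρ h0 h1 h2
    have hw : 0 < ρ ^ 2 / 4 := by positivity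
    calc _ ≤ cnu d a μ * (Gamma (μ + a) * (ρ ^ 2 / 4) ^ (-(μ + a))) := by
          have := cnu_pos (d := d) (ν := μ) ha (by linarith)
          gcongr; exact Jr_le (by linarith) h2
      _ = (cnu d a μ * Gamma (μ + a)) * ((ρ ^ 2 / 4) ^ (-a) * (ρ ^ 2 / 4) ^ (-μ)) := by
          rw [← rpow_add hw, show -a + -μ = -(μ + a) by ring]; ring
      _ = _ := by rw [cnu_Dn h0]; ring
  have hJ2' : ∀ ρ, 0 < ρ → Gamma ν' * (ρ ^ 2 / 4) ^ (-ν') * (1 - A2 * (ρ ^ 2 / 4) ^ κ) ≤ Jr ν' ρ := by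
    intro ρ h0
    have hw : 0 < ρ ^ 2 / 4 := by positivity
    have h1 := Jr_ge hκ0 hκ1 (show κ < ν' by linarith) h0
    rw [show κ - ν' = -ν' + κ by ring, rpow_add hw] at h1
    have h2 : Gamma ν' * A2 = Gamma (ν' - κ) := by rw [hA2]; field_simp
    rw [← h2] at h1
    linarith
  have hVp : ∀ ρ, 0 < ρ → 0 < Vr d a ν ρ := fun ρ h0 => Vr_pos ha hν hνd h0
  have hfar : ∀ μ ρ, ν' ≤ μ → μ ≤ ν → ρ0 ≤ ρ → cnu d a μ * Jr (μ + a) ρ ≤ C1 * C2 * Jr μ ρ := by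
    intro μ ρ h0 h1 h2
    have hρ : 0 < ρ := by linarith
    have h3 := hsh μ ρ (by linarith) h1 h2
    have h4 := hcb μ ⟨h0, h1⟩
    calc _ ≤ C2 * (C1 * Jr μ ρ) := mul_le_mul h4 h3 (Jr_pos (by linarith) hρ).le hC2.le
      _ = _ := by ring
  refine ⟨ν', ν0, K, C1 * C2, D0 / D, hν'0, by linarith, by linarith, by linarith, hK0, by positivity,
    by positivity, by rw [div_lt_one (by linarith)]; exact hD0D, fun ρ hρ => ?_, fun ν'' h1 h2 => ?_⟩
  · have hJp := Jr_pos hν'0 hρ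
    rw [add_mul]
    have hq0 : 0 ≤ D0 / D * Vr d a ν ρ * Jr ν' ρ := by have := hVp ρ hρ; positivity
    rcases lt_or_ge ρ ρ0 with hc | hc
    · obtain ⟨s1, s2, s3⟩ := hsmall ρ hρ hc
      have := near_alg2 (Wa := (ρ ^ 2 / 4) ^ (-a)) (by positivity) (by positivity) hD'p hDD0 hD0D hG'p s2 s3 hε
        (Vr_ge ha hν hνd hκ0 hκ1 (by linarith) hρ) hJp.le (hJ2' ρ hρ) (hL ν' ρ hν'0 (by linarith) hρ)
      have : 0 < C1 * C2 * Jr ν' ρ := by positivity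
      linarith
    · have := hfar ν' ρ le_rfl (by linarith) hc
      linarith
  · have hD'' : D0 ≤ Dn n a ν'' := by
      rcases h1.eq_or_lt with h | h
      · rw [hD0, h]
      · exact (Dn_strict ha (by linarith) h (by linarith)).le
    have hDD'' : Dn n a ν'' < D := Dn_strict ha (by linarith) h2 hνn
    have hDp'' : 0 < Dn n a ν'' := by linarith
    refine ⟨Dn n a ν'' / D, by positivity, by rw [div_lt_one (by linarith)]; exact hDD'', fun ρ hρ => ?_⟩
    have hJp := Jr_pos hν'0 hρ
    have hJp'' := Jr_pos (show 0 < ν'' by linarith) hρ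
    rw [add_mul]
    have hw : 0 < ρ ^ 2 / 4 := by positivity
    rcases lt_or_ge ρ ρ0 with hc | hc
    · obtain ⟨s1, s2, s3⟩ := hsmall ρ hρ hc
      have hep : (ρ ^ 2 / 4) ^ κ * (ρ ^ 2 / 4) ^ (-ν'') ≤ (ρ ^ 2 / 4) ^ (-ν') := by
        rw [← rpow_add hw]
        exact rpow_le_rpow_of_exponent_ge hw s1 (by linarith)
      have hJ1 : Gamma ν'' * (ρ ^ 2 / 4) ^ (-ν'') - G1 * (ρ ^ 2 / 4) ^ (-ν') ≤ Jr ν'' ρ := by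
        have h3 := Jr_ge hκ0 hκ1 (show κ < ν'' by linarith) hρ
        have h4 : Gamma (ν'' - κ) * (ρ ^ 2 / 4) ^ (κ - ν'') ≤ G1 * (ρ ^ 2 / 4) ^ (-ν') := by
          rw [show κ - ν'' = κ + -ν'' by ring, rpow_add hw]
          exact mul_le_mul (hG1b _ ⟨by linarith, by linarith⟩) hep (by positivity) hG1.le
        linarith
      have := near_alg (Wa := (ρ ^ 2 / 4) ^ (-a)) (by positivity) (by positivity) (by positivity)
        (by positivity) hep hD'p hDD0 hD'' hDD'' hG'p
        (Gamma_pos_of_pos (show 0 < ν'' by linarith)) (hG1b _ ⟨by linarith, by linarith⟩) hA1p hA2p s2 s3 hε hK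
        (Vr_ge ha hν hνd hκ0 hκ1 (by linarith) hρ) hJp''.le hJp.le hJ1 (hJ2' ρ hρ)
        (hL ν'' ρ (by linarith) h2.le hρ) (hL ν' ρ hν'0 (by linarith) hρ)
      have : 0 < C1 * C2 * (Jr ν'' ρ + K * Jr ν' ρ) := by positivity
      linarith
    · have e1 := hfar ν' ρ le_rfl (by linarith) hc
      have e2 := hfar ν'' ρ (by linarith) h2.le hc
      have e3 : K * (cnu d a ν' * Jr (ν' + a) ρ) ≤ K * (C1 * C2 * Jr ν' ρ) := by gcongr
      have : 0 ≤ Dn n a ν'' / D * Vr d a ν ρ * (Jr ν'' ρ + K * Jr ν' ρ) := by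
        have := hVp ρ hρ; positivity
      linarith

/-- The free kernel extended by zero to nonpositive times. -/
def ke {d : ℕ} (a : ℝ) (η : Measure ℝ) (t : ℝ) (x y : Ed d) : ENNReal :=
  if 0 < t then pe a η t x y else 0

def qe (d : ℕ) (a ν : ℝ) (z : Ed d) : ENNReal := ENNReal.ofReal (Vr d a ν ‖z‖)

/-- The perturbed kernel. -/
def pt {d : ℕ} (a ν : ℝ) (η : Measure ℝ) : ℝ → Ed d → Ed d → ENNReal := kT (ke a η) (qe d a ν)

structure Setup (d : ℕ) (a ν : ℝ) (η : Measure ℝ) : Prop where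
  hd : 0 < d
  h : IsSub a η
  ha : 0 < a
  ha1 : a < 1
  hν : 0 < ν
  hνn : ν ≤ ((d:ℝ) / 2 - a) / 2

lemma ke_pos {d : ℕ} {a : ℝ} {η : Measure ℝ} {t : ℝ} (ht : 0 < t) (x y : Ed d) :
    ke a η t x y = pe a η t x y := if_pos ht

lemma qe_meas (d : ℕ) (a ν : ℝ) : Measurable (qe d a ν) := by
  unfold qe Vr Jr
  have h1 := Jf_norm_meas (d := d) ν
  have h2 := Jf_norm_meas (d := d) (ν + a)
  exact ENNReal.measurable_ofReal.comp ((h2.ennreal_toReal.div h1.ennreal_toReal).const_mul _)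

namespace Setup
variable {d : ℕ} {a ν : ℝ} {η : Measure ℝ}

lemma hνd (S : Setup d a ν η) : ν + a < (d:ℝ) / 2 := by
  have := S.hν
  have := S.hνn
  linarith

lemma ker (S : Setup d a ν η) : IsKer (ke (d := d) a η) := by
  have := S.h.prob
  refine ⟨?_, fun t ht x y => if_neg (not_lt.2 ht)⟩
  unfold ke
  refine Measurable.ite (measurableSet_lt measurable_const measurable_fst) (pe_meas a η) measurable_const

lemma symm (_S : Setup d a ν η) (t : ℝ) (x y : Ed d) : ke a η t x y = ke a η t y x := by
  unfold ke; rw [pe_symm]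

lemma ck (S : Setup d a ν η) (t s : ℝ) (ht : 0 < t) (hs : 0 < s) (x y : Ed d) :
    ∫⁻ z, ke a η t x z * ke a η s z y = ke a η (t + s) x y := by
  rw [ke_pos (by linarith), ← pe_ck S.h S.ha ht hs]
  simp_rw [ke_pos ht, ke_pos hs]

lemma ptker (S : Setup d a ν η) : IsKer (pt (d := d) a ν η) := kT_ker S.ker (qe_meas d a ν)

lemma one_eq (S : Setup d a ν η) {t : ℝ} (ht : 0 < t) (x : Ed d) :
    Ap (ke a η) (fun _ => 1) t x = ENNReal.ofReal (exp (-t)) := by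
  rw [← pe_mass S.h S.ha ht x]
  unfold Ap
  simp_rw [ke_pos ht, mul_one]

lemma one_le (S : Setup d a ν η) (t : ℝ) (x : Ed d) : Ap (ke a η) (fun _ => 1) t x ≤ 1 := by
  by_cases ht : 0 < t
  · rw [S.one_eq ht]
    exact ENNReal.ofReal_le_one.2 (exp_le_one_iff.2 (by linarith))
  · rw [Ap_zero S.ker (not_lt.1 ht)]; exact zero_le_one

lemma ae_ne (S : Setup d a ν η) : ∀ᵐ z : Ed d, z ≠ 0 := by
  have : Nonempty (Fin d) := Fin.pos_iff_nonempty.1 S.hd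
  have : Nontrivial (Ed d) := by unfold Ed; infer_instance
  have h0 : (volume : Measure (Ed d)) {0} = 0 := measure_singleton (0 : Ed d)
  exact (measure_eq_zero_iff_ae_notMem.1 h0).mono fun z hz => by simpa using hz

lemma ApJ (S : Setup d a ν η) {t : ℝ} (ht : 0 < t) (μ : ℝ) (x : Ed d) :
    Ap (ke a η) (fun z => Jf μ ‖z‖) t x = ∫⁻ z, pe a η t x z * Jf μ ‖z‖ := by
  unfold Ap; simp_rw [ke_pos ht]

lemma bal (S : Setup d a ν η) {μ : ℝ} (hμ : μ + a < (d:ℝ) / 2) :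
    Bal (ke (d := d) a η) (fun z => Jf μ ‖z‖) (fun z => ENNReal.ofReal (cnu d a μ) * Jf (μ + a) ‖z‖) := by
  intro t ht x
  show _ = Jf μ ‖x‖
  rw [Ti_Ioo S.ker, S.ApJ ht, ← balanceJ S.h S.ha hμ ht x]
  congr 1
  refine setLIntegral_congr_fun measurableSet_Ioo fun s hs => ?_
  unfold Ap; simp_rw [ke_pos hs.1]

lemma gq (S : Setup d a ν η) : ∀ᵐ z : Ed d,
    ENNReal.ofReal (cnu d a ν) * Jf (ν + a) ‖z‖ = qe d a ν z * Jf ν ‖z‖ := by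
  filter_upwards [S.ae_ne] with z hz
  have hz' : 0 < ‖z‖ := norm_pos_iff.2 hz
  have h1 := S.hν
  have h2 := S.ha
  have hJ := Jr_pos S.hν hz'
  have hc := cnu_pos S.ha S.hνd
  rw [qe, ← ofReal_Jr h1 hz', ← ofReal_Jr (by linarith) hz', ← ENNReal.ofReal_mul hc.le,
    ← ENNReal.ofReal_mul (Vr_pos h2 h1 S.hνd hz').le, Vr]
  congr 1; field_simp

lemma cJ_meas (μ c : ℝ) : Measurable fun z : Ed d => ENNReal.ofReal c * Jf μ ‖z‖ :=
  (Jf_norm_meas μ).const_mul _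

lemma sup_Ap (S : Setup d a ν η) {t : ℝ} (ht : 0 < t) (x : Ed d) :
    Ap (pt a ν η) (fun z => Jf ν ‖z‖) t x ≤ Jf ν ‖x‖ :=
  (S.bal S.hνd).sup_Ap S.ker (qe_meas d a ν) (Jf_norm_meas ν) (cJ_meas _ _) S.gq ht x

lemma sup_Ti (S : Setup d a ν η) {t : ℝ} (ht : 0 < t) (x : Ed d) (N : ℕ) :
    Ti (kN (ke a η) (qe d a ν) N) (fun z => qe d a ν z * Jf ν ‖z‖) t x ≤ Jf ν ‖x‖ :=
  (S.bal S.hνd).sup_Ti S.ker (qe_meas d a ν) (Jf_norm_meas ν) (cJ_meas _ _) S.gq ht x N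

/-- Upper bound for the mass of the perturbed kernel. -/
lemma U1 (S : Setup d a ν η) {T : ℝ} (hT : 0 < T) : ∃ C : ℝ, 0 < C ∧ ∀ s t : ℝ, 0 < s → s ≤ t → t ≤ T →
    ∀ x : Ed d, Ap (pt a ν η) (fun _ => 1) s x ≤
      ENNReal.ofReal C * (1 + ENNReal.ofReal (t ^ (ν / a)) * Jf ν ‖x‖) := by
  obtain ⟨c, hc, h7⟩ := PtJ_ge S.h S.ha S.hνd hT
  obtain ⟨C, hC, hV⟩ := Vr_upper S.ha S.ha1 S.hν S.hνd
  have ha := S.ha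
  refine ⟨exp (C * (1 + T)) * (1 + 1 / c), by positivity, fun s t hs hst htT x => ?_⟩
  have ht : 0 < t := by linarith
  have hb := Ap_one_bound S.ker (qe_meas d a ν) (B := {z : Ed d | ‖z‖ ≤ t ^ (1 / (2 * a))})
    (Jf_norm_meas ν) (m := ENNReal.ofReal (t ^ (ν / a) / c)) (Q := C * (1 / t + 1)) (by positivity) (t := t)
    (fun z hz u hu hut => by
      rw [S.ApJ hu]
      calc (1:ENNReal) = ENNReal.ofReal (t ^ (ν / a) / c) * ENNReal.ofReal (c * t ^ (-(ν / a))) := by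
            rw [← ENNReal.ofReal_mul (by positivity), rpow_neg ht.le]
            rw [← ENNReal.ofReal_one]; congr 1; field_simp
        _ ≤ _ := mul_le_mul_right (h7 t u hu hut htT z hz) _)
    (fun z hz => by
      have hz1 : t ^ (1 / (2 * a)) < ‖z‖ := not_le.1 hz
      have hz0 : 0 < ‖z‖ := lt_trans (by positivity) hz1
      refine ENNReal.ofReal_le_ofReal ((hV _ hz0).trans ?_)
      gcongr
      have h1 : t = (t ^ (1 / (2 * a))) ^ (2 * a) := by
        rw [← rpow_mul ht.le, one_div_mul_cancel (by positivity), rpow_one]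
      rw [rpow_neg hz0.le, one_div]
      refine inv_anti₀ ht ?_
      nth_rewrite 1 [h1]
      exact rpow_le_rpow (by positivity) hz1.le (by positivity))
    S.one_le x (fun s hs => S.sup_Ap hs x) hs hst
  have he : exp (C * (1 / t + 1) * s) ≤ exp (C * (1 + T)) := by
    refine exp_le_exp.2 ?_
    have h1 : 1 / t * s ≤ 1 := by rw [one_div_mul_eq_div, div_le_one ht]; exact hst
    rw [mul_assoc]; gcongr; nlinarith
  calc _ ≤ _ := hb
    _ ≤ (1 + ENNReal.ofReal (t ^ (ν / a) / c) * Jf ν ‖x‖) * ENNReal.ofReal (exp (C * (1 + T))) := by gcongr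
    _ ≤ (ENNReal.ofReal (1 + 1 / c) * (1 + ENNReal.ofReal (t ^ (ν / a)) * Jf ν ‖x‖)) *
        ENNReal.ofReal (exp (C * (1 + T))) := by
        gcongr
        rw [mul_add, mul_one, ← mul_assoc, ← ENNReal.ofReal_mul (by positivity)]
        gcongr
        · rw [← ENNReal.ofReal_one]; refine ENNReal.ofReal_le_ofReal ?_
          have : 0 < 1 / c := by positivity
          linarith
        · rw [div_eq_mul_one_div, mul_comm]
          gcongr; linarith
    _ = _ := by rw [ENNReal.ofReal_mul (by positivity)]; ring

lemma pt_ne_top (S : Setup d a ν η) {t : ℝ} (ht : 0 < t) {x y : Ed d} (hx : x ≠ 0) (hy : y ≠ 0) :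
    pt a ν η t x y ≠ ⊤ := by
  obtain ⟨CU, hCU, hU⟩ := S.U1 ht
  obtain ⟨C, hC, hV⟩ := Vr_upper S.ha S.ha1 S.hν S.hνd
  obtain ⟨C2, hC2, h2⟩ := pe_le_diag S.hd S.h S.ha
  have ha := S.ha
  have hy0 : 0 < ‖y‖ := norm_pos_iff.2 hy
  have hx0 : 0 < ‖x‖ := norm_pos_iff.2 hx
  set Cy := C * ((‖y‖ / 2) ^ (-(2 * a)) + 1) with hCy
  have hCy0 : 0 < Cy := by positivity
  set τ := 1 / (2 * Cy) with hτ
  have hτ0 : 0 < τ := by positivity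
  set D0 := C2 * τ ^ (-(d:ℝ) / (2 * a)) + (1 + d.factorial) * (‖y‖ / 2) ^ (-(d:ℝ)) with hD0
  have hD0p : 0 < D0 := by positivity
  have hb := kT_bound S.ker (qe_meas d a ν) S.ck (t := t) (τ := τ) (C := ENNReal.ofReal Cy)
    (D := ENNReal.ofReal (D0 * exp t)) (by
      rw [← ENNReal.ofReal_mul hτ0.le, show τ * Cy = 1 / 2 by rw [hτ]; field_simp]
      rw [ENNReal.ofReal_div_of_pos two_pos]; simp) y (fun z u hu hut => by
      rw [S.one_eq hu, ke_pos hu]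
      have hpe : pe a η u z y ≤ ENNReal.ofReal D0 → pe a η u z y ≤
          ENNReal.ofReal (D0 * exp t) * ENNReal.ofReal (exp (-u)) := fun hh => by
        refine hh.trans ?_
        rw [← ENNReal.ofReal_mul (by positivity), mul_assoc, ← exp_add]
        refine ENNReal.ofReal_le_ofReal ?_
        have : 1 ≤ exp (t + -u) := one_le_exp (by linarith)
        nlinarith
      rcases lt_or_ge u τ with h1 | h1
      · rcases lt_or_ge ‖y - z‖ (‖y‖ / 2) with h3 | h3
        · left
          refine ⟨?_, h1⟩
          have h4 : ‖y‖ / 2 ≤ ‖z‖ := by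
            have h5 := norm_sub_norm_le y z
            linarith
          have hz0 : 0 < ‖z‖ := by linarith
          refine ENNReal.ofReal_le_ofReal ((hV _ hz0).trans ?_)
          rw [hCy]
          gcongr ?_ * (?_ + _)
          exact rpow_le_rpow_of_nonpos (by positivity) h4 (by linarith)
        · right
          refine hpe ((pe_le_off S.h hu z y ?_).trans (ENNReal.ofReal_le_ofReal ?_))
          · rintro rfl; simp at h3; linarith
          · have h5 : ‖y - z‖ ^ (-(d:ℝ)) ≤ (‖y‖ / 2) ^ (-(d:ℝ)) :=
              rpow_le_rpow_of_nonpos (by positivity) h3 (by simp)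
            have h6 : 0 < C2 * τ ^ (-(d:ℝ) / (2 * a)) := by positivity
            have h7 : (1 + (d.factorial:ℝ)) * ‖y - z‖ ^ (-(d:ℝ)) ≤
              (1 + d.factorial) * (‖y‖ / 2) ^ (-(d:ℝ)) := by gcongr
            rw [hD0]; linarith
      · right
        refine hpe ((h2 u hu z y).trans (ENNReal.ofReal_le_ofReal ?_))
        have h5 : u ^ (-(d:ℝ) / (2 * a)) ≤ τ ^ (-(d:ℝ) / (2 * a)) :=
          rpow_le_rpow_of_nonpos hτ0 h1 (by
            apply div_nonpos_of_nonpos_of_nonneg <;> simp [ha.le])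
        have h6 : 0 < (1 + (d.factorial:ℝ)) * (‖y‖ / 2) ^ (-(d:ℝ)) := by positivity
        have h7 : C2 * u ^ (-(d:ℝ) / (2 * a)) ≤ C2 * τ ^ (-(d:ℝ) / (2 * a)) := by gcongr
        rw [hD0]; linarith) x
  refine ne_top_of_le_ne_top ?_ hb
  refine ENNReal.mul_ne_top (by simp) (ENNReal.add_ne_top.2 ⟨?_, ENNReal.mul_ne_top ENNReal.ofReal_ne_top ?_⟩)
  · rw [ke_pos ht]; exact pe_ne_top S.hd S.h S.ha ht x y
  · refine ne_top_of_le_ne_top ?_ (hU t t ht le_rfl le_rfl x)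
    exact ENNReal.mul_ne_top ENNReal.ofReal_ne_top (ENNReal.add_ne_top.2 ⟨by simp,
      ENNReal.mul_ne_top ENNReal.ofReal_ne_top (Jf_ne_top S.hν hx0)⟩)

end Setup

lemma absorb {X A : ENNReal} (hX : X ≠ ⊤) (h : X ≤ A + X / 2) : X ≤ 2 * A := by
  have h1 : X / 2 ≤ A := by
    have h2 : X / 2 + X / 2 ≤ A + X / 2 := by rwa [ENNReal.add_halves]
    exact (ENNReal.add_le_add_iff_right (ENNReal.div_ne_top hX (by simp))).1 h2
  calc X = X / 2 + X / 2 := (ENNReal.add_halves X).symm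
    _ ≤ A + A := add_le_add h1 h1
    _ = _ := (two_mul A).symm

lemma Ti_le_of {E : Type*} [MeasureSpace E] [SFinite (volume : Measure E)] {A : ℝ → E → E → ENNReal}
    (hA : IsKer A) {f : E → ENNReal} {t : ℝ} {x : E} {B : ENNReal}
    (h : ∀ s, 0 < s → s ≤ t → Ap A f s x ≤ B) : Ti A f t x ≤ ENNReal.ofReal t * B := by
  rw [Ti_Ioo hA]
  calc _ ≤ ∫⁻ s in Ioo 0 t, B := setLIntegral_mono' measurableSet_Ioo fun s hs => h s hs.1 hs.2.le
    _ = _ := by rw [setLIntegral_const, Real.volume_Ioo, sub_zero, mul_comm]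

lemma le_Ti_of {E : Type*} [MeasureSpace E] [SFinite (volume : Measure E)] {A : ℝ → E → E → ENNReal}
    (hA : IsKer A) {f : E → ENNReal} {t : ℝ} {x : E} {B : ENNReal}
    (h : ∀ s, 0 < s → s ≤ t → B ≤ Ap A f s x) : ENNReal.ofReal t * B ≤ Ti A f t x := by
  rw [Ti_Ioo hA]
  calc _ = ∫⁻ s in Ioo 0 t, B := by rw [setLIntegral_const, Real.volume_Ioo, sub_zero, mul_comm]
    _ ≤ _ := setLIntegral_mono' measurableSet_Ioo fun s hs => h s hs.1 hs.2.le

/-- Lower semicontinuity of `Jf` in the index. -/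
lemma Jf_lsc {ν0 ν ρ : ℝ} {M : ENNReal} (h0 : ν0 < ν)
    (h : ∀ ν'', ν0 ≤ ν'' → ν'' < ν → Jf ν'' ρ ≤ M) : Jf ν ρ ≤ M := by
  set v : ℕ → ℝ := fun k => ν - (ν - ν0) / (k + 1) with hv
  have hvl : Tendsto v atTop (nhds ν) := by
    have h1 : Tendsto (fun k : ℕ => (ν - ν0) * (1 / ((k:ℝ) + 1))) atTop (nhds ((ν - ν0) * 0)) :=
      tendsto_one_div_add_atTop_nhds_zero_nat.const_mul _
    have h2 := h1.const_sub ν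
    simp only [mul_zero, sub_zero] at h2
    refine h2.congr fun k => ?_
    rw [hv]; simp only; ring
  have hb : ∀ k, Jf (v k) ρ ≤ M := by
    intro k
    have h1 : 0 < (ν - ν0) / ((k:ℝ) + 1) := div_pos (by linarith) (by positivity)
    have h2 : (ν - ν0) / ((k:ℝ) + 1) ≤ ν - ν0 := div_le_self (by linarith) (by
      have : (0:ℝ) ≤ k := Nat.cast_nonneg k
      linarith)
    exact h _ (by rw [hv]; simp only; linarith) (by rw [hv]; simp only; linarith)
  calc Jf ν ρ = ∫⁻ u in Ioi (0:ℝ), liminf (fun k => ENNReal.ofReal (u ^ (-(v k) - 1) * exp (-u - ρ ^ 2 / (4 * u)))) atTop := by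
        unfold Jf
        refine setLIntegral_congr_fun measurableSet_Ioi fun u (hu : 0 < u) => ?_
        refine (Tendsto.liminf_eq ?_).symm
        refine ENNReal.tendsto_ofReal (Tendsto.mul_const _ ?_)
        exact ((continuous_const_rpow hu.ne').tendsto _).comp (hvl.neg.sub_const 1)
    _ ≤ liminf (fun k => ∫⁻ u in Ioi (0:ℝ), ENNReal.ofReal (u ^ (-(v k) - 1) * exp (-u - ρ ^ 2 / (4 * u)))) atTop :=
        lintegral_liminf_le fun k => by fun_prop
    _ ≤ liminf (fun _ : ℕ => M) atTop := liminf_le_liminf (Eventually.of_forall hb)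
    _ = M := by simp

namespace Setup
variable {d : ℕ} {a ν : ℝ} {η : Measure ℝ}

/-- `1 ≤ C t^{ν/a} h(x)` for `|x| ≤ t^{1/(2 a)}`, `t ≤ 1`. -/
lemma near_one (S : Setup d a ν η) : ∃ C : ℝ, 0 < C ∧ ∀ t ρ : ℝ, 0 < t → t ≤ 1 → 0 < ρ →
    ρ ≤ t ^ (1 / (2 * a)) → 1 ≤ ENNReal.ofReal C * ENNReal.ofReal (t ^ (ν / a)) * Jf ν ρ := by
  obtain ⟨c, hc, h⟩ := Jf_ge_L ν (L := 1) S.hν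
  have ha := S.ha
  have hν := S.hν
  refine ⟨1 / c, by positivity, fun t ρ ht ht1 hρ hρt => ?_⟩
  have h1 : t ^ (1 / (2 * a)) ≤ 1 := rpow_le_one ht.le ht1 (by positivity)
  have h2 := h ρ hρ (hρt.trans h1)
  have h3 : (t ^ (1 / (2 * a))) ^ (-(2 * ν)) ≤ ρ ^ (-(2 * ν)) := rpow_le_rpow_of_nonpos hρ hρt (by linarith)
  have h4 : (t ^ (1 / (2 * a))) ^ (-(2 * ν)) = (t ^ (ν / a))⁻¹ := by
    rw [← rpow_mul ht.le, ← rpow_neg ht.le]; congr 1; field_simp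
  rw [h4] at h3
  calc (1 : ENNReal) = ENNReal.ofReal (1 / c) * ENNReal.ofReal (t ^ (ν / a)) * ENNReal.ofReal (c * (t ^ (ν / a))⁻¹) := by
        rw [← ENNReal.ofReal_mul (by positivity), ← ENNReal.ofReal_mul (by positivity), ← ENNReal.ofReal_one]
        congr 1; field_simp
    _ ≤ ENNReal.ofReal (1 / c) * ENNReal.ofReal (t ^ (ν / a)) * Jf ν ρ := by
        gcongr
        refine le_trans (ENNReal.ofReal_le_ofReal ?_) h2
        gcongr

/-- Mass bound near the origin. -/
lemma U1n (S : Setup d a ν η) : ∃ C : ℝ, 0 < C ∧ ∀ s t : ℝ, 0 < s → s ≤ t → t ≤ 1 →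
    ∀ x : Ed d, x ≠ 0 → ‖x‖ ≤ t ^ (1 / (2 * a)) → Ap (pt a ν η) (fun _ => 1) s x ≤
      ENNReal.ofReal C * (ENNReal.ofReal (t ^ (ν / a)) * Jf ν ‖x‖) := by
  obtain ⟨C1, hC1, h1⟩ := S.near_one
  obtain ⟨C2, hC2, h2⟩ := S.U1 one_pos
  refine ⟨C2 * (C1 + 1), by positivity, fun s t hs hst ht1 x hx hxR => ?_⟩
  have h3 := h1 t ‖x‖ (by linarith) ht1 (norm_pos_iff.2 hx) hxR
  refine (h2 s t hs hst ht1 x).trans ?_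
  rw [ENNReal.ofReal_mul hC2.le, mul_assoc]
  refine mul_le_mul_right ?_ _
  rw [ENNReal.ofReal_add hC1.le zero_le_one, add_mul, ENNReal.ofReal_one, one_mul, ← mul_assoc]
  gcongr

/-- The potential is dominated by `1 + q h`. -/
lemma q_le (S : Setup d a ν η) : ∃ C : ENNReal, C ≠ ⊤ ∧ ∀ z : Ed d, z ≠ 0 →
    qe d a ν z ≤ C * (1 + qe d a ν z * Jf ν ‖z‖) := by
  obtain ⟨C, hC, hV⟩ := Vr_upper S.ha S.ha1 S.hν S.hνd
  obtain ⟨C1, hC1, h1⟩ := S.near_one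
  have ha := S.ha
  refine ⟨ENNReal.ofReal (2 * C) + ENNReal.ofReal C1, ENNReal.add_ne_top.2 ⟨ENNReal.ofReal_ne_top, ENNReal.ofReal_ne_top⟩, fun z hz => ?_⟩
  have hz0 : 0 < ‖z‖ := norm_pos_iff.2 hz
  rcases le_total ‖z‖ 1 with h | h
  · have h2 := h1 1 ‖z‖ one_pos le_rfl hz0 (by simpa using h)
    simp only [one_rpow, ENNReal.ofReal_one, mul_one] at h2
    calc qe d a ν z = qe d a ν z * 1 := (mul_one _).symm
      _ ≤ qe d a ν z * (ENNReal.ofReal C1 * Jf ν ‖z‖) := by gcongr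
      _ = ENNReal.ofReal C1 * (qe d a ν z * Jf ν ‖z‖) := by ring
      _ ≤ _ := mul_le_mul' le_add_self le_add_self
  · calc qe d a ν z ≤ ENNReal.ofReal (2 * C) * 1 := by
          rw [mul_one]
          refine ENNReal.ofReal_le_ofReal ((hV _ hz0).trans ?_)
          have h2 : ‖z‖ ^ (-(2 * a)) ≤ 1 := rpow_le_one_of_one_le_of_nonpos h (by linarith)
          nlinarith
      _ ≤ _ := mul_le_mul' le_self_add le_self_add

/-- Finiteness of geometric series. -/
lemma fin_geo (S : Setup d a ν η) {f : Ed d → ENNReal} {M : ENNReal} (hM : M ≠ ⊤)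
    (hf : ∀ z, f z ≤ M * (Jf ν ‖z‖ + 1)) {t : ℝ} (ht : 0 < t) {x : Ed d} (hx : x ≠ 0) {θ : ENNReal} (hθ : θ < 1) :
    ∑' n, θ ^ n * Ti (kN (ke a η) (qe d a ν) n) (fun z => qe d a ν z * f z) t x ≠ ⊤ := by
  obtain ⟨C, hC, hq⟩ := S.q_le
  obtain ⟨CU, hCU, hU⟩ := S.U1 ht
  have hqm := qe_meas d a ν
  have hx0 : 0 < ‖x‖ := norm_pos_iff.2 hx
  have hqh : Measurable fun z : Ed d => qe d a ν z * Jf ν ‖z‖ := hqm.mul (Jf_norm_meas ν)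
  have hT1 : Ti (pt a ν η) (fun _ => 1) t x ≠ ⊤ := by
    refine ne_top_of_le_ne_top ?_ (Ti_le_of S.ptker (B := ENNReal.ofReal CU *
      (1 + ENNReal.ofReal (t ^ (ν / a)) * Jf ν ‖x‖)) fun s hs hst => hU s t hs hst le_rfl x)
    exact ENNReal.mul_ne_top (by simp) (ENNReal.mul_ne_top ENNReal.ofReal_ne_top (ENNReal.add_ne_top.2 ⟨by simp,
      ENNReal.mul_ne_top ENNReal.ofReal_ne_top (Jf_ne_top S.hν hx0)⟩))
  set B := M * (1 + C) * (Ti (pt a ν η) (fun _ => 1) t x + Jf ν ‖x‖) with hB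
  have hBt : B ≠ ⊤ := ENNReal.mul_ne_top (ENNReal.mul_ne_top hM (by simp [hC]))
    (ENNReal.add_ne_top.2 ⟨hT1, Jf_ne_top S.hν hx0⟩)
  have hn : ∀ n, Ti (kN (ke a η) (qe d a ν) n) (fun z => qe d a ν z * f z) t x ≤ B := by
    intro n
    have hk := kN_ker S.ker hqm n
    have h1 : Ti (kN (ke a η) (qe d a ν) n) (fun z => qe d a ν z * f z) t x ≤
        Ti (kN (ke a η) (qe d a ν) n) (fun z => M * (1 + C) * (1 + qe d a ν z * Jf ν ‖z‖)) t x := by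
      refine Ti_mono ?_ _ _
      filter_upwards [S.ae_ne] with z hz
      calc qe d a ν z * f z ≤ qe d a ν z * (M * (Jf ν ‖z‖ + 1)) := by gcongr; exact hf z
        _ = M * (qe d a ν z * Jf ν ‖z‖ + qe d a ν z) := by ring
        _ ≤ M * ((1 + qe d a ν z * Jf ν ‖z‖) + C * (1 + qe d a ν z * Jf ν ‖z‖)) := by
            gcongr
            · exact le_add_self
            · exact hq z hz
        _ = _ := by ring
    refine h1.trans ?_
    have hm1 : Measurable fun z : Ed d => 1 + qe d a ν z * Jf ν ‖z‖ := measurable_const.add hqh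
    rw [Ti_smul hk hm1, Ti_add hk measurable_const]
    rw [hB]
    gcongr
    · exact Ti_mono_ker (fun s z y => ENNReal.le_tsum (f := fun n => kN (ke a η) (qe d a ν) n s z y) n) _ _ _
    · exact S.sup_Ti ht x n
  refine ne_top_of_le_ne_top ?_ (ENNReal.tsum_le_tsum fun n => mul_le_mul_right (hn n) (θ ^ n))
  rw [ENNReal.tsum_mul_right, ENNReal.tsum_geometric]
  refine ENNReal.mul_ne_top (ENNReal.inv_ne_top.2 ?_) hBt
  exact (tsub_pos_of_lt hθ).ne'

end Setup

namespace Setup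
variable {d : ℕ} {a ν : ℝ} {η : Measure ℝ}

lemma Ti_h (S : Setup d a ν η) {s : ℝ} (x : Ed d) :
    Ti (pt a ν η) (fun z => Jf ν ‖z‖) s x ≤ ENNReal.ofReal s * Jf ν ‖x‖ :=
  Ti_le_of S.ptker fun r hr _ => S.sup_Ap hr x

lemma bal2 (S : Setup d a ν η) {μ μ' : ℝ} (hμ : μ + a < (d:ℝ) / 2) (hμ' : μ' + a < (d:ℝ) / 2) (K : ENNReal) :
    Bal (ke (d := d) a η) (fun z => Jf μ ‖z‖ + K * Jf μ' ‖z‖)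
      (fun z => ENNReal.ofReal (cnu d a μ) * Jf (μ + a) ‖z‖ +
        K * (ENNReal.ofReal (cnu d a μ') * Jf (μ' + a) ‖z‖)) := by
  intro t ht x
  have h1 := S.bal hμ t ht x
  have h2 := S.bal hμ' t ht x
  show _ = Jf μ ‖x‖ + K * Jf μ' ‖x‖
  have m1 : Measurable fun z : Ed d => Jf μ ‖z‖ := Jf_norm_meas μ
  have m2 : Measurable fun z : Ed d => Jf μ' ‖z‖ := Jf_norm_meas μ'
  have m3 : Measurable fun z : Ed d => ENNReal.ofReal (cnu d a μ) * Jf (μ + a) ‖z‖ :=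
    (Jf_norm_meas (μ + a)).const_mul _
  have m4 : Measurable fun z : Ed d => ENNReal.ofReal (cnu d a μ') * Jf (μ' + a) ‖z‖ :=
    (Jf_norm_meas (μ' + a)).const_mul _
  rw [Ap_add S.ker m1, Ap_smul S.ker m2, Ti_add S.ker m3, Ti_smul S.ker m4]
  simp only at h1 h2
  rw [← h1, ← h2]
  ring

lemma K1pre (S : Setup d a ν η) : ∃ C : ℝ, 0 < C ∧ ∀ s t : ℝ, 0 < s → s ≤ t → t ≤ 1 →
    ∀ x : Ed d, x ≠ 0 → ‖x‖ ≤ t ^ (1 / (2 * a)) → Jf ν ‖x‖ ≤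
      ENNReal.ofReal C * (Ap (pt a ν η) (fun z => Jf ν ‖z‖) s x +
        (ENNReal.ofReal (t ^ (ν / a)) + ENNReal.ofReal t) * Jf ν ‖x‖) := by
  obtain ⟨ν', ν0, K, C, σ, hν'0, hν'ν0, hν0ν, hκ, hK, hC, hσ0, hσ1, -, hmain⟩ := exists_aux S.ha S.ha1 S.hν S.hνn
  obtain ⟨CU, hCU, hU⟩ := S.U1n
  have ha := S.ha
  have hνd := S.hνd
  refine ⟨(1 + K) * (1 + CU) * (1 + C), by positivity, fun s t hs hst ht1 x hx hxR => ?_⟩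
  have ht0 : 0 < t := by linarith
  have hx0 : 0 < ‖x‖ := norm_pos_iff.2 hx
  have hA1 := hU s t hs hst ht1 x hx hxR
  have hT1 : Ti (pt a ν η) (fun _ => 1) s x ≤ ENNReal.ofReal CU * (ENNReal.ofReal (t ^ (ν / a)) * Jf ν ‖x‖) := by
    refine (Ti_le_of S.ptker fun r hr hrs => hU r t hr (hrs.trans hst) ht1 x hx hxR).trans ?_
    refine (mul_le_mul_left (ENNReal.ofReal_le_one.2 (hst.trans ht1)) _).trans ?_
    rw [one_mul]
  have hTh : Ti (pt a ν η) (fun z => Jf ν ‖z‖) s x ≤ ENNReal.ofReal t * Jf ν ‖x‖ :=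
    S.Ti_h x |>.trans (mul_le_mul_left (ENNReal.ofReal_le_ofReal hst) _)
  refine Jf_lsc hν0ν fun ν'' h1 h2 => ?_
  obtain ⟨θ, hθ0, hθ1, hθ⟩ := hmain ν'' h1 h2
  have hν''0 : 0 < ν'' := by linarith
  have hb := S.bal2 (μ := ν'') (μ' := ν') (by linarith) (by linarith) (ENNReal.ofReal K)
  have mh : Measurable fun z : Ed d => Jf ν ‖z‖ := Jf_norm_meas ν
  have m1 : Measurable fun z : Ed d => Jf ν'' ‖z‖ + ENNReal.ofReal K * Jf ν' ‖z‖ :=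
    (Jf_norm_meas ν'').add ((Jf_norm_meas ν').const_mul _)
  have m2 : Measurable fun z : Ed d => ENNReal.ofReal (cnu d a ν'') * Jf (ν'' + a) ‖z‖ +
        ENNReal.ofReal K * (ENNReal.ofReal (cnu d a ν') * Jf (ν' + a) ‖z‖) :=
    ((Jf_norm_meas _).const_mul _).add (((Jf_norm_meas _).const_mul _).const_mul _)
  have hub : ∀ z : Ed d, Jf ν'' ‖z‖ + ENNReal.ofReal K * Jf ν' ‖z‖ ≤ ENNReal.ofReal (1 + K) * (Jf ν ‖z‖ + 1) := by
    intro z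
    rw [ENNReal.ofReal_add zero_le_one hK.le, ENNReal.ofReal_one, add_mul, one_mul]
    gcongr
    · exact Jf_le_add_one hν''0 h2.le _
    · exact Jf_le_add_one hν'0 (by linarith) _
  have hfin := S.fin_geo (M := ENNReal.ofReal (1 + K)) ENNReal.ofReal_ne_top hub hs hx
    (θ := ENNReal.ofReal θ) (by rw [← ENNReal.ofReal_one]; exact (ENNReal.ofReal_lt_ofReal_iff one_pos).2 hθ1)
  have hlow := hb.lower S.ker (qe_meas d a ν) m1 m2 (θ := ENNReal.ofReal θ) (C := ENNReal.ofReal C)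
    (ENNReal.ofReal_le_one.2 hθ1.le) (by
      filter_upwards [S.ae_ne] with z hz
      have hz0 : 0 < ‖z‖ := norm_pos_iff.2 hz
      have h3 := ENNReal.ofReal_le_ofReal (hθ _ hz0)
      have hc1 : 0 ≤ cnu d a ν'' := (cnu_pos ha (by linarith)).le
      have hc2 : 0 ≤ cnu d a ν' := (cnu_pos ha (by linarith)).le
      have j1 : 0 ≤ Jr (ν'' + a) ‖z‖ := (Jr_pos (by linarith) hz0).le
      have j2 : 0 ≤ Jr (ν' + a) ‖z‖ := (Jr_pos (by linarith) hz0).le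
      have j3 : 0 ≤ Jr ν'' ‖z‖ := (Jr_pos (by linarith) hz0).le
      have j4 : 0 ≤ Jr ν' ‖z‖ := (Jr_pos (by linarith) hz0).le
      have j5 : 0 ≤ Vr d a ν ‖z‖ := (Vr_pos ha S.hν hνd hz0).le
      rw [ENNReal.ofReal_add (by positivity) (by positivity), ENNReal.ofReal_mul hc1, ENNReal.ofReal_mul hK.le,
        ENNReal.ofReal_mul hc2, ENNReal.ofReal_mul (by positivity), ENNReal.ofReal_add (by positivity) hC,
        ENNReal.ofReal_mul hθ0, ENNReal.ofReal_add j3 (by positivity), ENNReal.ofReal_mul hK.le,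
        ofReal_Jr (by linarith) hz0, ofReal_Jr (by linarith) hz0, ofReal_Jr (by linarith) hz0,
        ofReal_Jr (by linarith) hz0] at h3
      exact h3) hs x hfin
  have hm1 : Measurable fun z : Ed d => Jf ν ‖z‖ + 1 := mh.add_const _
  have hAu : Ap (pt a ν η) (fun z => Jf ν'' ‖z‖ + ENNReal.ofReal K * Jf ν' ‖z‖) s x ≤
      ENNReal.ofReal (1 + K) * (Ap (pt a ν η) (fun z => Jf ν ‖z‖) s x + Ap (pt a ν η) (fun _ => 1) s x) := by
    refine (Ap_mono (Eventually.of_forall hub) s x).trans (le_of_eq ?_)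
    rw [Ap_smul S.ptker hm1, Ap_add S.ptker mh]
  have hTu : Ti (pt a ν η) (fun z => Jf ν'' ‖z‖ + ENNReal.ofReal K * Jf ν' ‖z‖) s x ≤
      ENNReal.ofReal (1 + K) * (Ti (pt a ν η) (fun z => Jf ν ‖z‖) s x + Ti (pt a ν η) (fun _ => 1) s x) := by
    refine (Ti_mono (Eventually.of_forall hub) s x).trans (le_of_eq ?_)
    rw [Ti_smul S.ptker hm1, Ti_add S.ptker mh]
  have h4 : Jf ν'' ‖x‖ ≤ _ := le_self_add.trans hlow
  refine h4.trans ((add_le_add (hAu.trans (mul_le_mul_right (add_le_add_right hA1 _) _))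
    (mul_le_mul_right (hTu.trans (mul_le_mul_right (add_le_add hTh hT1) _)) _)).trans ?_)
  rw [ENNReal.ofReal_mul (by positivity), ENNReal.ofReal_mul (by positivity), ENNReal.ofReal_add zero_le_one hC,
    ENNReal.ofReal_add zero_le_one hCU.le, ENNReal.ofReal_one]
  generalize ENNReal.ofReal (1 + K) = k
  generalize ENNReal.ofReal CU = u
  generalize ENNReal.ofReal C = c
  generalize ENNReal.ofReal (t ^ (ν / a)) = e
  generalize Jf ν ‖x‖ = X
  generalize ENNReal.ofReal t = τ
  generalize Ap (pt a ν η) (fun z => Jf ν ‖z‖) s x = A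
  have e1 : k * (1 + u) * (1 + c) * (A + (e + τ) * X) =
    (k * (A + u * (e * X)) + c * (k * (τ * X + u * (e * X)))) + k * (e * X + τ * X + c * (A + e * X) + u * A + u * (τ * X) + u * c * A + u * c * (τ * X)) := by ring
  rw [e1]
  exact le_self_add

lemma small_t {C e : ℝ} (hC : 0 < C) (he : 0 < e) : ∃ t0 : ℝ, 0 < t0 ∧ t0 ≤ 1 ∧ ∀ t, 0 < t → t ≤ t0 →
    C * (t ^ e + t) ≤ 1 / 2 := by
  refine ⟨min 1 (min (1 / (4 * C)) ((1 / (4 * C)) ^ (1 / e))), by positivity, min_le_left _ _, fun t ht h => ?_⟩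
  have h1 : t ≤ 1 / (4 * C) := h.trans ((min_le_right _ _).trans (min_le_left _ _))
  have h2 : t ≤ (1 / (4 * C)) ^ (1 / e) := h.trans ((min_le_right _ _).trans (min_le_right _ _))
  have h3 : t ^ e ≤ 1 / (4 * C) := by
    calc t ^ e ≤ ((1 / (4 * C)) ^ (1 / e)) ^ e := rpow_le_rpow ht.le h2 he.le
      _ = _ := by rw [← rpow_mul (by positivity), one_div_mul_cancel he.ne', rpow_one]
  calc C * (t ^ e + t) ≤ C * (1 / (4 * C) + 1 / (4 * C)) := by gcongr
    _ = 1 / 2 := by field_simp; norm_num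

/-- Lower bound for the action on `h`. -/
lemma K1 (S : Setup d a ν η) : ∃ t0 c : ℝ, 0 < t0 ∧ t0 ≤ 1 ∧ 0 < c ∧ ∀ s t : ℝ, 0 < s → s ≤ t → t ≤ t0 →
    ∀ x : Ed d, x ≠ 0 → ‖x‖ ≤ t ^ (1 / (2 * a)) → ENNReal.ofReal c * Jf ν ‖x‖ ≤
      Ap (pt a ν η) (fun z => Jf ν ‖z‖) s x := by
  obtain ⟨C, hC, h⟩ := S.K1pre
  obtain ⟨t0, ht0, ht1, hsm⟩ := small_t hC (div_pos S.hν S.ha)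
  refine ⟨t0, 1 / (2 * C), ht0, ht1, by positivity, fun s t hs hst ht x hx hxR => ?_⟩
  have hx0 : 0 < ‖x‖ := norm_pos_iff.2 hx
  have h1 := h s t hs hst (ht.trans ht1) x hx hxR
  have hX := Jf_ne_top S.hν hx0
  have h2 : ENNReal.ofReal C * ((ENNReal.ofReal (t ^ (ν / a)) + ENNReal.ofReal t) * Jf ν ‖x‖) ≤ Jf ν ‖x‖ / 2 := by
    rw [← ENNReal.ofReal_add (rpow_nonneg (by linarith) _) (by linarith), ← mul_assoc, ← ENNReal.ofReal_mul hC.le]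
    refine (mul_le_mul_left (ENNReal.ofReal_le_ofReal (hsm t (by linarith) ht)) _).trans (le_of_eq ?_)
    rw [ENNReal.ofReal_div_of_pos (by norm_num), ENNReal.div_eq_inv_mul, ENNReal.div_eq_inv_mul]
    simp
  rw [mul_add] at h1
  have h3 := absorb hX (h1.trans (add_le_add_right h2 _))
  calc _ ≤ ENNReal.ofReal (1 / (2 * C)) * (2 * (ENNReal.ofReal C * Ap (pt a ν η) (fun z => Jf ν ‖z‖) s x)) := by gcongr
    _ = (ENNReal.ofReal (1 / (2 * C)) * ENNReal.ofReal (2 * C)) * Ap (pt a ν η) (fun z => Jf ν ‖z‖) s x := by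
        rw [ENNReal.ofReal_mul (p := 2) zero_le_two, ENNReal.ofReal_ofNat]; ring
    _ = _ := by
        rw [← ENNReal.ofReal_mul (by positivity), one_div_mul_cancel (by positivity), ENNReal.ofReal_one, one_mul]

end Setup

lemma Jf_le2 {μ : ℝ} (hμ : 0 < μ) : ∃ C : ℝ, 0 < C ∧ ∀ ρ, 0 < ρ → Jf μ ρ ≤ ENNReal.ofReal (C * ρ ^ (-(2 * μ))) := by
  have := Real.Gamma_pos_of_pos hμ
  refine ⟨Gamma μ * 4 ^ μ, by positivity, fun ρ hρ => ?_⟩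
  have h := Jf_le hμ hρ
  rwa [rpow_half_sq hρ, ← mul_assoc] at h

lemma R_pow {a t : ℝ} (ha : 0 < a) (ht : 0 < t) (e : ℝ) : (t ^ (1 / (2 * a))) ^ (2 * e) = t ^ (e / a) := by
  rw [← rpow_mul ht.le]; congr 1; field_simp

namespace Setup
variable {d : ℕ} {a ν : ℝ} {η : Measure ℝ}

/-- Pointwise comparison of `J_{ν'}` with `h`. -/
lemma Jprime (S : Setup d a ν η) {ν' : ℝ} (h0 : 0 < ν') (h1 : ν' < ν) : ∃ C : ℝ, 0 < C ∧ ∀ t ρ : ℝ, 0 < t → t ≤ 1 →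
    0 < ρ → Jf ν' ρ ≤ ENNReal.ofReal C * (ENNReal.ofReal (t ^ ((ν - ν') / a)) * Jf ν ρ + ENNReal.ofReal (t ^ (-ν' / a))) := by
  obtain ⟨C1, hC1, hJ⟩ := Jf_le2 h0
  obtain ⟨c, hc, hL⟩ := Jf_ge_L ν (L := 1) S.hν
  have ha := S.ha
  refine ⟨C1 / c + C1, by positivity, fun t ρ ht ht1 hρ => ?_⟩
  have hR : t ^ (1 / (2 * a)) ≤ 1 := rpow_le_one ht.le ht1 (by positivity)
  have hR0 : 0 < t ^ (1 / (2 * a)) := by positivity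
  refine (hJ ρ hρ).trans ?_
  rcases le_total ρ (t ^ (1 / (2 * a))) with h | h
  · have h2 := hL ρ hρ (h.trans hR)
    have h3 : ρ ^ (2 * (ν - ν')) ≤ t ^ ((ν - ν') / a) := by
      rw [← R_pow ha ht]; exact rpow_le_rpow hρ.le h (by linarith)
    have h4 : ρ ^ (-(2 * ν')) = ρ ^ (2 * (ν - ν')) * ρ ^ (-(2 * ν)) := by rw [← rpow_add hρ]; congr 1; ring
    calc ENNReal.ofReal (C1 * ρ ^ (-(2 * ν'))) ≤ ENNReal.ofReal ((C1 / c) * (t ^ ((ν - ν') / a) * (c * ρ ^ (-(2 * ν))))) := by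
          refine ENNReal.ofReal_le_ofReal ?_
          rw [h4]
          calc _ ≤ C1 * (t ^ ((ν - ν') / a) * ρ ^ (-(2 * ν))) := by gcongr
            _ = _ := by field_simp
      _ = ENNReal.ofReal (C1 / c) * (ENNReal.ofReal (t ^ ((ν - ν') / a)) * ENNReal.ofReal (c * ρ ^ (-(2 * ν)))) := by
          rw [ENNReal.ofReal_mul (by positivity), ENNReal.ofReal_mul (by positivity)]
      _ ≤ _ := by
          refine mul_le_mul' (ENNReal.ofReal_le_ofReal (by linarith)) ?_
          exact le_trans (mul_le_mul_right h2 _) le_self_add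
  · have h3 : ρ ^ (-(2 * ν')) ≤ t ^ (-ν' / a) := by
      rw [← R_pow ha ht, mul_neg]; exact rpow_le_rpow_of_nonpos hR0 h (by linarith)
    calc ENNReal.ofReal (C1 * ρ ^ (-(2 * ν'))) ≤ ENNReal.ofReal (C1 * t ^ (-ν' / a)) := by
          refine ENNReal.ofReal_le_ofReal ?_; gcongr
      _ = ENNReal.ofReal C1 * ENNReal.ofReal (t ^ (-ν' / a)) := ENNReal.ofReal_mul hC1.le
      _ ≤ _ := by
          refine mul_le_mul' (ENNReal.ofReal_le_ofReal ?_) le_add_self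
          have : 0 < C1 / c := by positivity
          linarith

/-- Upper bound for the potential of `q J_{ν'}`. -/
lemma K2 (S : Setup d a ν η) : ∃ ν' C : ℝ, 0 < ν' ∧ ν' < ν ∧ ν - ν' < a ∧ 0 < C ∧ ∀ t : ℝ, 0 < t → t ≤ 1 →
    ∀ x : Ed d, x ≠ 0 → ‖x‖ ≤ t ^ (1 / (2 * a)) →
    Ti (pt a ν η) (fun z => qe d a ν z * Jf ν' ‖z‖) t x ≤
      ENNReal.ofReal C * (ENNReal.ofReal (t ^ ((ν - ν') / a)) * Jf ν ‖x‖) := by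
  obtain ⟨ν', ν0, K, C, σ, hν'0, hν'ν0, hν0ν, hκ, hK, hC, hσ0, hσ1, hσ, -⟩ := exists_aux S.ha S.ha1 S.hν S.hνn
  obtain ⟨CU, hCU, hU⟩ := S.U1n
  have hν'ν : ν' < ν := by linarith
  obtain ⟨C3, hC3, hJ⟩ := S.Jprime hν'0 hν'ν
  have ha := S.ha
  have hνd := S.hνd
  have hσ' : 0 < 1 - σ := by linarith
  refine ⟨ν', (4 / (1 - σ)) * ((1 + C) * (C3 * (1 + CU))), hν'0, hν'ν, hκ, by positivity,
    fun t ht ht1 x hx hxR => ?_⟩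
  have mh : Measurable fun z : Ed d => Jf ν ‖z‖ := Jf_norm_meas ν
  have m1 : Measurable fun z : Ed d => Jf ν' ‖z‖ := Jf_norm_meas ν'
  have m2 : Measurable fun z : Ed d => ENNReal.ofReal (cnu d a ν') * Jf (ν' + a) ‖z‖ := (Jf_norm_meas _).const_mul _
  have hub : ∀ z : Ed d, Jf ν' ‖z‖ ≤ 1 * (Jf ν ‖z‖ + 1) := fun z => by
    rw [one_mul]; exact Jf_le_add_one hν'0 hν'ν.le _
  have hup := (S.bal (μ := ν') (by linarith)).upper S.ker (qe_meas d a ν) m1 m2 hσ0 hσ1 (C := ENNReal.ofReal C) (by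
      filter_upwards [S.ae_ne] with z hz
      have hz0 : 0 < ‖z‖ := norm_pos_iff.2 hz
      have h3 := ENNReal.ofReal_le_ofReal (hσ _ hz0)
      have hc2 : 0 ≤ cnu d a ν' := (cnu_pos ha (by linarith)).le
      have j4 : 0 ≤ Jr ν' ‖z‖ := (Jr_pos (by linarith) hz0).le
      have j5 : 0 ≤ Vr d a ν ‖z‖ := (Vr_pos ha S.hν hνd hz0).le
      rw [ENNReal.ofReal_mul hc2, ENNReal.ofReal_mul (by positivity), ENNReal.ofReal_add (by positivity) hC,
        ENNReal.ofReal_mul hσ0, 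
        ofReal_Jr (by linarith) hz0, ofReal_Jr (by linarith) hz0] at h3
      exact h3) ht x (fun θ hθ => S.fin_geo ENNReal.one_ne_top hub ht hx hθ)
  have hAp : ∀ s, 0 < s → s ≤ t → Ap (pt a ν η) (fun z => Jf ν' ‖z‖) s x ≤
      ENNReal.ofReal (C3 * (1 + CU)) * (ENNReal.ofReal (t ^ ((ν - ν') / a)) * Jf ν ‖x‖) := by
    intro s hs hst
    have mm1 : Measurable fun z : Ed d => ENNReal.ofReal (t ^ ((ν - ν') / a)) * Jf ν ‖z‖ := mh.const_mul _
    have mm : Measurable fun z : Ed d => ENNReal.ofReal (t ^ ((ν - ν') / a)) * Jf ν ‖z‖ + ENNReal.ofReal (t ^ (-ν' / a)) * 1 :=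
      mm1.add_const _
    have h1 : Ap (pt a ν η) (fun z => Jf ν' ‖z‖) s x ≤ ENNReal.ofReal C3 *
        (ENNReal.ofReal (t ^ ((ν - ν') / a)) * Ap (pt a ν η) (fun z => Jf ν ‖z‖) s x +
          ENNReal.ofReal (t ^ (-ν' / a)) * Ap (pt a ν η) (fun _ => 1) s x) := by
      rw [← Ap_smul S.ptker mh, ← Ap_smul S.ptker measurable_const, ← Ap_add S.ptker mm1, ← Ap_smul S.ptker mm]
      refine Ap_mono ?_ s x
      filter_upwards [S.ae_ne] with z hz
      rw [mul_one]
      exact hJ t ‖z‖ ht ht1 (norm_pos_iff.2 hz)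
    refine h1.trans ?_
    rw [ENNReal.ofReal_mul hC3.le, mul_assoc]
    refine mul_le_mul_right ?_ _
    rw [ENNReal.ofReal_add zero_le_one hCU.le, ENNReal.ofReal_one, add_mul, one_mul]
    refine add_le_add (mul_le_mul_right (S.sup_Ap hs x) _) ?_
    refine (mul_le_mul_right (hU s t hs hst ht1 x hx hxR) _).trans (le_of_eq ?_)
    have e1 : t ^ ((ν - ν') / a) = t ^ (-ν' / a) * t ^ (ν / a) := by rw [← rpow_add ht]; congr 1; ring
    rw [e1, ENNReal.ofReal_mul (by positivity)]
    ring
  have hTi : Ti (pt a ν η) (fun z => Jf ν' ‖z‖) t x ≤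
      ENNReal.ofReal (C3 * (1 + CU)) * (ENNReal.ofReal (t ^ ((ν - ν') / a)) * Jf ν ‖x‖) := by
    refine (Ti_le_of S.ptker hAp).trans ?_
    refine (mul_le_mul_left (ENNReal.ofReal_le_one.2 ht1) _).trans ?_
    rw [one_mul]
  have h5 := hup.trans (add_le_add (hAp t ht le_rfl) (mul_le_mul_right hTi _))
  rw [ENNReal.ofReal_mul (p := 4 / (1 - σ)) (by positivity), mul_assoc]
  calc _ = ENNReal.ofReal (4 / (1 - σ)) * (ENNReal.ofReal ((1 - σ) / 4) * Ti (pt a ν η) (fun z => qe d a ν z * Jf ν' ‖z‖) t x) := by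
        rw [← mul_assoc, ← ENNReal.ofReal_mul (by positivity)]
        have : 4 / (1 - σ) * ((1 - σ) / 4) = 1 := by field_simp
        rw [this, ENNReal.ofReal_one, one_mul]
    _ ≤ _ := by
        refine mul_le_mul_right (h5.trans (le_of_eq ?_)) _
        rw [ENNReal.ofReal_mul (p := 1 + C) (by positivity), ENNReal.ofReal_add zero_le_one hC, ENNReal.ofReal_one]
        ring

/-- The contribution of a small neighbourhood of the origin. -/
lemma nearTi (S : Setup d a ν η) : ∃ C e : ℝ, 0 < C ∧ 0 < e ∧ ∀ ε t : ℝ, 0 < ε → ε ≤ 1 → 0 < t → t ≤ 1 →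
    ∀ x : Ed d, x ≠ 0 → ‖x‖ ≤ t ^ (1 / (2 * a)) →
    Ti (pt a ν η) ({z : Ed d | ‖z‖ ≤ ε * t ^ (1 / (2 * a))}.indicator fun z => Jf ν ‖z‖) t x ≤
      ENNReal.ofReal (C * ε ^ e) * (ENNReal.ofReal t * Jf ν ‖x‖) := by
  obtain ⟨ν', C, hν', hν'ν, hκ, hC, h2⟩ := S.K2
  obtain ⟨cV, hcV, hV⟩ := Vr_lower (L := 1) S.ha S.hν S.hνd
  obtain ⟨C1, hC1, hJ⟩ := Jf_le2 S.hν
  obtain ⟨c', hc', hL⟩ := Jf_ge_L ν' (L := 1) hν'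
  have ha := S.ha
  refine ⟨C1 / (cV * c') * C, 2 * (a - (ν - ν')), by positivity, by linarith, fun ε t hε hε1 ht ht1 x hx hxR => ?_⟩
  have hR : t ^ (1 / (2 * a)) ≤ 1 := rpow_le_one ht.le ht1 (by positivity)
  have hR0 : 0 < t ^ (1 / (2 * a)) := by positivity
  have m1 : Measurable fun z : Ed d => qe d a ν z * Jf ν' ‖z‖ := (qe_meas d a ν).mul (Jf_norm_meas ν')
  have e1 : t = t ^ (1 - (ν - ν') / a) * t ^ ((ν - ν') / a) := by
    rw [← rpow_add ht]; simp
  calc _ ≤ Ti (pt a ν η) (fun z => ENNReal.ofReal (C1 / (cV * c') * (ε ^ (2 * (a - (ν - ν'))) * t ^ (1 - (ν - ν') / a))) * 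
        (qe d a ν z * Jf ν' ‖z‖)) t x := by
        refine Ti_mono ?_ t x
        filter_upwards [S.ae_ne] with z hz
        have hz0 : 0 < ‖z‖ := norm_pos_iff.2 hz
        by_cases hzR : ‖z‖ ≤ ε * t ^ (1 / (2 * a))
        · rw [indicator_of_mem (show z ∈ {z : Ed d | ‖z‖ ≤ ε * t ^ (1 / (2 * a))} from hzR)]
          have hz1 : ‖z‖ ≤ 1 := hzR.trans (mul_le_one₀ hε1 hR0.le hR)
          have q1 := ENNReal.ofReal_le_ofReal (hV _ hz0 hz1)
          have j1 := hL _ hz0 hz1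
          have q2 : ‖z‖ ^ (2 * (a - (ν - ν'))) ≤ ε ^ (2 * (a - (ν - ν'))) * t ^ (1 - (ν - ν') / a) := by
            have : 1 - (ν - ν') / a = (a - (ν - ν')) / a := by field_simp
            rw [this, ← R_pow ha ht, ← mul_rpow hε.le hR0.le]
            exact rpow_le_rpow hz0.le hzR (by linarith)
          have e2 : ‖z‖ ^ (-(2 * ν)) = ‖z‖ ^ (2 * (a - (ν - ν'))) * (‖z‖ ^ (-(2 * a)) * ‖z‖ ^ (-(2 * ν'))) := by
            rw [← rpow_add hz0, ← rpow_add hz0]; congr 1; ring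
          calc Jf ν ‖z‖ ≤ ENNReal.ofReal (C1 * ‖z‖ ^ (-(2 * ν))) := hJ _ hz0
            _ ≤ ENNReal.ofReal (C1 / (cV * c') * (ε ^ (2 * (a - (ν - ν'))) * t ^ (1 - (ν - ν') / a)) *
                  ((cV * ‖z‖ ^ (-(2 * a))) * (c' * ‖z‖ ^ (-(2 * ν'))))) := by
                refine ENNReal.ofReal_le_ofReal ?_
                rw [e2]
                calc _ ≤ C1 * ((ε ^ (2 * (a - (ν - ν'))) * t ^ (1 - (ν - ν') / a)) * (‖z‖ ^ (-(2 * a)) * ‖z‖ ^ (-(2 * ν')))) := by gcongr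
                  _ = _ := by field_simp
            _ = ENNReal.ofReal (C1 / (cV * c') * (ε ^ (2 * (a - (ν - ν'))) * t ^ (1 - (ν - ν') / a))) *
                  (ENNReal.ofReal (cV * ‖z‖ ^ (-(2 * a))) * ENNReal.ofReal (c' * ‖z‖ ^ (-(2 * ν')))) := by
                rw [ENNReal.ofReal_mul (by positivity), ENNReal.ofReal_mul (p := cV * ‖z‖ ^ (-(2 * a))) (by positivity)]
            _ ≤ _ := mul_le_mul_right (mul_le_mul' q1 j1) _
        · rw [indicator_of_notMem (show z ∉ {z : Ed d | ‖z‖ ≤ ε * t ^ (1 / (2 * a))} from hzR)]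
          exact bot_le
    _ = ENNReal.ofReal (C1 / (cV * c') * (ε ^ (2 * (a - (ν - ν'))) * t ^ (1 - (ν - ν') / a))) *
        Ti (pt a ν η) (fun z => qe d a ν z * Jf ν' ‖z‖) t x := Ti_smul S.ptker m1 _ _ _
    _ ≤ ENNReal.ofReal (C1 / (cV * c') * (ε ^ (2 * (a - (ν - ν'))) * t ^ (1 - (ν - ν') / a))) *
        (ENNReal.ofReal C * (ENNReal.ofReal (t ^ ((ν - ν') / a)) * Jf ν ‖x‖)) := mul_le_mul_right (h2 t ht ht1 x hx hxR) _
    _ = _ := by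
        rw [← mul_assoc, ← mul_assoc, ← ENNReal.ofReal_mul (by positivity), ← ENNReal.ofReal_mul (by positivity),
          ← mul_assoc (ENNReal.ofReal _) (ENNReal.ofReal t), ← ENNReal.ofReal_mul (by positivity)]
        congr 2
        calc _ = C1 / (cV * c') * C * ε ^ (2 * (a - (ν - ν'))) * (t ^ (1 - (ν - ν') / a) * t ^ ((ν - ν') / a)) := by ring
          _ = _ := by rw [← e1]

lemma small_eM {C e f c : ℝ} (hC : 0 < C) (he : 0 < e) (hf : 0 < f) (hc : 0 < c) : ∃ ε M : ℝ, 0 < ε ∧ ε ≤ 1 ∧ 1 ≤ M ∧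
    C * ε ^ e + C * M ^ (-f) ≤ c / 2 := by
  have h1 : Tendsto (fun ε : ℝ => ε ^ e) (nhdsWithin 0 (Ioi 0)) (nhds 0) := by
    have := (continuous_rpow_const he.le).tendsto (0:ℝ)
    rw [zero_rpow he.ne'] at this
    exact this.mono_left nhdsWithin_le_nhds
  have h2 := tendsto_rpow_neg_atTop hf
  have h3 : ∀ᶠ ε : ℝ in nhdsWithin 0 (Ioi 0), ε ^ e < c / (4 * C) := h1.eventually (gt_mem_nhds (by positivity))
  have h4 : ∀ᶠ M : ℝ in atTop, M ^ (-f) < c / (4 * C) := h2.eventually (gt_mem_nhds (by positivity))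
  have h5 : ∀ᶠ ε : ℝ in nhdsWithin 0 (Ioi 0), ε ∈ Ioc (0:ℝ) 1 := Ioc_mem_nhdsGT one_pos
  obtain ⟨ε, hε, hε1⟩ := (h3.and h5).exists
  obtain ⟨M, hM, hM1⟩ := (h4.and (eventually_ge_atTop 1)).exists
  refine ⟨ε, M, hε1.1, hε1.2, hM1, ?_⟩
  calc C * ε ^ e + C * M ^ (-f) ≤ C * (c / (4 * C)) + C * (c / (4 * C)) := by gcongr
    _ = c / 2 := by field_simp; norm_num

/-- The perturbed process started near the origin spends enough time in a ball. -/
lemma mid (S : Setup d a ν η) : ∃ t0 M c : ℝ, 0 < t0 ∧ t0 ≤ 1 ∧ 1 ≤ M ∧ 0 < c ∧ ∀ t : ℝ, 0 < t → t ≤ t0 →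
    ∀ x : Ed d, x ≠ 0 → ‖x‖ ≤ t ^ (1 / (2 * a)) →
    ENNReal.ofReal (c * t * t ^ (ν / a)) * Jf ν ‖x‖ ≤
      Ti (pt a ν η) ({z : Ed d | ‖z‖ ≤ M * t ^ (1 / (2 * a))}.indicator fun _ => 1) t x := by
  obtain ⟨t0, c1, ht0, ht01, hc1, hK1⟩ := S.K1
  obtain ⟨C, e, hC, he, hN⟩ := S.nearTi
  obtain ⟨CU, hCU, hU⟩ := S.U1n
  obtain ⟨C1, hC1, hJ⟩ := Jf_le2 S.hν
  have ha := S.ha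
  have hν := S.hν
  obtain ⟨ε, M, hε, hε1, hM, hsm⟩ := small_eM (C := C + C1 * CU) (e := e) (f := 2 * ν) (c := c1) (by positivity) he (by positivity) hc1
  have hM0 : 0 < M := by linarith
  refine ⟨t0, M, c1 / (2 * (C1 * ε ^ (-(2 * ν)))), ht0, ht01, hM, by positivity, fun t ht htt x hx hxR => ?_⟩
  have ht1 : t ≤ 1 := htt.trans ht01
  have hx0 : 0 < ‖x‖ := norm_pos_iff.2 hx
  have hR0 : 0 < t ^ (1 / (2 * a)) := by positivity
  set R := t ^ (1 / (2 * a)) with hRdef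
  have hX := Jf_ne_top hν hx0
  set X := Jf ν ‖x‖ with hXd
  have h1 : ENNReal.ofReal t * (ENNReal.ofReal c1 * X) ≤ Ti (pt a ν η) (fun z => Jf ν ‖z‖) t x :=
    le_Ti_of S.ptker fun s hs hst => hK1 s t hs hst htt x hx hxR
  set sE : Set (Ed d) := {z | ‖z‖ ≤ ε * R} with hsE
  set sM : Set (Ed d) := {z | ‖z‖ ≤ M * R} with hsM
  have msE : MeasurableSet sE := measurableSet_le measurable_norm measurable_const
  have msM : MeasurableSet sM := measurableSet_le measurable_norm measurable_const
  have m1 : Measurable (sE.indicator fun z : Ed d => Jf ν ‖z‖) := (Jf_norm_meas ν).indicator msE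
  have m2 : Measurable (sM.indicator fun _ : Ed d => (1 : ENNReal)) := measurable_const.indicator msM
  have m3 : Measurable fun z : Ed d => ENNReal.ofReal (C1 * ε ^ (-(2 * ν)) * t ^ (-ν / a)) * sM.indicator (fun _ => 1) z :=
    m2.const_mul _
  have hpt : Ti (pt a ν η) (fun z => Jf ν ‖z‖) t x ≤ Ti (pt a ν η) (fun z => sE.indicator (fun z : Ed d => Jf ν ‖z‖) z +
      (ENNReal.ofReal (C1 * ε ^ (-(2 * ν)) * t ^ (-ν / a)) * sM.indicator (fun _ => 1) z +
        ENNReal.ofReal (C1 * M ^ (-(2 * ν)) * t ^ (-ν / a)) * 1)) t x := by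
    refine Ti_mono ?_ t x
    filter_upwards [S.ae_ne] with z hz
    have hz0 : 0 < ‖z‖ := norm_pos_iff.2 hz
    have hpw : ∀ m : ℝ, 0 < m → m * R ≤ ‖z‖ → Jf ν ‖z‖ ≤ ENNReal.ofReal (C1 * m ^ (-(2 * ν)) * t ^ (-ν / a)) := by
      intro m hm hmz
      refine (hJ _ hz0).trans (ENNReal.ofReal_le_ofReal ?_)
      have : (m * R) ^ (-(2 * ν)) = m ^ (-(2 * ν)) * t ^ (-ν / a) := by
        rw [mul_rpow hm.le hR0.le, ← R_pow ha ht, ← hRdef, mul_neg]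
      rw [mul_assoc, ← this]
      exact mul_le_mul_of_nonneg_left (rpow_le_rpow_of_nonpos (by positivity) hmz (by linarith)) hC1.le
    by_cases hzE : ‖z‖ ≤ ε * R
    · rw [indicator_of_mem (show z ∈ sE from hzE)]; exact le_self_add
    · by_cases hzM : ‖z‖ ≤ M * R
      · rw [indicator_of_mem (show z ∈ sM from hzM), mul_one]
        exact (hpw ε hε (not_le.1 hzE).le).trans (le_self_add.trans le_add_self)
      · rw [mul_one]
        exact (hpw M hM0 (not_le.1 hzM).le).trans (le_add_self.trans le_add_self)
  rw [Ti_add S.ptker m1, Ti_add S.ptker m3, Ti_smul S.ptker m2, Ti_smul S.ptker measurable_const] at hpt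
  have h2 := hN ε t hε hε1 ht ht1 x hx hxR
  have h3 : Ti (pt a ν η) (fun _ => 1) t x ≤ ENNReal.ofReal t * (ENNReal.ofReal CU * (ENNReal.ofReal (t ^ (ν / a)) * X)) :=
    Ti_le_of S.ptker fun s hs hst => hU s t hs hst ht1 x hx hxR
  set Y := Ti (pt a ν η) (sM.indicator fun _ => 1) t x with hY
  have e1 : t ^ (-ν / a) * t ^ (ν / a) = 1 := by
    rw [← rpow_add ht]; simp [neg_div]
  have h4 : ENNReal.ofReal (C1 * M ^ (-(2 * ν)) * t ^ (-ν / a)) * Ti (pt a ν η) (fun _ => 1) t x ≤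
      ENNReal.ofReal (C1 * CU * M ^ (-(2 * ν))) * (ENNReal.ofReal t * X) := by
    refine (mul_le_mul_right h3 _).trans (le_of_eq ?_)
    have e2 : C1 * CU * M ^ (-(2 * ν)) = C1 * M ^ (-(2 * ν)) * t ^ (-ν / a) * CU * t ^ (ν / a) := by
      calc _ = C1 * M ^ (-(2 * ν)) * CU * (t ^ (-ν / a) * t ^ (ν / a)) := by rw [e1]; ring
        _ = _ := by ring
    rw [e2, ENNReal.ofReal_mul (q := t ^ (ν / a)) (by positivity), ENNReal.ofReal_mul (q := CU) (by positivity)]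
    ring
  have h5 : ENNReal.ofReal c1 * (ENNReal.ofReal t * X) ≤ ENNReal.ofReal (C1 * ε ^ (-(2 * ν)) * t ^ (-ν / a)) * Y +
      ENNReal.ofReal c1 * (ENNReal.ofReal t * X) / 2 := by
    calc ENNReal.ofReal c1 * (ENNReal.ofReal t * X) = ENNReal.ofReal t * (ENNReal.ofReal c1 * X) := by ring
      _ ≤ _ := h1.trans hpt
      _ ≤ ENNReal.ofReal (C * ε ^ e) * (ENNReal.ofReal t * X) + (ENNReal.ofReal (C1 * ε ^ (-(2 * ν)) * t ^ (-ν / a)) * Y +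
          ENNReal.ofReal (C1 * CU * M ^ (-(2 * ν))) * (ENNReal.ofReal t * X)) := add_le_add h2 (add_le_add_right h4 _)
      _ = ENNReal.ofReal (C1 * ε ^ (-(2 * ν)) * t ^ (-ν / a)) * Y +
          ENNReal.ofReal (C * ε ^ e + C1 * CU * M ^ (-(2 * ν))) * (ENNReal.ofReal t * X) := by
          rw [ENNReal.ofReal_add (by positivity) (by positivity)]; ring
      _ ≤ ENNReal.ofReal (C1 * ε ^ (-(2 * ν)) * t ^ (-ν / a)) * Y + ENNReal.ofReal (c1 / 2) * (ENNReal.ofReal t * X) := by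
          gcongr
          refine le_trans ?_ hsm
          have p1 : 0 < ε ^ e := by positivity
          have p2 : 0 < M ^ (-(2 * ν)) := by positivity
          have p3 : 0 < C1 * CU := by positivity
          nlinarith [mul_pos p3 p1, mul_pos hC p2]
      _ = _ := by
          rw [ENNReal.ofReal_div_of_pos two_pos, ENNReal.ofReal_ofNat, ENNReal.div_eq_inv_mul, ENNReal.div_eq_inv_mul]
          ring
  have h6 := absorb (ENNReal.mul_ne_top ENNReal.ofReal_ne_top (ENNReal.mul_ne_top ENNReal.ofReal_ne_top hX)) h5
  set D := C1 * ε ^ (-(2 * ν)) with hD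
  have hD0 : 0 < D := by positivity
  clear_value D
  calc ENNReal.ofReal (c1 / (2 * D) * t * t ^ (ν / a)) * X
      = ENNReal.ofReal (1 / (2 * D) * t ^ (ν / a)) * (ENNReal.ofReal c1 * (ENNReal.ofReal t * X)) := by
        rw [← mul_assoc, ← mul_assoc, ← ENNReal.ofReal_mul (by positivity), ← ENNReal.ofReal_mul (by positivity)]
        congr 2; ring
    _ ≤ ENNReal.ofReal (1 / (2 * D) * t ^ (ν / a)) * (2 * (ENNReal.ofReal (D * t ^ (-ν / a)) * Y)) := mul_le_mul_right h6 _
    _ = ENNReal.ofReal (1 / (2 * D) * t ^ (ν / a) * (2 * (D * t ^ (-ν / a)))) * Y := by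
        rw [ENNReal.ofReal_mul (p := 1 / (2 * D) * t ^ (ν / a)) (by positivity), ENNReal.ofReal_mul (p := 2) zero_le_two,
          ENNReal.ofReal_ofNat]
        ring
    _ = Y := by
        have : 1 / (2 * D) * t ^ (ν / a) * (2 * (D * t ^ (-ν / a))) = 1 := by
          calc _ = (1 / (2 * D) * (2 * D)) * (t ^ (-ν / a) * t ^ (ν / a)) := by ring
            _ = 1 := by rw [e1, mul_one, one_div_mul_cancel (by positivity)]
        rw [this, ENNReal.ofReal_one, one_mul]

end Setup

/-- The comparison function `1 + t^{ν/a} h(x)`. -/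
def HH {d : ℕ} (a ν t : ℝ) (x : Ed d) : ENNReal := 1 + ENNReal.ofReal (t ^ (ν / a)) * Jf ν ‖x‖

namespace Setup
variable {d : ℕ} {a ν : ℝ} {η : Measure ℝ}

lemma pe_le_pt (_S : Setup d a ν η) {t : ℝ} (ht : 0 < t) (x y : Ed d) : pe a η t x y ≤ pt a ν η t x y := by
  rw [← ke_pos ht]; exact le_kT t x y

lemma sck (S : Setup d a ν η) {t s : ℝ} (ht : 0 < t) (hs : 0 < s) (x y : Ed d) :
    ∫⁻ v, pt a ν η t x v * pt a ν η s v y ≤ pt a ν η (t + s) x y :=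
  kT_sck S.ker (qe_meas d a ν) S.ck ht hs x y

/-- One-sided lower bound. -/
lemma oneside (S : Setup d a ν η) {T : ℝ} (hT : 0 < T) : ∃ B : ENNReal, B ≠ ⊤ ∧ ∀ t : ℝ, 0 < t → t ≤ T →
    ∀ x y : Ed d, x ≠ 0 → HH a ν t x * pe a η t x y ≤ B * pt a ν η t x y := by
  obtain ⟨t0, M, c, ht0, ht01, hM, hc, hmid⟩ := S.mid
  obtain ⟨C1, hC1, hJ⟩ := Jf_le2 S.hν
  have ha := S.ha
  have hν := S.hν
  obtain ⟨C, hC, hH⟩ := pe_harnack S.hd S.h S.ha S.ha1 hT (K := 1 + M) (by linarith)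
  obtain ⟨ε, hεd⟩ : ∃ ε, ε = min (1 / 2) (t0 / T) := ⟨_, rfl⟩
  have hε : 0 < ε := by rw [hεd]; positivity
  have hε2 : ε ≤ 1 / 2 := by rw [hεd]; exact min_le_left _ _
  have hεT : ε * T ≤ t0 := by
    have : ε ≤ t0 / T := by rw [hεd]; exact min_le_right _ _
    rwa [le_div_iff₀ hT] at this
  refine ⟨(1 + ENNReal.ofReal (C1 * ε ^ (-ν / a))) + (1 + ENNReal.ofReal (1 / (c * ε ^ (ν / a))) * C), ?_, 
    fun t ht htT x y hx => ?_⟩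
  · simp only [ne_eq, ENNReal.add_eq_top, ENNReal.one_ne_top, ENNReal.ofReal_ne_top, false_or, or_self]
    exact ENNReal.mul_ne_top ENNReal.ofReal_ne_top hC
  have hx0 : 0 < ‖x‖ := norm_pos_iff.2 hx
  have hle := S.pe_le_pt ht x y
  obtain ⟨τ, hτd⟩ : ∃ τ, τ = ε * t := ⟨_, rfl⟩
  have hτ : 0 < τ := by rw [hτd]; positivity
  have hτ0 : τ ≤ t0 := by rw [hτd]; exact (mul_le_mul_of_nonneg_left htT hε.le).trans hεT
  have hτt : τ ≤ t / 2 := by rw [hτd]; nlinarith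
  have hr0 : 0 < τ ^ (1 / (2 * a)) := by positivity
  have hrt : τ ^ (1 / (2 * a)) ≤ t ^ (1 / (2 * a)) := rpow_le_rpow hτ.le (by linarith) (by positivity)
  rcases le_total (τ ^ (1 / (2 * a))) ‖x‖ with h | h
  · have h1 : ENNReal.ofReal (t ^ (ν / a)) * Jf ν ‖x‖ ≤ ENNReal.ofReal (C1 * ε ^ (-ν / a)) := by
      refine (mul_le_mul_right (hJ _ hx0) _).trans ?_
      rw [← ENNReal.ofReal_mul (by positivity)]
      refine ENNReal.ofReal_le_ofReal ?_
      have h2 : ‖x‖ ^ (-(2 * ν)) ≤ ε ^ (-ν / a) * t ^ (-ν / a) := by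
        rw [← mul_rpow hε.le ht.le, ← hτd, ← R_pow ha hτ, mul_neg]
        exact rpow_le_rpow_of_nonpos hr0 h (by linarith)
      have e1 : t ^ (-ν / a) * t ^ (ν / a) = 1 := by rw [← rpow_add ht]; simp [neg_div]
      calc t ^ (ν / a) * (C1 * ‖x‖ ^ (-(2 * ν))) ≤ t ^ (ν / a) * (C1 * (ε ^ (-ν / a) * t ^ (-ν / a))) := by gcongr
        _ = C1 * ε ^ (-ν / a) * (t ^ (-ν / a) * t ^ (ν / a)) := by ring
        _ = _ := by rw [e1, mul_one]
    refine mul_le_mul' ?_ hle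
    exact (add_le_add_right h1 1).trans le_self_add
  · have h1 := hmid τ hτ hτ0 x hx h
    set sM : Set (Ed d) := {z | ‖z‖ ≤ M * τ ^ (1 / (2 * a))} with hsM
    have msM : MeasurableSet sM := measurableSet_le measurable_norm measurable_const
    have m2 : Measurable (sM.indicator fun _ : Ed d => (1 : ENNReal)) := measurable_const.indicator msM
    have h2 : Ti (pt a ν η) (fun z => pe a η t x y * sM.indicator (fun _ => 1) z) τ x ≤
        ENNReal.ofReal τ * (C * pt a ν η t x y) := by
      refine Ti_le_of S.ptker fun s hs hsτ => ?_
      have hts : 0 < t - s := by linarith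
      calc Ap (pt a ν η) (fun z => pe a η t x y * sM.indicator (fun _ => 1) z) s x
          ≤ ∫⁻ z, C * (pt a ν η s x z * pt a ν η (t - s) z y) := by
            refine lintegral_mono fun z => ?_
            by_cases hz : z ∈ sM
            · simp only [indicator_of_mem hz, mul_one]
              have hz' : ‖z‖ ≤ M * τ ^ (1 / (2 * a)) := hz
              have h3 := hH t (t - s) ht htT (by linarith) (by linarith) x z y (by
                calc ‖x - z‖ ≤ ‖x‖ + ‖z‖ := norm_sub_le _ _
                  _ ≤ (1 + M) * τ ^ (1 / (2 * a)) := by linarith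
                  _ ≤ _ := by gcongr)
              calc pt a ν η s x z * pe a η t x y ≤ pt a ν η s x z * (C * pt a ν η (t - s) z y) :=
                    mul_le_mul_right (h3.trans (mul_le_mul_right (S.pe_le_pt hts z y) _)) _
                _ = _ := by ring
            · simp only [indicator_of_notMem hz, mul_zero]; exact bot_le
        _ = C * ∫⁻ z, (pt a ν η s x z * pt a ν η (t - s) z y) := lintegral_const_mul' _ _ hC
        _ ≤ C * pt a ν η t x y := by
            refine mul_le_mul_right ?_ _
            have := S.sck hs hts x y
            rwa [add_sub_cancel] at this
    rw [Ti_smul S.ptker m2] at h2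
    have h3 := (mul_le_mul_right h1 (pe a η t x y)).trans h2
    have h4 : ENNReal.ofReal (c * τ ^ (ν / a)) * Jf ν ‖x‖ * pe a η t x y ≤ C * pt a ν η t x y := by
      have e1 : c * τ * τ ^ (ν / a) = τ * (c * τ ^ (ν / a)) := by ring
      rw [e1, ENNReal.ofReal_mul hτ.le] at h3
      refine (ENNReal.mul_le_mul_iff_right (a := ENNReal.ofReal τ) (by simpa using hτ) ENNReal.ofReal_ne_top).1 ?_
      refine le_trans (le_of_eq ?_) h3
      ring
    have h5 : ENNReal.ofReal (t ^ (ν / a)) * Jf ν ‖x‖ * pe a η t x y ≤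
        ENNReal.ofReal (1 / (c * ε ^ (ν / a))) * C * pt a ν η t x y := by
      have e1 : t ^ (ν / a) = 1 / (c * ε ^ (ν / a)) * (c * τ ^ (ν / a)) := by
        rw [hτd, mul_rpow hε.le ht.le]; field_simp
      rw [e1, ENNReal.ofReal_mul (by positivity), mul_assoc, mul_assoc, mul_assoc _ C]
      refine mul_le_mul_right ?_ _
      rwa [← mul_assoc]
    unfold HH
    rw [add_mul, one_mul]
    refine (add_le_add hle h5).trans ?_
    rw [add_mul (1 + ENNReal.ofReal (C1 * ε ^ (-ν / a))), add_mul 1 (ENNReal.ofReal (1 / (c * ε ^ (ν / a))) * C), one_mul]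
    exact le_add_self

/-- Two-sided lower bound. -/
lemma main (S : Setup d a ν η) {T : ℝ} (hT : 0 < T) : ∃ B : ENNReal, B ≠ ⊤ ∧ ∀ t : ℝ, 0 < t → t ≤ T →
    ∀ x y : Ed d, x ≠ 0 → y ≠ 0 → HH a ν t x * HH a ν t y * pe a η t x y ≤ B * pt a ν η t x y := by
  obtain ⟨B, hB, h⟩ := S.oneside hT
  have ha := S.ha
  have hν := S.hν
  set k := ENNReal.ofReal (2 ^ (ν / a)) with hk
  have hHH : ∀ t : ℝ, 0 < t → ∀ x : Ed d, HH a ν t x ≤ k * HH a ν (t / 2) x := by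
    intro t ht x
    have e1 : t ^ (ν / a) = 2 ^ (ν / a) * (t / 2) ^ (ν / a) := by
      rw [← mul_rpow zero_le_two (by positivity)]; congr 1; ring
    unfold HH
    rw [mul_add, e1, ENNReal.ofReal_mul (by positivity), mul_one, mul_assoc]
    refine add_le_add_left ?_ _
    rw [hk, ← ENNReal.ofReal_one]
    exact ENNReal.ofReal_le_ofReal (one_le_rpow (by norm_num) (by positivity))
  refine ⟨k * k * (B * B), ENNReal.mul_ne_top (ENNReal.mul_ne_top ENNReal.ofReal_ne_top ENNReal.ofReal_ne_top)
    (ENNReal.mul_ne_top hB hB), fun t ht htT x y hx hy => ?_⟩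
  have ht2 : 0 < t / 2 := by positivity
  have htT2 : t / 2 ≤ T := by linarith
  have hck := pe_ck S.h S.ha ht2 ht2 x y
  have hs := S.sck ht2 ht2 x y
  rw [add_halves] at hck hs
  have hfin : ∀ x : Ed d, x ≠ 0 → HH a ν (t / 2) x ≠ ⊤ := fun x hx => by
    unfold HH
    exact ENNReal.add_ne_top.2 ⟨ENNReal.one_ne_top, ENNReal.mul_ne_top ENNReal.ofReal_ne_top
      (Jf_ne_top hν (norm_pos_iff.2 hx))⟩
  calc HH a ν t x * HH a ν t y * pe a η t x y
      ≤ (k * HH a ν (t / 2) x) * (k * HH a ν (t / 2) y) * pe a η t x y := by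
        gcongr
        · exact hHH t ht x
        · exact hHH t ht y
    _ = k * k * (HH a ν (t / 2) x * HH a ν (t / 2) y * ∫⁻ z, pe a η (t / 2) x z * pe a η (t / 2) z y) := by
        rw [hck]; ring
    _ = k * k * ∫⁻ z, HH a ν (t / 2) x * HH a ν (t / 2) y * (pe a η (t / 2) x z * pe a η (t / 2) z y) := by
        rw [lintegral_const_mul' _ _ (ENNReal.mul_ne_top (hfin x hx) (hfin y hy))]
    _ ≤ k * k * ∫⁻ z, B * B * (pt a ν η (t / 2) x z * pt a ν η (t / 2) z y) := by
        refine mul_le_mul_right (lintegral_mono fun z => ?_) _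
        have h1 := h (t / 2) ht2 htT2 x z hx
        have h2 := h (t / 2) ht2 htT2 y z hy
        rw [pe_symm, show pt a ν η (t / 2) y z = pt a ν η (t / 2) z y from
          kT_symm S.ker (qe_meas d a ν) S.symm _ _ _] at h2
        calc _ = (HH a ν (t / 2) x * pe a η (t / 2) x z) * (HH a ν (t / 2) y * pe a η (t / 2) z y) := by ring
          _ ≤ _ := mul_le_mul' h1 h2
          _ = _ := by ring
    _ = k * k * (B * B * ∫⁻ z, (pt a ν η (t / 2) x z * pt a ν η (t / 2) z y)) := by
        rw [lintegral_const_mul' _ _ (ENNReal.mul_ne_top hB hB)]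
    _ ≤ k * k * (B * B * pt a ν η t x y) := by gcongr
    _ = _ := by ring

end Setup

lemma int_eq_Jr (ν r : ℝ) : ∫ u in Ioi (0 : ℝ), u ^ (-ν - 1) * Real.exp (-u - r ^ 2 / (4 * u)) = Jr ν r := by
  unfold Jr Jf
  refine integral_eq_lintegral_of_nonneg_ae ?_ ?_
  · filter_upwards [ae_restrict_mem measurableSet_Ioi] with u hu
    have : (0:ℝ) < u := hu
    show 0 ≤ u ^ (-ν - 1) * Real.exp (-u - r ^ 2 / (4 * u))
    positivity
  · exact Measurable.aestronglyMeasurable (by fun_prop)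

lemma besselK_eq (ν r : ℝ) : besselK ν r = (1 / 2) * (r / 2) ^ ν * Jr ν r := by
  rw [besselK, int_eq_Jr]

lemma VProf_eq {d : ℕ} {α δ r : ℝ} (hδ : 0 < δ) (hr : 0 < r) :
    VProf d α δ r = Vr d (α / 2) (δ / 2) r := by
  have hJ := Jr_pos (ν := δ / 2) (by positivity) hr
  unfold VProf Vr cnu
  rw [besselK_eq, besselK_eq]
  have e1 : (δ + α) / 2 = δ / 2 + α / 2 := by ring
  have e2 : ((d:ℝ) - δ) / 2 = d / 2 - δ / 2 := by ring
  have e3 : ((d:ℝ) - δ - α) / 2 = d / 2 - δ / 2 - α / 2 := by ring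
  rw [e1, e2, e3, rpow_add (by positivity)]
  have e4 : (2:ℝ) ^ (α / 2) * (r / 2) ^ (α / 2) * r ^ (-(α / 2)) = 1 := by
    rw [← mul_rpow zero_le_two (by positivity), rpow_neg hr.le, mul_div_cancel₀ r two_ne_zero]
    exact mul_inv_cancel₀ (by positivity)
  have hp : (0:ℝ) < (r / 2) ^ (δ / 2) := by positivity
  generalize (r / 2) ^ (δ / 2) = p at *
  generalize Jr (δ / 2) r = j at *
  generalize Jr (δ / 2 + α / 2) r = j'
  generalize Gamma ((d:ℝ) / 2 - δ / 2) = g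
  generalize Gamma ((d:ℝ) / 2 - δ / 2 - α / 2) = g'
  calc _ = ((2:ℝ) ^ (α / 2) * (r / 2) ^ (α / 2) * r ^ (-(α / 2))) * (g / g') * (((1/2) * p) / ((1/2) * p)) * (j' / j) := by
        field_simp
    _ = _ := by rw [e4, div_self (by positivity)]; ring

lemma hBeta_eq {d : ℕ} (hd : 0 < d) {α δ : ℝ} (hα : 0 < α) (hδ : δ < d) {η : Measure ℝ} (h : IsSub (α / 2) η) :
    ∃ K : ℝ, 0 < K ∧ ∀ x : Ed d, hBeta d α δ x = K * Jr (δ / 2) ‖x‖ := by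
  have := h.prob
  have hb : 0 < ((d:ℝ) - δ) / 2 := by linarith
  have g1 := Real.Gamma_pos_of_pos hb
  have g2 := Real.Gamma_pos_of_pos (show 0 < ((d:ℝ) - δ) / 2 / (α / 2) by positivity)
  refine ⟨Gamma (((d:ℝ) - δ) / 2 / (α / 2)) / Gamma (((d:ℝ) - δ) / 2) * (4 * π) ^ (-(d:ℝ) / 2), by positivity, fun x => ?_⟩
  have h1 := pe_pot h (by positivity) hb x 0
  unfold hBeta hBetaM
  have e1 : ((d:ℝ) - α - δ) / α = ((d:ℝ) - δ) / 2 / (α / 2) - 1 := by field_simp; ring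
  rw [e1]
  have h2 : ∫ t in Ioi (0:ℝ), t ^ (((d:ℝ) - δ) / 2 / (α / 2) - 1) * relKernel d α 1 t x 0 =
      ∫ t in Ioi (0:ℝ), (ENNReal.ofReal (t ^ (((d:ℝ) - δ) / 2 / (α / 2) - 1)) * pe (α / 2) η t x 0).toReal := by
    refine setIntegral_congr_fun measurableSet_Ioi fun t (ht : 0 < t) => ?_
    rw [relKernel_eq hd hα h ht, ENNReal.toReal_mul, ENNReal.toReal_ofReal (by positivity)]
  rw [h2, integral_toReal, h1, ENNReal.toReal_mul, ENNReal.toReal_ofReal (by positivity), Jr, zero_sub, norm_neg]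
  · congr 3; ring
  · have : Measurable fun t : ℝ => pe (α / 2) η t x 0 := pe_meas2 (by fun_prop) (by fun_prop) (by fun_prop)
    exact Measurable.aemeasurable (by fun_prop)
  · filter_upwards [ae_restrict_mem measurableSet_Ioi] with t ht
    exact (ENNReal.mul_ne_top ENNReal.ofReal_ne_top (pe_ne_top hd h (by positivity) ht x 0)).lt_top

lemma kN_le_kT {E : Type*} [MeasureSpace E] {k : ℝ → E → E → ENNReal} {q : E → ENNReal} (n : ℕ) (t x y) :
    kN k q n t x y ≤ kT k q t x y := ENNReal.le_tsum (f := fun n => kN k q n t x y) n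

lemma pertN_eq {d : ℕ} {α δ : ℝ} (hα : 0 < α) (hδ : 0 < δ) {η : Measure ℝ} (S : Setup d (α / 2) (δ / 2) η) (n : ℕ) :
    ∀ t : ℝ, 0 < t → ∀ x y : Ed d, x ≠ 0 → y ≠ 0 → pertN d (relKernel d α 1) (Vbeta d α δ) n t x y =
      (kN (ke (α / 2) η) (qe d (α / 2) (δ / 2)) n t x y).toReal := by
  induction n with
  | zero =>
    intro t ht x y _ _
    show relKernel d α 1 t x y = (ke (α / 2) η t x y).toReal
    rw [ke_pos ht, relKernel_eq S.hd hα S.h ht]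
  | succ n ih =>
    intro t ht x y hx hy
    have hk := kN_ker S.ker (qe_meas d (α / 2) (δ / 2)) n
    have hfin : kN (ke (α / 2) η) (qe d (α / 2) (δ / 2)) (n + 1) t x y ≠ ⊤ :=
      ne_top_of_le_ne_top (S.pt_ne_top ht hx hy) (kN_le_kT _ _ _ _)
    set F : ℝ × Ed d → ENNReal := fun p => kN (ke (α / 2) η) (qe d (α / 2) (δ / 2)) n p.1 x p.2 *
      qe d (α / 2) (δ / 2) p.2 * ke (α / 2) η (t - p.1) p.2 y with hF
    have hFm : Measurable F := ((hk.m2 (by fun_prop) (by fun_prop) (by fun_prop)).mul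
      ((qe_meas d (α / 2) (δ / 2)).comp measurable_snd)).mul (S.ker.m2 (by fun_prop) (by fun_prop) (by fun_prop))
    have hIm : Measurable fun s : ℝ => ∫⁻ z, F (s, z) := hFm.lintegral_prod_right'
    have e1 : kN (ke (α / 2) η) (qe d (α / 2) (δ / 2)) (n + 1) t x y = ∫⁻ s in Ioo 0 t, ∫⁻ z, F (s, z) := by
      show stq _ _ _ t x y = _
      unfold stq
      rw [Measure.volume_eq_prod, lintegral_prod _ hFm.aemeasurable, ← lintegral_indicator measurableSet_Ioo]
      refine lintegral_congr fun s => ?_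
      by_cases hs : s ∈ Ioo 0 t
      · rw [indicator_of_mem hs]
      · rw [indicator_of_notMem hs]
        have : ∀ z, F (s, z) = 0 := by
          intro z
          simp only [mem_Ioo, not_and_or, not_lt] at hs
          rcases hs with hs | hs
          · simp [hF, hk.zero s hs]
          · simp [hF, S.ker.zero (t - s) (by linarith)]
        exact (lintegral_congr this).trans (by simp)
    rw [e1] at hfin ⊢
    have hae : ∀ᵐ s ∂(volume.restrict (Ioo 0 t)), ∫⁻ z, F (s, z) < ⊤ := ae_lt_top hIm hfin
    rw [← integral_toReal hIm.aemeasurable hae]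
    show (∫ s in Ioo (0 : ℝ) t, ∫ z : Ed d, pertN d (relKernel d α 1) (Vbeta d α δ) n s x z * Vbeta d α δ z * relKernel d α 1 (t - s) z y) = _
    refine setIntegral_congr_fun measurableSet_Ioo fun s hs => ?_
    have hs0 : 0 < s := hs.1
    have hts : 0 < t - s := sub_pos.2 hs.2
    have hFs : Measurable fun z => F (s, z) := hFm.comp (by fun_prop)
    rw [← integral_toReal hFs.aemeasurable]
    · refine integral_congr_ae ?_
      filter_upwards [S.ae_ne] with z hz
      have hz0 : 0 < ‖z‖ := norm_pos_iff.2 hz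
      have hV := (Vr_pos S.ha S.hν S.hνd hz0).le
      rw [ih s hs0 x z hx hz, relKernel_eq S.hd hα S.h hts, Vbeta, VProf_eq hδ hz0, hF]
      simp only
      rw [ENNReal.toReal_mul, ENNReal.toReal_mul, qe, ENNReal.toReal_ofReal hV, ke_pos hts]
    · filter_upwards [S.ae_ne] with z hz
      refine (ENNReal.mul_ne_top (ENNReal.mul_ne_top ?_ ENNReal.ofReal_ne_top) ?_).lt_top
      · exact ne_top_of_le_ne_top (S.pt_ne_top hs0 hx hz) (kN_le_kT _ _ _ _)
      · show ke (α / 2) η (t - s) z y ≠ ⊤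
        rw [ke_pos hts]; exact pe_ne_top S.hd S.h S.ha hts z y

lemma pert_eq {d : ℕ} {α δ : ℝ} (hα : 0 < α) (hδ : 0 < δ) {η : Measure ℝ} (S : Setup d (α / 2) (δ / 2) η)
    {t : ℝ} (ht : 0 < t) {x y : Ed d} (hx : x ≠ 0) (hy : y ≠ 0) :
    pert d (relKernel d α 1) (Vbeta d α δ) t x y = (pt (α / 2) (δ / 2) η t x y).toReal := by
  unfold pert pt kT
  rw [ENNReal.tsum_toReal_eq fun n => ne_top_of_le_ne_top (S.pt_ne_top ht hx hy) (kN_le_kT _ _ _ _)]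
  exact tsum_congr fun n => pertN_eq hα hδ S n t ht x y hx hy

/-- Lower bound for the perturbed kernel via `H(t,x) = 1 + h_δ(x)/h_δ(t^{1/α})`
(Theorem 4.11); since `h_δ` is radial, its profile value at `t^{1/α}` is `h_δ(w)` for
any `w` with `‖w‖ = t^{1/α}`. -/
theorem stmt_17 (d : ℕ) (α δ : ℝ) (hα : α ∈ Ioo 0 (min 2 (d : ℝ)))
    (hδ : δ ∈ Ioc 0 (((d : ℝ) - α) / 2)) (T : ℝ) (hT : 0 < T) :
    ∃ c : ℝ, 0 < c ∧ ∀ t ∈ Ioc (0 : ℝ) T, ∀ x y : Ed d, x ≠ 0 → y ≠ 0 →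
      ∀ w : Ed d, ‖w‖ = t ^ (1 / α) →
        c * (relKernel d α 1 t x y * (1 + hBeta d α δ x / hBeta d α δ w) *
            (1 + hBeta d α δ y / hBeta d α δ w)) ≤
          pert d (relKernel d α 1) (Vbeta d α δ) t x y := by
  obtain ⟨hα0, hαm⟩ := hα
  obtain ⟨hδ0, hδm⟩ := hδ
  have hα2 : α < 2 := hαm.trans_le (min_le_left _ _)
  have hαd : α < d := hαm.trans_le (min_le_right _ _)
  have hd : 0 < d := by
    have : (0:ℝ) < d := hα0.trans hαd
    exact_mod_cast this
  obtain ⟨η, hp, hn, hl⟩ := exists_subordinator (α / 2) (by positivity) (by linarith)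
  have hS : IsSub (α / 2) η := ⟨hp, hn, hl⟩
  have S : Setup d (α / 2) (δ / 2) η := ⟨hd, hS, by positivity, by linarith, by positivity, by linarith⟩
  obtain ⟨K, hK, hh⟩ := hBeta_eq hd hα0 (show δ < d by linarith) hS
  obtain ⟨B, hB, hmain⟩ := S.main hT
  obtain ⟨cL, hcL, hL⟩ := Jf_ge_L (δ / 2) (L := T ^ (1 / α)) S.hν
  obtain ⟨D, hDd⟩ : ∃ D, D = 1 + 1 / cL := ⟨_, rfl⟩
  have hD1 : 1 ≤ D := by rw [hDd]; have : 0 < 1 / cL := by positivity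
                         linarith
  have hD2 : 1 / cL ≤ D := by rw [hDd]; linarith
  refine ⟨1 / (D ^ 2 * (B.toReal + 1)), by positivity, fun t ht x y hx hy w hw => ?_⟩
  obtain ⟨ht0, htT⟩ := ht
  have hw0 : 0 < ‖w‖ := by rw [hw]; positivity
  have hJw := Jr_pos S.hν hw0
  have hexp : (δ / 2) / (α / 2) = δ / α := by field_simp
  have hrat : ∀ x : Ed d, x ≠ 0 → 0 ≤ 1 + hBeta d α δ x / hBeta d α δ w ∧
      1 + hBeta d α δ x / hBeta d α δ w ≤ D * (HH (α / 2) (δ / 2) t x).toReal ∧ HH (α / 2) (δ / 2) t x ≠ ⊤ := by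
    intro x hx
    have hx0 : 0 < ‖x‖ := norm_pos_iff.2 hx
    have hJx := Jr_pos S.hν hx0
    have e0 : hBeta d α δ x / hBeta d α δ w = Jr (δ / 2) ‖x‖ / Jr (δ / 2) ‖w‖ := by
      rw [hh, hh]; field_simp
    have h1 : cL * t ^ (-(δ / α)) ≤ Jr (δ / 2) ‖w‖ := by
      have h2 := hL ‖w‖ hw0 (by rw [hw]; exact rpow_le_rpow ht0.le htT (by positivity))
      rw [← ofReal_Jr S.hν hw0, ENNReal.ofReal_le_ofReal_iff hJw.le, hw, ← rpow_mul ht0.le] at h2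
      convert h2 using 3
      field_simp
    have hf : HH (α / 2) (δ / 2) t x = ENNReal.ofReal (1 + t ^ (δ / α) * Jr (δ / 2) ‖x‖) := by
      unfold HH
      rw [hexp, ENNReal.ofReal_add zero_le_one (by positivity), ENNReal.ofReal_one, ENNReal.ofReal_mul (by positivity),
        ofReal_Jr S.hν hx0]
    refine ⟨by rw [e0]; positivity, ?_, by rw [hf]; exact ENNReal.ofReal_ne_top⟩
    rw [e0, hf, ENNReal.toReal_ofReal (by positivity)]
    have h3 : Jr (δ / 2) ‖x‖ / Jr (δ / 2) ‖w‖ ≤ D * (t ^ (δ / α) * Jr (δ / 2) ‖x‖) := by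
      calc _ ≤ Jr (δ / 2) ‖x‖ / (cL * t ^ (-(δ / α))) := by gcongr
        _ = 1 / cL * (t ^ (δ / α) * Jr (δ / 2) ‖x‖) := by rw [rpow_neg ht0.le]; field_simp
        _ ≤ _ := by gcongr
    linarith
  obtain ⟨x0, x1, x2⟩ := hrat x hx
  obtain ⟨y0, y1, y2⟩ := hrat y hy
  have hm := hmain t ht0 htT x y hx hy
  have hptf := S.pt_ne_top ht0 hx hy
  have hm' := ENNReal.toReal_mono (ENNReal.mul_ne_top hB hptf) hm
  rw [ENNReal.toReal_mul, ENNReal.toReal_mul, ENNReal.toReal_mul] at hm'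
  rw [pert_eq hα0 hδ0 S ht0 hx hy, relKernel_eq hd hα0 hS ht0]
  have p0 : 0 ≤ (pe (α / 2) η t x y).toReal := ENNReal.toReal_nonneg
  have q0 : 0 ≤ (pt (α / 2) (δ / 2) η t x y).toReal := ENNReal.toReal_nonneg
  have b0 : 0 ≤ B.toReal := ENNReal.toReal_nonneg
  have hx' : 0 ≤ (HH (α / 2) (δ / 2) t x).toReal := ENNReal.toReal_nonneg
  have hy' : 0 ≤ (HH (α / 2) (δ / 2) t y).toReal := ENNReal.toReal_nonneg
  generalize (pe (α / 2) η t x y).toReal = p at *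
  generalize (pt (α / 2) (δ / 2) η t x y).toReal = q at *
  generalize (HH (α / 2) (δ / 2) t x).toReal = u at *
  generalize (HH (α / 2) (δ / 2) t y).toReal = v at *
  generalize B.toReal = b at *
  have hD0 : 0 < D := by linarith
  rw [one_div, inv_mul_le_iff₀ (by positivity)]
  calc _ ≤ p * (D * u) * (D * v) := by gcongr
    _ = D ^ 2 * (u * v * p) := by ring
    _ ≤ D ^ 2 * ((b + 1) * q) := mul_le_mul_of_nonneg_left (by linarith) (by positivity)
    _ = _ := by ring
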